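/- arXiv:0812.4963 — 3 statements merged into one kernel-verified Lean document; each statement's English description precedes it below -/
import Mathlib

section
/- With notation as in the context, the defining ideal 𝒜 of the Rees algebra 𝓡(I) equals the ideal ℒ = H + ( { G_{(a,j)} : a an eligible tuple, 1 ≤ j ≤ r(a) } ) of S. -/
open MvPolynomial

/-!
Common setup: `R = k[x,y]` (with `x = X 0`, `y = X 1`),
`S = R[T₁,…,T_m] = k[x,y,T₀,…,T_{m-1}]` (`m = m2 + 2`, variables `Fin 2 ⊕ Fin m`,
`x = X (inl 0)`, `y = X (inl 1)`, `Tᵢ = X (inr i)`, 0-indexed).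
`S` is bi-graded with `deg x = deg y = (1,0)`, `deg Tᵢ = (0,1)`.
The ideal `I` is generated by the signed maximal minors of the `m × (m−1)`
Hilbert–Burch matrix `φ = [φ' φ'']` whose linear part `φ'` is the block matrix with
diagonal blocks `D_{σ₁}` (and `D_{σ₂}`, the splitting being encoded by `σ₁` alone),
where `D_a` has `x` on the main diagonal and `−y` on the subdiagonal, and whose last
column `φ''` has entries of degree `n`.
-/

/-- The variable `Tᵢ` of `S` (0-indexed); junk value `0` if `i` is out of range. -/
noncomputable def Tvar (k : Type*) [Field k] (m : ℕ) (i : ℕ) :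
    MvPolynomial (Fin 2 ⊕ Fin m) k :=
  if h : i < m then X (Sum.inr ⟨i, h⟩) else 0

/-- The Hilbert–Burch matrix `φ = [φ' φ'']`: the linear part `φ'` is the block
diagonal matrix with blocks `D_{σ₁}` and `D_{m2-σ₁}` (a single block `D_{m2}` with a
zero row when `σ₁ = m2`, i.e. `ρ = 1`), and the last column is `col = φ''`. -/
noncomputable def hbMatrix (k : Type*) [Field k] (m2 σ₁ : ℕ)
    (col : Fin (m2 + 2) → MvPolynomial (Fin 2) k) :
    Matrix (Fin (m2 + 2)) (Fin (m2 + 1)) (MvPolynomial (Fin 2) k) :=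
  Matrix.of fun i j =>
    if (j : ℕ) = m2 then col i
    else if (j : ℕ) < σ₁ then
      (if (i : ℕ) = (j : ℕ) then X 0 else if (i : ℕ) = (j : ℕ) + 1 then -(X 1) else 0)
    else
      (if (i : ℕ) = (j : ℕ) + 1 then X 0 else if (i : ℕ) = (j : ℕ) + 2 then -(X 1) else 0)

/-- The signed maximal minors `δᵢ` of the Hilbert–Burch matrix: the generators of `I`. -/
noncomputable def hbDelta (k : Type*) [Field k] (m2 σ₁ : ℕ)
    (col : Fin (m2 + 2) → MvPolynomial (Fin 2) k) (i : Fin (m2 + 2)) :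
    MvPolynomial (Fin 2) k :=
  (-1) ^ (i : ℕ) * ((hbMatrix k m2 σ₁ col).submatrix i.succAbove id).det

/-- The ideal `I ⊆ R` generated by the maximal minors of the Hilbert-Burch matrix. -/
noncomputable def hbIdeal (k : Type*) [Field k] (m2 σ₁ : ℕ)
    (col : Fin (m2 + 2) → MvPolynomial (Fin 2) k) : Ideal (MvPolynomial (Fin 2) k) :=
  Ideal.span (Set.range (hbDelta k m2 σ₁ col))

/-- The map `Π : S → R[t] = R[It]`, `x,y ↦ x,y`, `Tᵢ ↦ δᵢ t`. -/
noncomputable def PiRees (k : Type*) [Field k] (m2 σ₁ : ℕ)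
    (col : Fin (m2 + 2) → MvPolynomial (Fin 2) k) :
    MvPolynomial (Fin 2 ⊕ Fin (m2 + 2)) k →ₐ[k] Polynomial (MvPolynomial (Fin 2) k) :=
  aeval (Sum.elim (fun i => Polynomial.C (X i))
    (fun i => Polynomial.C (hbDelta k m2 σ₁ col i) * Polynomial.X))

/-- The defining ideal `𝒜 = ker Π` of the Rees algebra `𝓡(I) = R[It]`. -/
noncomputable def reesDefIdeal (k : Type*) [Field k] (m2 σ₁ : ℕ)
    (col : Fin (m2 + 2) → MvPolynomial (Fin 2) k) :
    Ideal (MvPolynomial (Fin 2 ⊕ Fin (m2 + 2)) k) :=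
  RingHom.ker (PiRees k m2 σ₁ col).toRingHom

/-- Top row of the scroll matrix `ψ = [ψ₁ ⋯ ψ_ρ ψ_{ρ+1}]`, where `ψᵢ` (`i ≤ ρ`) is the
generic scroll block on the variables `T_{i,1},…,T_{i,σᵢ+1}` and `ψ_{ρ+1} = (y,x)ᵀ`.
(The relabelling `T_{1,j} = T_j`, `T_{2,j} = T_{σ₁+1+j}` is built in; only `σ₁` and
`m2 = σ₁ + ⋯ + σ_ρ` are needed to describe `ψ`.) -/
noncomputable def psiTop (k : Type*) [Field k] (m2 σ₁ : ℕ) (j : Fin (m2 + 1)) :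
    MvPolynomial (Fin 2 ⊕ Fin (m2 + 2)) k :=
  if (j : ℕ) = m2 then X (Sum.inl 1)
  else if (j : ℕ) < σ₁ then Tvar k (m2 + 2) (j : ℕ) else Tvar k (m2 + 2) ((j : ℕ) + 1)

/-- Bottom row of the scroll matrix `ψ`. -/
noncomputable def psiBot (k : Type*) [Field k] (m2 σ₁ : ℕ) (j : Fin (m2 + 1)) :
    MvPolynomial (Fin 2 ⊕ Fin (m2 + 2)) k :=
  if (j : ℕ) = m2 then X (Sum.inl 0)
  else if (j : ℕ) < σ₁ then Tvar k (m2 + 2) ((j : ℕ) + 1) else Tvar k (m2 + 2) ((j : ℕ) + 2)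

/-- `H = I₂(ψ) ⊆ S`. -/
noncomputable def scrollH (k : Type*) [Field k] (m2 σ₁ : ℕ) :
    Ideal (MvPolynomial (Fin 2 ⊕ Fin (m2 + 2)) k) :=
  Ideal.span {p | ∃ j j' : Fin (m2 + 1),
    p = psiTop k m2 σ₁ j * psiBot k m2 σ₁ j' - psiTop k m2 σ₁ j' * psiBot k m2 σ₁ j}

/-- The height one prime ideal `K ⊆ A = S/H` generated by the entries of the top row
of `ψ`. -/
noncomputable def scrollK (k : Type*) [Field k] (m2 σ₁ : ℕ) :
    Ideal (MvPolynomial (Fin 2 ⊕ Fin (m2 + 2)) k ⧸ scrollH k m2 σ₁) :=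
  Ideal.span (Set.range fun j : Fin (m2 + 1) =>
    Ideal.Quotient.mk (scrollH k m2 σ₁) (psiTop k m2 σ₁ j))

/-- The `n`-th symbolic power of an ideal `K` of `A` (for `K` prime this is
`K^{(n)} = ⋃_{s ∉ K} (Kⁿ :_A s)`, the `K`-primary component of `Kⁿ`). -/
noncomputable def symbolicPower {A : Type*} [CommRing A] (K : Ideal A) (n : ℕ) :
    Ideal A :=
  sSup {J : Ideal A | ∃ s : A, s ∉ K ∧ J = Submodule.colon (K ^ n) (Ideal.span {s})}

/-- `g = T·φ'' = Σᵢ Tᵢ·φ''ᵢ ∈ S`. -/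
noncomputable def scrollg (k : Type*) [Field k] (m2 : ℕ)
    (col : Fin (m2 + 2) → MvPolynomial (Fin 2) k) :
    MvPolynomial (Fin 2 ⊕ Fin (m2 + 2)) k :=
  ∑ i : Fin (m2 + 2), X (Sum.inr i) * rename Sum.inl (col i)

/-- Bi-homogeneity in `S`, with `deg x = deg y = (1,0)` and `deg Tᵢ = (0,1)`. -/
def IsBiHomogeneous {k : Type*} [Field k] {m : ℕ}
    (p : MvPolynomial (Fin 2 ⊕ Fin m) k) (u s : ℕ) : Prop :=
  IsWeightedHomogeneous (Sum.elim (fun _ : Fin 2 => 1) (fun _ : Fin m => 0)) p u ∧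
  IsWeightedHomogeneous (Sum.elim (fun _ : Fin 2 => 0) (fun _ : Fin m => 1)) p s

/-- An element of `A = S/H` is bi-homogeneous of bidegree `(u,s)` if it is the image of
a bi-homogeneous element of `S` of bidegree `(u,s)`. -/
def IsBiHomogeneousQuot {k : Type*} [Field k] {m2 σ₁ : ℕ}
    (a : MvPolynomial (Fin 2 ⊕ Fin (m2 + 2)) k ⧸ scrollH k m2 σ₁) (u s : ℕ) : Prop :=
  ∃ p : MvPolynomial (Fin 2 ⊕ Fin (m2 + 2)) k,
    IsBiHomogeneous p u s ∧ Ideal.Quotient.mk (scrollH k m2 σ₁) p = a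

/-- The height of an ideal: the infimum of the heights of the primes containing it. -/
noncomputable def idealHeight {R : Type*} [CommRing R] (I : Ideal R) : ℕ∞ :=
  ⨅ (p : PrimeSpectrum R) (_ : I ≤ p.asIdeal), Order.height p

/-- The hypotheses on the numerical data: `σ₁ ≥ 1`, `n ≥ 2`, and either `ρ = 1` (a single
block `D_{σ₁}`, `σ₁ = m−2`; by convention `σ₂ = 1` in this case) or `ρ = 2`
(two blocks, `σ₁ ≥ σ₂ ≥ 1`, `σ₁ + σ₂ = m−2`). -/
def ScrollData (m2 σ₁ σ₂ ρ n : ℕ) : Prop :=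
  1 ≤ σ₁ ∧ 2 ≤ n ∧
    ((ρ = 1 ∧ σ₁ = m2 ∧ σ₂ = 1) ∨ (ρ = 2 ∧ 1 ≤ σ₂ ∧ σ₂ ≤ σ₁ ∧ σ₁ + σ₂ = m2))

/-- The context hypotheses on the ideal `I`: the entries of `φ''` are forms of degree
`n`, `I` has height two and is minimally generated by the `m` maximal minors `δᵢ`. -/
def ScrollIdealData (k : Type*) [Field k] (m2 σ₁ n : ℕ)
    (col : Fin (m2 + 2) → MvPolynomial (Fin 2) k) : Prop :=
  (∀ i, (col i).IsHomogeneous n) ∧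
  idealHeight (hbIdeal k m2 σ₁ col) = 2 ∧
  (∀ i, hbDelta k m2 σ₁ col i ∉
    Ideal.span (hbDelta k m2 σ₁ col '' {i' | i' ≠ i}))

/-! Extra notation for Theorem A=L.  Throughout, `T_{1,j} = T_j` (`1 ≤ j ≤ σ₁+1`), and,
when `ρ = 2`, `T_{2,j} = T_{σ₁+1+j}` (`1 ≤ j ≤ σ₂+1`); when `ρ = 1` the convention
`σ₂ = 1`, `T_{2,1} = y`, `T_{2,2} = x` is in force.  `g = Σ_{i=0}^n cᵢ x^{n-i} yⁱ` where
the `cᵢ` are the (bidegree `(0,1)`) coefficient forms of `g`. -/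

/-- The double-indexed variable `T_{i,j}` (`i ∈ {1,2}`, `j` 1-indexed). -/
noncomputable def TT (k : Type*) [Field k] (m2 σ₁ ρ : ℕ) (i j : ℕ) :
    MvPolynomial (Fin 2 ⊕ Fin (m2 + 2)) k :=
  if i = 1 then Tvar k (m2 + 2) (j - 1)
  else if ρ = 2 then Tvar k (m2 + 2) (σ₁ + j)
  else if j = 1 then X (Sum.inl 1) else X (Sum.inl 0)

/-- The coefficient `cᵢ ∈ S` of `x^{n-i}yⁱ` in `g = T·φ''`. -/
noncomputable def cCoeff (k : Type*) [Field k] (m2 n : ℕ)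
    (col : Fin (m2 + 2) → MvPolynomial (Fin 2) k) (i : ℕ) :
    MvPolynomial (Fin 2 ⊕ Fin (m2 + 2)) k :=
  ∑ j : Fin (m2 + 2),
    MvPolynomial.C (MvPolynomial.coeff (Finsupp.single 0 (n - i) + Finsupp.single 1 i) (col j))
      * X (Sum.inr j)

/-- `Δ_b = c_b x^{n-b} + c_{b+1} x^{n-b-1} y + ⋯ + c_n y^{n-b}`. -/
noncomputable def DeltaPoly (k : Type*) [Field k] (m2 n : ℕ)
    (col : Fin (m2 + 2) → MvPolynomial (Fin 2) k) (b : ℕ) :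
    MvPolynomial (Fin 2 ⊕ Fin (m2 + 2)) k :=
  ∑ t ∈ Finset.range (n - b + 1),
    cCoeff k m2 n col (b + t) * X (Sum.inl 0) ^ (n - b - t) * X (Sum.inl 1) ^ t

/-- `π_{i,b} = c_b T_{i,σᵢ+1} + c_{b+1} T_{i,σᵢ} + ⋯ + c_{b+σᵢ-1} T_{i,2}`
(here `σi` is `σ_i`). -/
noncomputable def piPoly (k : Type*) [Field k] (m2 σ₁ ρ n : ℕ)
    (col : Fin (m2 + 2) → MvPolynomial (Fin 2) k) (i σi b : ℕ) :
    MvPolynomial (Fin 2 ⊕ Fin (m2 + 2)) k :=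
  ∑ t ∈ Finset.range σi, cCoeff k m2 n col (b + t) * TT k m2 σ₁ ρ i (σi + 1 - t)

/-- `π'_{i,s,j} = c_n T_{i,j} + c_{n-1} T_{i,j+1} + ⋯ + c_{n-s} T_{i,j+s}`. -/
noncomputable def piPrimePoly (k : Type*) [Field k] (m2 σ₁ ρ n : ℕ)
    (col : Fin (m2 + 2) → MvPolynomial (Fin 2) k) (i s j : ℕ) :
    MvPolynomial (Fin 2 ⊕ Fin (m2 + 2)) k :=
  ∑ t ∈ Finset.range (s + 1), cCoeff k m2 n col (n - t) * TT k m2 σ₁ ρ i (j + t)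

/-- `f(∅) = ⌈n/σ₁⌉ − 1` and `r(∅) = σ₁⌈n/σ₁⌉ − n + 1`, defined by
`f(∅)σ₁ < n ≤ (f(∅)+1)σ₁`, `r(∅) = (f(∅)+1)σ₁ − n + 1`. -/
def fEmpty (n σ₁ : ℕ) : ℕ := (n - 1) / σ₁
def rEmpty (n σ₁ : ℕ) : ℕ := σ₁ * (fEmpty n σ₁ + 1) - n + 1

/-- `f(a₁)`, `r(a₁)` for an eligible 1-tuple `(a₁)`: `a₁σ₁ + f(a₁)σ₂ < n ≤
a₁σ₁ + (f(a₁)+1)σ₂`, `r(a₁) = a₁σ₁ + (f(a₁)+1)σ₂ − n + 1`. -/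
def fOne (n σ₁ σ₂ a₁ : ℕ) : ℕ := (n - a₁ * σ₁ - 1) / σ₂
def rOne (n σ₁ σ₂ a₁ : ℕ) : ℕ := a₁ * σ₁ + (fOne n σ₁ σ₂ a₁ + 1) * σ₂ - n + 1

/-- `G_{(∅,j)} = f_j`. -/
noncomputable def Gempty (k : Type*) [Field k] (m2 σ₁ ρ n : ℕ)
    (col : Fin (m2 + 2) → MvPolynomial (Fin 2) k) (j : ℕ) :
    MvPolynomial (Fin 2 ⊕ Fin (m2 + 2)) k :=
  TT k m2 σ₁ ρ 1 (j + σ₁ + 1 - rEmpty n σ₁) *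
      (∑ p ∈ Finset.range (fEmpty n σ₁),
        TT k m2 σ₁ ρ 1 1 ^ p * TT k m2 σ₁ ρ 1 (σ₁ + 1) ^ (fEmpty n σ₁ - 1 - p)
          * piPoly k m2 σ₁ ρ n col 1 σ₁ (p * σ₁))
    + TT k m2 σ₁ ρ 1 1 ^ fEmpty n σ₁
        * piPrimePoly k m2 σ₁ ρ n col 1 (σ₁ + 1 - rEmpty n σ₁) j

/-- `G_{((a₁),j)} = g_{a₁,j}`. -/
noncomputable def Gone (k : Type*) [Field k] (m2 σ₁ σ₂ ρ n : ℕ)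
    (col : Fin (m2 + 2) → MvPolynomial (Fin 2) k) (a₁ j : ℕ) :
    MvPolynomial (Fin 2 ⊕ Fin (m2 + 2)) k :=
  TT k m2 σ₁ ρ 2 (j + σ₂ + 1 - rOne n σ₁ σ₂ a₁) * TT k m2 σ₁ ρ 2 (σ₂ + 1) ^ fOne n σ₁ σ₂ a₁ *
      (∑ p ∈ Finset.range a₁,
        TT k m2 σ₁ ρ 1 1 ^ p * TT k m2 σ₁ ρ 1 (σ₁ + 1) ^ (a₁ - 1 - p)
          * piPoly k m2 σ₁ ρ n col 1 σ₁ (p * σ₁))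
    + TT k m2 σ₁ ρ 1 1 ^ a₁ * TT k m2 σ₁ ρ 2 (j + σ₂ + 1 - rOne n σ₁ σ₂ a₁) *
        (∑ p ∈ Finset.range (fOne n σ₁ σ₂ a₁),
          TT k m2 σ₁ ρ 2 1 ^ p * TT k m2 σ₁ ρ 2 (σ₂ + 1) ^ (fOne n σ₁ σ₂ a₁ - 1 - p)
            * piPoly k m2 σ₁ ρ n col 2 σ₂ (a₁ * σ₁ + p * σ₂))
    + TT k m2 σ₁ ρ 1 1 ^ a₁ * TT k m2 σ₁ ρ 2 1 ^ fOne n σ₁ σ₂ a₁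
        * piPrimePoly k m2 σ₁ ρ n col 2 (σ₂ + 1 - rOne n σ₁ σ₂ a₁) j

/-- `G_{((a₁,a₂),1)} = h_{a₁,a₂}` (only for `ρ = 2`). -/
noncomputable def Gtwo (k : Type*) [Field k] (m2 σ₁ σ₂ ρ n : ℕ)
    (col : Fin (m2 + 2) → MvPolynomial (Fin 2) k) (a₁ a₂ : ℕ) :
    MvPolynomial (Fin 2 ⊕ Fin (m2 + 2)) k :=
  X (Sum.inl 0) ^ (n - a₁ * σ₁ - a₂ * σ₂) * TT k m2 σ₁ ρ 2 (σ₂ + 1) ^ a₂ *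
      (∑ p ∈ Finset.range a₁,
        TT k m2 σ₁ ρ 1 1 ^ p * TT k m2 σ₁ ρ 1 (σ₁ + 1) ^ (a₁ - 1 - p)
          * piPoly k m2 σ₁ ρ n col 1 σ₁ (p * σ₁))
    + X (Sum.inl 0) ^ (n - a₁ * σ₁ - a₂ * σ₂) * TT k m2 σ₁ ρ 1 1 ^ a₁ *
        (∑ p ∈ Finset.range a₂,
          TT k m2 σ₁ ρ 2 1 ^ p * TT k m2 σ₁ ρ 2 (σ₂ + 1) ^ (a₂ - 1 - p)
            * piPoly k m2 σ₁ ρ n col 2 σ₂ (a₁ * σ₁ + p * σ₂))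
    + TT k m2 σ₁ ρ 1 1 ^ a₁ * TT k m2 σ₁ ρ 2 1 ^ a₂
        * DeltaPoly k m2 n col (a₁ * σ₁ + a₂ * σ₂)

/-- Given `F : ℕ → ℕ → Q`, thought of as a family indexed by the exponents of two variables
`x, y`, adjoin one factor from the sequence `u₀, …, u_s` (where `u_i` uses up `x^i y^(s-i)`),
taking the one that uses up as many factors `x` as possible. -/
def scrollLayer {Q : Type*} [CommRing Q] (u : ℕ → Q) (s : ℕ) (F : ℕ → ℕ → Q) (α β : ℕ) : Q :=
  u (min α s) * F (α - min α s) (β - (s - min α s))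

/-- The normal form of a monomial of the scroll ring with `p` factors `u_i`, `q` factors `v_i`
and total exponents `α, β` of `x, y`. -/
def scrollNF {Q : Type*} [CommRing Q] (u v : ℕ → Q) (x y : Q) (s t : ℕ) :
    ℕ → ℕ → ℕ → ℕ → Q
  | 0, q => (scrollLayer v t)^[q] fun α β => x ^ α * y ^ β
  | p + 1, q => scrollLayer u s (scrollNF u v x y s t p q)

section Layer

variable {Q : Type*} [CommRing Q] {u : ℕ → Q} {s : ℕ} {F : ℕ → ℕ → Q}

lemma scrollLayer_exchange {l r : Q} (hF : ∀ α β, l * F (α + 1) β = r * F α (β + 1))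
    (hu : ∀ i < s, l * u (i + 1) = r * u i) (α β : ℕ) :
    l * scrollLayer u s F (α + 1) β = r * scrollLayer u s F α (β + 1) := by
  unfold scrollLayer
  rcases lt_or_ge α s with h | h
  · rw [min_eq_left (by omega : α + 1 ≤ s), min_eq_left h.le, ← mul_assoc, ← mul_assoc,
      hu α h, show β + 1 - (s - α) = β - (s - (α + 1)) by omega]
    simp
  · rw [min_eq_right (by omega : s ≤ α + 1), min_eq_right h,
      show α + 1 - s = (α - s) + 1 by omega, show β + 1 - (s - s) = (β - (s - s)) + 1 by omega,
      mul_left_comm, hF, mul_left_comm]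

lemma scrollLayer_mul (hF : ∀ i < s, ∀ α β, u i * F (α + 1) β = u (i + 1) * F α (β + 1))
    {j : ℕ} (hj : j ≤ s) (α β : ℕ) :
    u j * F α β = scrollLayer u s F (α + j) (β + (s - j)) := by
  induction α generalizing j β with
  | zero =>
    unfold scrollLayer
    rw [zero_add, min_eq_left hj]
    congr 2 <;> omega
  | succ α ih =>
    rcases hj.lt_or_eq with h | rfl
    · rw [hF j h, ih (by omega)]
      congr 1 <;> omega
    · unfold scrollLayer
      rw [min_eq_right (by omega)]
      congr 2 <;> omega

lemma scrollLayer_mul_through {F' : ℕ → ℕ → Q} {z : Q} {i j D : ℕ}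
    (hz : ∀ α β, D ≤ α + β → z * F α β = F' (α + i) (β + j))
    (hF' : ∀ i < s, ∀ α β, u i * F' (α + 1) β = u (i + 1) * F' α (β + 1))
    (α β : ℕ) (h : s + D ≤ α + β) :
    z * scrollLayer u s F α β = scrollLayer u s F' (α + i) (β + j) := by
  unfold scrollLayer
  rw [mul_left_comm, hz _ _ (by omega), scrollLayer_mul hF' (min_le_right _ _)]
  unfold scrollLayer
  rw [show α - min α s + i + min α s = α + i by omega,
    show β - (s - min α s) + j + (s - min α s) = β + j by omega]

lemma scrollLayer_eq_of_param {a c x y : Q} {D : ℕ}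
    (hu : ∀ i ≤ s, u i = a * x ^ i * y ^ (s - i))
    (hF : ∀ α β, D ≤ α + β → F α β = c * (x ^ α * y ^ β)) (α β : ℕ) (h : s + D ≤ α + β) :
    scrollLayer u s F α β = a * c * (x ^ α * y ^ β) := by
  unfold scrollLayer
  rw [hu _ (min_le_right _ _), hF _ _ (by omega)]
  have h1 : x ^ α = x ^ min α s * x ^ (α - min α s) := by rw [← pow_add]; congr 1; omega
  have h2 : y ^ β = y ^ (s - min α s) * y ^ (β - (s - min α s)) := by
    rw [← pow_add]; congr 1; omega
  rw [h1, h2]; ring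

end Layer

/-- The relations given by the `2 × 2` minors of a scroll matrix with two blocks
`u₀, …, u_s` and `v₀, …, v_t` and the column `(y, x)`. -/
structure IsScroll {Q : Type*} [CommRing Q] (u v : ℕ → Q) (x y : Q) (s t : ℕ) : Prop where
  uu : ∀ i < s, ∀ j < s, u i * u (j + 1) = u (i + 1) * u j
  uv : ∀ i < s, ∀ j < t, u i * v (j + 1) = u (i + 1) * v j
  vv : ∀ i < t, ∀ j < t, v i * v (j + 1) = v (i + 1) * v j
  ux : ∀ i < s, u i * x = u (i + 1) * y
  vx : ∀ i < t, v i * x = v (i + 1) * y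

namespace IsScroll

variable {Q : Type*} [CommRing Q] {u v : ℕ → Q} {x y : Q} {s t : ℕ}

lemma exchange {l r : Q} (hu : ∀ i < s, l * u (i + 1) = r * u i)
    (hv : ∀ i < t, l * v (i + 1) = r * v i) (hx : l * x = r * y) (p q α β : ℕ) :
    l * scrollNF u v x y s t p q (α + 1) β = r * scrollNF u v x y s t p q α (β + 1) := by
  induction p generalizing α β with
  | zero =>
    induction q generalizing α β with
    | zero =>
      simp only [scrollNF, Function.iterate_zero, id]
      linear_combination x ^ α * y ^ β * hx
    | succ q ih =>
      simp only [scrollNF, Function.iterate_succ_apply'] at ih ⊢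
      exact scrollLayer_exchange ih hv α β
  | succ p ih => exact scrollLayer_exchange ih hu α β

lemma exchange_u (h : IsScroll u v x y s t) {i : ℕ} (hi : i < s)
    (p q α β : ℕ) :
    u i * scrollNF u v x y s t p q (α + 1) β = u (i + 1) * scrollNF u v x y s t p q α (β + 1) :=
  exchange (fun j hj => h.uu i hi j hj) (fun j hj => h.uv i hi j hj) (h.ux i hi) p q α β

lemma exchange_v (h : IsScroll u v x y s t) {i : ℕ} (hi : i < t)
    (p q α β : ℕ) :
    v i * scrollNF u v x y s t p q (α + 1) β = v (i + 1) * scrollNF u v x y s t p q α (β + 1) :=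
  exchange (fun j hj => by linear_combination -h.uv j hj i hi) (fun j hj => h.vv i hi j hj)
    (h.vx i hi) p q α β

lemma u_mul (h : IsScroll u v x y s t) {j : ℕ} (hj : j ≤ s) (p q α β : ℕ) :
    u j * scrollNF u v x y s t p q α β
      = scrollNF u v x y s t (p + 1) q (α + j) (β + (s - j)) :=
  scrollLayer_mul (fun _ hi α β => h.exchange_u hi p q α β) hj α β

lemma v_mul (h : IsScroll u v x y s t) {j : ℕ} (hj : j ≤ t)
    (p q α β : ℕ) (hd : p * s + q * t ≤ α + β) :
    v j * scrollNF u v x y s t p q α β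
      = scrollNF u v x y s t p (q + 1) (α + j) (β + (t - j)) := by
  induction p generalizing α β with
  | zero =>
    simp only [scrollNF, Function.iterate_succ_apply']
    exact scrollLayer_mul (fun _ hi α β => h.exchange_v hi 0 q α β) hj α β
  | succ p ih =>
    exact scrollLayer_mul_through ih (fun _ hi α β => h.exchange_u hi p (q + 1) α β) α β
      (by linarith)

lemma z_mul (h : IsScroll u v x y s t) {z : Q} {i j : ℕ}
    (hz : ∀ α β, z * (x ^ α * y ^ β) = x ^ (α + i) * y ^ (β + j))
    (p q α β : ℕ) (hd : p * s + q * t ≤ α + β) :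
    z * scrollNF u v x y s t p q α β = scrollNF u v x y s t p q (α + i) (β + j) := by
  induction p generalizing α β with
  | zero =>
    induction q generalizing α β with
    | zero => exact hz α β
    | succ q ih =>
      simp only [scrollNF, Function.iterate_succ_apply'] at ih ⊢
      exact scrollLayer_mul_through ih (fun _ hi α β => h.exchange_v hi 0 q α β) α β
        (by linarith)
  | succ p ih =>
    exact scrollLayer_mul_through ih (fun _ hi α β => h.exchange_u hi p q α β) α β
      (by linarith)

end IsScroll

lemma scrollNF_eq_of_param {Q : Type*} [CommRing Q] {u v : ℕ → Q} {x y a b : Q} {s t : ℕ}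
    (hu : ∀ i ≤ s, u i = a * x ^ i * y ^ (s - i)) (hv : ∀ i ≤ t, v i = b * x ^ i * y ^ (t - i))
    (p q α β : ℕ) (hd : p * s + q * t ≤ α + β) :
    scrollNF u v x y s t p q α β = a ^ p * b ^ q * (x ^ α * y ^ β) := by
  induction p generalizing α β with
  | zero =>
    induction q generalizing α β with
    | zero => simp [scrollNF]
    | succ q ih =>
      simp only [scrollNF, Function.iterate_succ_apply'] at ih ⊢
      rw [scrollLayer_eq_of_param hv ih α β (by linarith)]
      ring
  | succ p ih =>
    simp only [scrollNF]
    rw [scrollLayer_eq_of_param hu ih α β (by linarith)]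
    ring

lemma map_scrollNF {Q Q' H : Type*} [CommRing Q] [CommRing Q'] [FunLike H Q Q']
    [RingHomClass H Q Q'] (f : H) (u v : ℕ → Q)
    (x y : Q) (s t p q α β : ℕ) :
    f (scrollNF u v x y s t p q α β)
      = scrollNF (fun i => f (u i)) (fun i => f (v i)) (f x) (f y) s t p q α β := by
  induction p generalizing α β with
  | zero =>
    induction q generalizing α β with
    | zero => simp [scrollNF]
    | succ q ih =>
      simp only [scrollNF, Function.iterate_succ_apply'] at ih ⊢
      simp only [scrollLayer, map_mul, ih]
  | succ p ih => simp only [scrollNF, scrollLayer, map_mul, ih]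

section Param

variable (k : Type*) [Field k] (m2 σ₁ : ℕ)

/-- The parametrisation of the scroll: `T_{1,j} ↦ a x^(j-1) y^(σ₁+1-j)` and
`T_{2,j} ↦ b x^(j-1) y^(σ₂+1-j)`, where `x, y, a, b` are the four variables of the target. -/
noncomputable def scrollParam :
    MvPolynomial (Fin 2 ⊕ Fin (m2 + 2)) k →ₐ[k] MvPolynomial (Fin 4) k :=
  aeval (Sum.elim ![X 0, X 1] fun i =>
    if (i : ℕ) ≤ σ₁ then X 2 * X 0 ^ (i : ℕ) * X 1 ^ (σ₁ - i)
    else X 3 * X 0 ^ ((i : ℕ) - σ₁ - 1) * X 1 ^ (m2 + 1 - i))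

@[simp] lemma scrollParam_x : scrollParam k m2 σ₁ (X (Sum.inl 0)) = X 0 := by
  simp [scrollParam]

@[simp] lemma scrollParam_y : scrollParam k m2 σ₁ (X (Sum.inl 1)) = X 1 := by
  simp [scrollParam]

variable {m2 σ₁}

lemma scrollParam_Tvar_fst (hσ : σ₁ ≤ m2) {i : ℕ} (hi : i ≤ σ₁) :
    scrollParam k m2 σ₁ (Tvar k (m2 + 2) i) = X 2 * X 0 ^ i * X 1 ^ (σ₁ - i) := by
  rw [Tvar, dif_pos (by omega)]
  simp [scrollParam, hi]

lemma scrollParam_Tvar_snd (hσ : σ₁ ≤ m2) {j : ℕ} (hj : j ≤ m2 - σ₁) :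
    scrollParam k m2 σ₁ (Tvar k (m2 + 2) (σ₁ + 1 + j))
      = X 3 * X 0 ^ j * X 1 ^ (m2 - σ₁ - j) := by
  rw [Tvar, dif_pos (by omega)]
  simp only [scrollParam, aeval_X, Sum.elim_inr]
  rw [if_neg (by omega), show σ₁ + 1 + j - σ₁ - 1 = j by omega,
    show m2 + 1 - (σ₁ + 1 + j) = m2 - σ₁ - j by omega]

lemma isScroll_quot (hσ : σ₁ ≤ m2) :
    IsScroll (fun i => Ideal.Quotient.mk (scrollH k m2 σ₁) (Tvar k (m2 + 2) i))
      (fun j => Ideal.Quotient.mk (scrollH k m2 σ₁) (Tvar k (m2 + 2) (σ₁ + 1 + j)))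
      (Ideal.Quotient.mk (scrollH k m2 σ₁) (X (Sum.inl 0)))
      (Ideal.Quotient.mk (scrollH k m2 σ₁) (X (Sum.inl 1))) σ₁ (m2 - σ₁) := by
  have key : ∀ j j' : Fin (m2 + 1),
      Ideal.Quotient.mk (scrollH k m2 σ₁) (psiTop k m2 σ₁ j * psiBot k m2 σ₁ j')
        = Ideal.Quotient.mk (scrollH k m2 σ₁) (psiBot k m2 σ₁ j * psiTop k m2 σ₁ j') := by
    intro j j'
    rw [Ideal.Quotient.eq, mul_comm (psiBot k m2 σ₁ j)]
    exact Ideal.subset_span ⟨j, j', rfl⟩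
  have t1 : ∀ i (h : i < σ₁), psiTop k m2 σ₁ ⟨i, by omega⟩ = Tvar k (m2 + 2) i ∧
      psiBot k m2 σ₁ ⟨i, by omega⟩ = Tvar k (m2 + 2) (i + 1) := by
    intro i h
    have : i ≠ m2 := by omega
    simp [psiTop, psiBot, h, this]
  have t2 : ∀ j (h : j < m2 - σ₁),
      psiTop k m2 σ₁ ⟨σ₁ + j, by omega⟩ = Tvar k (m2 + 2) (σ₁ + 1 + j) ∧
      psiBot k m2 σ₁ ⟨σ₁ + j, by omega⟩ = Tvar k (m2 + 2) (σ₁ + 1 + (j + 1)) := by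
    intro j h
    have : σ₁ + j ≠ m2 := by omega
    simp [psiTop, psiBot, this]
    constructor <;> congr 1 <;> omega
  have t3 : psiTop k m2 σ₁ ⟨m2, by omega⟩ = X (Sum.inl 1) ∧
      psiBot k m2 σ₁ ⟨m2, by omega⟩ = X (Sum.inl 0) := by
    simp [psiTop, psiBot]
  constructor
  · intro i hi j hj
    have := key ⟨i, by omega⟩ ⟨j, by omega⟩
    rwa [(t1 i hi).1, (t1 i hi).2, (t1 j hj).1, (t1 j hj).2, map_mul, map_mul] at this
  · intro i hi j hj
    have := key ⟨i, by omega⟩ ⟨σ₁ + j, by omega⟩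
    rwa [(t1 i hi).1, (t1 i hi).2, (t2 j hj).1, (t2 j hj).2, map_mul, map_mul] at this
  · intro i hi j hj
    have := key ⟨σ₁ + i, by omega⟩ ⟨σ₁ + j, by omega⟩
    rwa [(t2 i hi).1, (t2 i hi).2, (t2 j hj).1, (t2 j hj).2, map_mul, map_mul] at this
  · intro i hi
    have := key ⟨i, by omega⟩ ⟨m2, by omega⟩
    rwa [(t1 i hi).1, (t1 i hi).2, t3.1, t3.2, map_mul, map_mul] at this
  · intro i hi
    have := key ⟨σ₁ + i, by omega⟩ ⟨m2, by omega⟩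
    rwa [(t2 i hi).1, (t2 i hi).2, t3.1, t3.2, map_mul, map_mul] at this

lemma scrollH_le_ker_scrollParam (hσ : σ₁ ≤ m2) :
    scrollH k m2 σ₁ ≤ RingHom.ker (scrollParam k m2 σ₁) := by
  have key : ∀ j : Fin (m2 + 1), ∃ c : MvPolynomial (Fin 4) k,
      scrollParam k m2 σ₁ (psiTop k m2 σ₁ j) = c * X 1 ∧
      scrollParam k m2 σ₁ (psiBot k m2 σ₁ j) = c * X 0 := by
    intro j
    by_cases h1 : (j : ℕ) = m2
    · exact ⟨1, by simp [psiTop, psiBot, h1]⟩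
    by_cases h2 : (j : ℕ) < σ₁
    · refine ⟨X 2 * X 0 ^ (j : ℕ) * X 1 ^ (σ₁ - (j + 1)), ?_⟩
      simp only [psiTop, psiBot, h1, h2, if_true, if_false]
      rw [scrollParam_Tvar_fst k hσ h2.le, scrollParam_Tvar_fst k hσ (Nat.succ_le_of_lt h2),
        Nat.succ_eq_add_one, show σ₁ - (j : ℕ) = σ₁ - (j + 1) + 1 by omega]
      constructor <;> ring
    · refine ⟨X 3 * X 0 ^ ((j : ℕ) - σ₁) * X 1 ^ (m2 - j - 1), ?_⟩
      simp only [psiTop, psiBot, h1, h2, if_false]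
      rw [show (j : ℕ) + 1 = σ₁ + 1 + (j - σ₁) by omega,
        show (j : ℕ) + 2 = σ₁ + 1 + (j - σ₁ + 1) by omega,
        scrollParam_Tvar_snd k hσ (by omega), scrollParam_Tvar_snd k hσ (by omega),
        show m2 - σ₁ - (j - σ₁) = m2 - j - 1 + 1 by omega,
        show m2 - σ₁ - (j - σ₁ + 1) = m2 - j - 1 by omega]
      constructor <;> ring
  refine Ideal.span_le.2 ?_
  rintro _ ⟨j, j', rfl⟩
  obtain ⟨c, h1, h2⟩ := key j
  obtain ⟨c', h1', h2'⟩ := key j'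
  simp only [SetLike.mem_coe, RingHom.mem_ker, map_sub, map_mul, h1, h2, h1', h2']
  ring

variable (m2 σ₁) in
/-- The linear map sending a monomial in the parameters to its normal form in `S/H`. -/
noncomputable def scrollLift :
    MvPolynomial (Fin 4) k →ₗ[k] MvPolynomial (Fin 2 ⊕ Fin (m2 + 2)) k ⧸ scrollH k m2 σ₁ :=
  (basisMonomials (Fin 4) k).constr k fun e =>
    scrollNF (fun i => Ideal.Quotient.mk (scrollH k m2 σ₁) (Tvar k (m2 + 2) i))
      (fun j => Ideal.Quotient.mk (scrollH k m2 σ₁) (Tvar k (m2 + 2) (σ₁ + 1 + j)))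
      (Ideal.Quotient.mk (scrollH k m2 σ₁) (X (Sum.inl 0)))
      (Ideal.Quotient.mk (scrollH k m2 σ₁) (X (Sum.inl 1))) σ₁ (m2 - σ₁)
      (e 2) (e 3) (e 0) (e 1)

lemma scrollLift_monomial (e : Fin 4 →₀ ℕ) : scrollLift k m2 σ₁ (monomial e 1) =
    scrollNF (fun i => Ideal.Quotient.mk (scrollH k m2 σ₁) (Tvar k (m2 + 2) i))
      (fun j => Ideal.Quotient.mk (scrollH k m2 σ₁) (Tvar k (m2 + 2) (σ₁ + 1 + j)))
      (Ideal.Quotient.mk (scrollH k m2 σ₁) (X (Sum.inl 0)))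
      (Ideal.Quotient.mk (scrollH k m2 σ₁) (X (Sum.inl 1))) σ₁ (m2 - σ₁)
      (e 2) (e 3) (e 0) (e 1) := by
  have := (basisMonomials (Fin 4) k).constr_basis k (fun e =>
    scrollNF (fun i => Ideal.Quotient.mk (scrollH k m2 σ₁) (Tvar k (m2 + 2) i))
      (fun j => Ideal.Quotient.mk (scrollH k m2 σ₁) (Tvar k (m2 + 2) (σ₁ + 1 + j)))
      (Ideal.Quotient.mk (scrollH k m2 σ₁) (X (Sum.inl 0)))
      (Ideal.Quotient.mk (scrollH k m2 σ₁) (X (Sum.inl 1))) σ₁ (m2 - σ₁)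
      (e 2) (e 3) (e 0) (e 1)) e
  rwa [coe_basisMonomials] at this

/-- The exponents of the monomials in the image of the scroll parametrisation. -/
def scrollCone (s t : ℕ) : Set (Fin 4 →₀ ℕ) := {e | e 2 * s + e 3 * t ≤ e 0 + e 1}

/-- Each variable of `S` maps to a monomial, multiplication by which is compatible with
`scrollLift` on the cone. -/
lemma exists_scrollParam_X_eq_monomial (hσ : σ₁ ≤ m2) (v : Fin 2 ⊕ Fin (m2 + 2)) :
    ∃ d : Fin 4 →₀ ℕ, scrollParam k m2 σ₁ (X v) = monomial d 1 ∧
      ∀ e ∈ scrollCone σ₁ (m2 - σ₁), d + e ∈ scrollCone σ₁ (m2 - σ₁) ∧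
        scrollLift k m2 σ₁ (monomial (d + e) 1)
          = Ideal.Quotient.mk _ (X v) * scrollLift k m2 σ₁ (monomial e 1) := by
  have hs := isScroll_quot k hσ
  have hX : ∀ i j : Fin 4, ∀ p q r : ℕ, ∀ l : Fin 4,
      (X l * X i ^ p * X j ^ q : MvPolynomial (Fin 4) k)
        = monomial (Finsupp.single l 1 + Finsupp.single i p + Finsupp.single j q) 1 := by
    intro i j p q r l
    rw [X_pow_eq_monomial, X_pow_eq_monomial, X, monomial_mul, monomial_mul]
    simp
  rcases v with v | i
  · fin_cases v
    · refine ⟨Finsupp.single 0 1, scrollParam_x k m2 σ₁, fun e he => ⟨?_, ?_⟩⟩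
      · simp [scrollCone] at he ⊢; omega
      · rw [scrollLift_monomial, scrollLift_monomial]
        simp only [Fin.zero_eta]
        rw [hs.z_mul (i := 1) (j := 0) (fun α β => by ring) _ _ _ _ he]
        simp [add_comm]
    · refine ⟨Finsupp.single 1 1, scrollParam_y k m2 σ₁, fun e he => ⟨?_, ?_⟩⟩
      · simp [scrollCone] at he ⊢; omega
      · rw [scrollLift_monomial, scrollLift_monomial]
        simp only [Fin.mk_one]
        rw [hs.z_mul (i := 0) (j := 1) (fun α β => by ring) _ _ _ _ he]
        simp [add_comm]
  · by_cases hi : (i : ℕ) ≤ σ₁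
    · have hT : (X (Sum.inr i) : MvPolynomial (Fin 2 ⊕ Fin (m2 + 2)) k) = Tvar k (m2 + 2) i := by
        simp [Tvar]
      rw [hT, scrollParam_Tvar_fst k hσ hi, hX _ _ _ _ 0]
      refine ⟨_, rfl, fun e he => ⟨?_, ?_⟩⟩
      · simp [scrollCone] at he ⊢
        rw [add_mul]
        omega
      · rw [scrollLift_monomial, scrollLift_monomial, hs.u_mul hi]
        simp [add_comm]
    · obtain ⟨j, hj⟩ : ∃ j, (i : ℕ) = σ₁ + 1 + j := ⟨i - σ₁ - 1, by omega⟩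
      have hT : (X (Sum.inr i) : MvPolynomial (Fin 2 ⊕ Fin (m2 + 2)) k)
          = Tvar k (m2 + 2) (σ₁ + 1 + j) := by
        rw [← hj]; simp [Tvar]
      have hj' : j ≤ m2 - σ₁ := by omega
      rw [hT, scrollParam_Tvar_snd k hσ hj', hX _ _ _ _ 0]
      refine ⟨_, rfl, fun e he => ⟨?_, ?_⟩⟩
      · simp [scrollCone] at he ⊢
        rw [add_mul]
        omega
      · rw [scrollLift_monomial, scrollLift_monomial, hs.v_mul hj' _ _ _ _ he]
        simp [add_comm]

lemma scrollParam_mem_span_and_lift (hσ : σ₁ ≤ m2)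
    (f : MvPolynomial (Fin 2 ⊕ Fin (m2 + 2)) k) :
    scrollParam k m2 σ₁ f ∈
        Submodule.span k ((fun e => monomial e (1 : k)) '' scrollCone σ₁ (m2 - σ₁)) ∧
      scrollLift k m2 σ₁ (scrollParam k m2 σ₁ f) = Ideal.Quotient.mk _ f := by
  induction f using MvPolynomial.induction_on with
  | C c =>
    have h0 : scrollParam k m2 σ₁ (C c) = c • monomial 0 1 := by
      rw [← MvPolynomial.algebraMap_eq, AlgHom.commutes, Algebra.algebraMap_eq_smul_one]
      simp
    rw [h0]
    refine ⟨Submodule.smul_mem _ _ (Submodule.subset_span ⟨0, by simp [scrollCone], rfl⟩), ?_⟩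
    rw [map_smul, scrollLift_monomial]
    simp only [Finsupp.coe_zero, Pi.zero_apply, scrollNF, Function.iterate_zero, id, pow_zero,
      mul_one]
    exact (Algebra.algebraMap_eq_smul_one c).symm
  | add p q hp hq =>
    simp only [map_add]
    exact ⟨add_mem hp.1 hq.1, by rw [hp.2, hq.2]⟩
  | mul_X p v hp =>
    obtain ⟨d, hd, hde⟩ := exists_scrollParam_X_eq_monomial k hσ v
    rw [mul_comm p, map_mul (scrollParam k m2 σ₁), map_mul (Ideal.Quotient.mk _), hd, ← hp.2]
    generalize scrollParam k m2 σ₁ p = b at hp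
    have hb := hp.1
    clear hp
    induction hb using Submodule.span_induction with
    | mem b hb =>
      obtain ⟨e, he, rfl⟩ := hb
      simp only [monomial_mul, mul_one]
      exact ⟨Submodule.subset_span ⟨_, (hde e he).1, rfl⟩, (hde e he).2⟩
    | zero => simp
    | add a b _ _ ha hb =>
      simp only [mul_add, map_add]
      exact ⟨add_mem ha.1 hb.1, by rw [ha.2, hb.2]⟩
    | smul c a _ ha =>
      simp only [mul_smul_comm, map_smul]
      exact ⟨Submodule.smul_mem _ _ ha.1, by rw [ha.2]⟩

/-- The scroll ideal is the kernel of the parametrisation. -/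
lemma ker_scrollParam (hσ : σ₁ ≤ m2) : RingHom.ker (scrollParam k m2 σ₁) = scrollH k m2 σ₁ := by
  refine le_antisymm (fun f hf => ?_) (scrollH_le_ker_scrollParam k hσ)
  have := (scrollParam_mem_span_and_lift k hσ f).2
  rw [RingHom.mem_ker.1 hf, map_zero] at this
  exact Ideal.Quotient.eq_zero_iff_mem.1 this.symm

lemma mem_scrollCone_of_coeff_ne_zero (hσ : σ₁ ≤ m2)
    {f : MvPolynomial (Fin 2 ⊕ Fin (m2 + 2)) k}
    {e : Fin 4 →₀ ℕ} (he : coeff e (scrollParam k m2 σ₁ f) ≠ 0) :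
    e ∈ scrollCone σ₁ (m2 - σ₁) := by
  classical
  have hb := (scrollParam_mem_span_and_lift k hσ f).1
  generalize scrollParam k m2 σ₁ f = b at hb he
  by_contra hn
  refine he ?_
  clear he
  induction hb using Submodule.span_induction with
  | mem b hb =>
    obtain ⟨e', he', rfl⟩ := hb
    rw [coeff_monomial, if_neg]
    rintro rfl
    exact hn he'
  | zero => simp
  | add a b _ _ ha hb => rw [coeff_add, ha, hb, add_zero]
  | smul c a _ ha => rw [coeff_smul, ha, smul_zero]

lemma exists_scrollParam_eq (hσ : σ₁ ≤ m2) {p q α β : ℕ}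
    (h : p * σ₁ + q * (m2 - σ₁) ≤ α + β) :
    ∃ f, scrollParam k m2 σ₁ f = X 2 ^ p * X 3 ^ q * (X 0 ^ α * X 1 ^ β) := by
  refine ⟨scrollNF (fun i => Tvar k (m2 + 2) i) (fun j => Tvar k (m2 + 2) (σ₁ + 1 + j))
    (X (Sum.inl 0)) (X (Sum.inl 1)) σ₁ (m2 - σ₁) p q α β, ?_⟩
  rw [map_scrollNF, scrollParam_x, scrollParam_y]
  exact scrollNF_eq_of_param (fun i hi => scrollParam_Tvar_fst k hσ hi)
    (fun i hi => scrollParam_Tvar_snd k hσ hi) p q α β h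

end Param

section HilbertBurch

variable {k : Type*} [Field k] {m2 σ₁ : ℕ} {col : Fin (m2 + 2) → MvPolynomial (Fin 2) k}

lemma sum_hbDelta_mul_hbMatrix (j : Fin (m2 + 1)) :
    ∑ i, hbDelta k m2 σ₁ col i * hbMatrix k m2 σ₁ col i j = 0 := by
  let A : Matrix (Fin (m2 + 2)) (Fin (m2 + 2)) (MvPolynomial (Fin 2) k) :=
    Matrix.of fun i => Fin.cons (hbMatrix k m2 σ₁ col i j) (hbMatrix k m2 σ₁ col i)
  have hA : A.det = 0 :=
    Matrix.det_zero_of_column_eq (i := 0) (j := j.succ) (Fin.succ_ne_zero j).symm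
      fun i => by simp [A]
  rw [Matrix.det_succ_column_zero] at hA
  rw [← hA]
  refine Finset.sum_congr rfl fun i _ => ?_
  have : A.submatrix i.succAbove Fin.succ = (hbMatrix k m2 σ₁ col).submatrix i.succAbove id := by
    ext; simp [A]
  rw [this, hbDelta]
  simp only [A, Matrix.of_apply, Fin.cons_zero]
  ring

lemma sum_mul_hbMatrix_of_lt (d : Fin (m2 + 2) → MvPolynomial (Fin 2) k) {j : ℕ} (hj : j < σ₁)
    (hσ : σ₁ ≤ m2) :
    ∑ i, d i * hbMatrix k m2 σ₁ col i ⟨j, by omega⟩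
      = X 0 * d ⟨j, by omega⟩ - X 1 * d ⟨j + 1, by omega⟩ := by
  have : ∀ i, d i * hbMatrix k m2 σ₁ col i ⟨j, by omega⟩
      = (if i = ⟨j, by omega⟩ then X 0 * d i else 0)
        - (if i = ⟨j + 1, by omega⟩ then X 1 * d i else 0) := by
    intro i
    have : j ≠ m2 := by omega
    simp only [hbMatrix, Matrix.of_apply, Fin.ext_iff, hj, this, if_true, if_false]
    split_ifs <;> first | omega | ring
  simp [this]

lemma sum_mul_hbMatrix_of_le (d : Fin (m2 + 2) → MvPolynomial (Fin 2) k) {j : ℕ} (hj : σ₁ ≤ j)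
    (hj' : j < m2) :
    ∑ i, d i * hbMatrix k m2 σ₁ col i ⟨j, by omega⟩
      = X 0 * d ⟨j + 1, by omega⟩ - X 1 * d ⟨j + 2, by omega⟩ := by
  have : ∀ i, d i * hbMatrix k m2 σ₁ col i ⟨j, by omega⟩
      = (if i = ⟨j + 1, by omega⟩ then X 0 * d i else 0)
        - (if i = ⟨j + 2, by omega⟩ then X 1 * d i else 0) := by
    intro i
    have h1 : j ≠ m2 := by omega
    have h2 : ¬ j < σ₁ := by omega
    simp only [hbMatrix, Matrix.of_apply, Fin.ext_iff, h1, h2, if_false]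
    split_ifs <;> first | omega | ring
  simp [this]

lemma sum_mul_hbMatrix_last (d : Fin (m2 + 2) → MvPolynomial (Fin 2) k) :
    ∑ i, d i * hbMatrix k m2 σ₁ col i (Fin.last m2) = ∑ i, d i * col i := by
  simp [hbMatrix]

lemma exists_eq_mul_pow_of_X_mul_eq {s : ℕ} (d : ℕ → MvPolynomial (Fin 2) k)
    (hd : ∀ i < s, X 0 * d i = X 1 * d (i + 1)) :
    ∃ α, ∀ i ≤ s, d i = α * X 0 ^ i * X 1 ^ (s - i) := by
  induction s with
  | zero => exact ⟨d 0, fun i hi => by obtain rfl : i = 0 := by omega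
                                       simp⟩
  | succ s ih =>
    obtain ⟨α, hα⟩ := ih fun i hi => hd i (by omega)
    have hp : Prime (X 1 : MvPolynomial (Fin 2) k) := X_prime
    have h1 : X 1 ∣ α := by
      have h2 : X 1 ∣ α * X 0 ^ (s + 1) := by
        refine ⟨d (s + 1), ?_⟩
        rw [← hd s (by omega), hα s le_rfl]
        simp; ring
      refine (hp.dvd_or_dvd h2).resolve_right fun h => ?_
      have := hp.dvd_of_dvd_pow h
      rw [X_dvd_X] at this
      simp at this
    obtain ⟨β, rfl⟩ := h1
    refine ⟨β, fun i hi => ?_⟩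
    rcases hi.lt_or_eq with h | rfl
    · rw [hα i (by omega), show s + 1 - i = s - i + 1 by omega]
      ring
    · apply mul_left_cancel₀ hp.ne_zero
      rw [← hd s (by omega), hα s le_rfl]
      simp; ring

/-- The coefficient of `a` in the image of `g` under the scroll parametrisation. -/
noncomputable def gFst (σ₁ : ℕ) (col : Fin (m2 + 2) → MvPolynomial (Fin 2) k) :
    MvPolynomial (Fin 2) k :=
  ∑ i : Fin (m2 + 2), (if (i : ℕ) ≤ σ₁ then X 0 ^ (i : ℕ) * X 1 ^ (σ₁ - i) else 0) * col i

/-- The coefficient of `b` in the image of `g` under the scroll parametrisation. -/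
noncomputable def gSnd (σ₁ : ℕ) (col : Fin (m2 + 2) → MvPolynomial (Fin 2) k) :
    MvPolynomial (Fin 2) k :=
  ∑ i : Fin (m2 + 2),
    (if (i : ℕ) ≤ σ₁ then 0 else X 0 ^ ((i : ℕ) - σ₁ - 1) * X 1 ^ (m2 + 1 - i)) * col i

lemma hbDelta_mul_X_pow (hσ : σ₁ ≤ m2) :
    hbDelta k m2 σ₁ col ⟨σ₁, by omega⟩ * X 0 ^ (m2 - σ₁)
      = (-1) ^ σ₁ * (gSnd σ₁ col * X 0 ^ m2) := by
  set p : Fin (m2 + 2) := ⟨σ₁, by omega⟩ with hp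
  set M := (hbMatrix k m2 σ₁ col).submatrix p.succAbove id with hM
  let d : Fin (m2 + 2) → MvPolynomial (Fin 2) k := fun i =>
    if (i : ℕ) ≤ σ₁ then 0 else X 0 ^ ((i : ℕ) - σ₁ - 1) * X 1 ^ (m2 + 1 - i)
  let w : Fin (m2 + 1) → MvPolynomial (Fin 2) k := fun r => d (p.succAbove r)
  have hw : Matrix.vecMul w M = Pi.single (Fin.last m2) (gSnd σ₁ col) := by
    have h1 : ∀ j, Matrix.vecMul w M j = ∑ i, d i * hbMatrix k m2 σ₁ col i j := by
      intro j
      rw [Fin.sum_univ_succAbove _ p]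
      simp [Matrix.vecMul, dotProduct, w, M, d, hp]
    ext1 j
    rw [h1]
    rcases lt_trichotomy (j : ℕ) σ₁ with h | h | h
    all_goals
      by_cases hj : (j : ℕ) = m2
      · obtain rfl : j = Fin.last m2 := Fin.ext hj
        rw [sum_mul_hbMatrix_last, Pi.single_eq_same]
        rfl
      rw [Pi.single_eq_of_ne (fun hh => hj (by rw [hh]; rfl))]
    · refine (sum_mul_hbMatrix_of_lt d h hσ).trans ?_
      simp only [d]
      rw [if_pos h.le, if_pos (by simp; omega)]
      simp
    all_goals
      refine (sum_mul_hbMatrix_of_le d (by omega : σ₁ ≤ (j : ℕ)) (by omega)).trans ?_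
      simp only [d]
      rw [if_neg (by simp; omega), if_neg (by simp; omega),
        show m2 + 1 - ((j : ℕ) + 1) = m2 + 1 - ((j : ℕ) + 2) + 1 by omega,
        show (j : ℕ) + 2 - σ₁ - 1 = (j : ℕ) + 1 - σ₁ - 1 + 1 by omega]
      ring
  have hsucc : ∀ r : Fin (m2 + 1),
      ((p.succAbove r : Fin (m2 + 2)) : ℕ) = if (r : ℕ) < σ₁ then (r : ℕ) else r + 1 := by
    intro r
    simp only [Fin.succAbove, hp, Fin.lt_def]
    split_ifs <;> simp_all
  have hdet : (M.submatrix (Fin.last m2).succAbove (Fin.last m2).succAbove).det = X 0 ^ m2 := by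
    rw [Matrix.det_of_isLowerTriangular]
    · have : ∀ r ∈ Finset.univ,
          M.submatrix (Fin.last m2).succAbove (Fin.last m2).succAbove r r = X 0 := by
        intro r _
        have := r.2
        simp only [M, Matrix.submatrix_apply, hbMatrix, Matrix.of_apply, hsucc,
          Fin.succAbove_last, Fin.val_castSucc, id]
        split_ifs <;> first | omega | rfl
      rw [Finset.prod_congr rfl this]
      simp
    · intro r c hrc
      have hrc : (r : ℕ) < c := hrc
      have := c.2
      simp only [M, Matrix.submatrix_apply, hbMatrix, Matrix.of_apply, hsucc,
        Fin.succAbove_last, Fin.val_castSucc, id]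
      split_ifs <;> first | omega | rfl
  have hadj : M.adjugate (Fin.last m2) (Fin.last m2) = X 0 ^ m2 := by
    rw [Matrix.adjugate_fin_succ_eq_det_submatrix, hdet, Even.neg_one_pow ⟨_, rfl⟩, one_mul]
  have h2 := congrFun (congrArg (fun v => Matrix.vecMul v M.adjugate) hw) (Fin.last m2)
  simp only [Matrix.vecMul_vecMul, Matrix.mul_adjugate, Matrix.single_vecMul,
    Matrix.vecMul_smul, Matrix.vecMul_one, Pi.smul_apply, smul_eq_mul, Matrix.row_apply,
    hadj] at h2
  have hwl : w (Fin.last m2) = X 0 ^ (m2 - σ₁) := by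
    have h3 : ((p.succAbove (Fin.last m2) : Fin (m2 + 2)) : ℕ) = m2 + 1 := by
      rw [hsucc, if_neg (by simp; omega)]; simp
    simp only [w, d, h3]
    rw [if_neg (by omega), show m2 + 1 - σ₁ - 1 = m2 - σ₁ by omega]
    simp
  rw [hwl] at h2
  rw [hbDelta, ← hM, mul_assoc, h2]

/-- The signed minors are given by the scroll parametrisation evaluated at multiples of the
coefficients of `g`. -/
lemma exists_hbDelta_eq (hσ : σ₁ ≤ m2) (h0 : ∀ i, hbDelta k m2 σ₁ col i ≠ 0) :
    ∃ α₁ α₂ : MvPolynomial (Fin 2) k, α₁ ≠ 0 ∧ gSnd σ₁ col ≠ 0 ∧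
      α₁ * gFst σ₁ col + α₂ * gSnd σ₁ col = 0 ∧ gSnd σ₁ col ∣ α₁ ∧ gFst σ₁ col ∣ α₂ ∧
      ∀ i, hbDelta k m2 σ₁ col i = if (i : ℕ) ≤ σ₁ then α₁ * X 0 ^ (i : ℕ) * X 1 ^ (σ₁ - i)
        else α₂ * X 0 ^ ((i : ℕ) - σ₁ - 1) * X 1 ^ (m2 + 1 - i) := by
  let D : ℕ → MvPolynomial (Fin 2) k := fun i =>
    if h : i < m2 + 2 then hbDelta k m2 σ₁ col ⟨i, h⟩ else 0
  have hD : ∀ i : Fin (m2 + 2), hbDelta k m2 σ₁ col i = D i := fun i => by simp [D]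
  obtain ⟨α₁, h1⟩ := exists_eq_mul_pow_of_X_mul_eq (s := σ₁) D fun i hi => by
    have := sum_mul_hbMatrix_of_lt (col := col) (hbDelta k m2 σ₁ col) hi hσ
    rw [sum_hbDelta_mul_hbMatrix, hD, hD] at this
    exact (sub_eq_zero.1 this.symm)
  obtain ⟨α₂, h2⟩ := exists_eq_mul_pow_of_X_mul_eq (s := m2 - σ₁) (fun i => D (σ₁ + 1 + i))
    fun i hi => by
      have := sum_mul_hbMatrix_of_le (col := col) (σ₁ := σ₁) (hbDelta k m2 σ₁ col)
        (j := σ₁ + i) (by omega) (show σ₁ + i < m2 by omega)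
      rw [sum_hbDelta_mul_hbMatrix, hD, hD] at this
      simp only at this ⊢
      rw [show σ₁ + 1 + i = σ₁ + i + 1 by omega, show σ₁ + 1 + (i + 1) = σ₁ + i + 2 by omega]
      exact (sub_eq_zero.1 this.symm)
  have hδ : ∀ i, hbDelta k m2 σ₁ col i = if (i : ℕ) ≤ σ₁ then
      α₁ * X 0 ^ (i : ℕ) * X 1 ^ (σ₁ - i)
        else α₂ * X 0 ^ ((i : ℕ) - σ₁ - 1) * X 1 ^ (m2 + 1 - i) := by
    intro i
    rw [hD]
    split_ifs with h
    · exact h1 i h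
    · have := h2 (i - σ₁ - 1) (by omega)
      rw [show σ₁ + 1 + ((i : ℕ) - σ₁ - 1) = i by omega,
        show m2 - σ₁ - ((i : ℕ) - σ₁ - 1) = m2 + 1 - i by omega] at this
      exact this
  have hα₁ : α₁ ≠ 0 := by
    rintro rfl
    exact h0 0 (by rw [hδ]; simp)
  have hX : (X 0 : MvPolynomial (Fin 2) k) ≠ 0 := X_ne_zero 0
  have hg : α₁ = (-1) ^ σ₁ * gSnd σ₁ col := by
    have := hbDelta_mul_X_pow (k := k) (col := col) hσ
    rw [hδ] at this
    simp only [le_refl, if_true, Nat.sub_self, pow_zero, mul_one] at this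
    rw [mul_assoc, ← pow_add, show σ₁ + (m2 - σ₁) = m2 by omega, ← mul_assoc] at this
    exact mul_right_cancel₀ (pow_ne_zero _ hX) this
  have hg0 : gSnd σ₁ col ≠ 0 := by
    intro h
    exact hα₁ (by rw [hg, h, mul_zero])
  have hsum : α₁ * gFst σ₁ col + α₂ * gSnd σ₁ col = 0 := by
    have := sum_hbDelta_mul_hbMatrix (k := k) (σ₁ := σ₁) (col := col) (Fin.last m2)
    rw [sum_mul_hbMatrix_last] at this
    rw [← this, gFst, gSnd, Finset.mul_sum, Finset.mul_sum, ← Finset.sum_add_distrib]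
    refine Finset.sum_congr rfl fun i _ => ?_
    rw [hδ]
    split_ifs <;> ring
  have hg' : α₂ = -(-1) ^ σ₁ * gFst σ₁ col := by
    apply mul_right_cancel₀ hg0
    rw [hg] at hsum
    linear_combination hsum
  exact ⟨α₁, α₂, hα₁, hg0, hsum, Dvd.intro_left _ hg.symm, Dvd.intro_left _ hg'.symm, hδ⟩

lemma isRelPrime_of_idealHeight_eq_two {R : Type*} [CommRing R] [IsNoetherianRing R]
    {I : Ideal R} (hI : idealHeight I = 2) {a b : R} (hab : I ≤ Ideal.span {a, b}) :
    IsRelPrime a b := by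
  intro d hda hdb
  by_contra hd
  obtain ⟨p, hp⟩ := (Ideal.span {d}).nonempty_minimalPrimes (by simpa using hd)
  have h1 := Ideal.height_le_one_of_isPrincipal_of_mem_minimalPrimes (Ideal.span {d}) p hp
  have hIp : I ≤ p := by
    refine hab.trans ?_
    have hdp : d ∈ p := hp.1.2 (Ideal.mem_span_singleton_self d)
    rw [Ideal.span_le]
    rintro z (rfl | rfl)
    · exact Ideal.mem_of_dvd _ hda hdp
    · exact Ideal.mem_of_dvd _ hdb hdp
  have h2 : idealHeight I ≤ Order.height (⟨p, hp.1.1⟩ : PrimeSpectrum R) :=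
    iInf₂_le (⟨p, hp.1.1⟩ : PrimeSpectrum R) hIp
  rw [← PrimeSpectrum.height_eq_orderHeight, hI] at h2
  have := h2.trans h1
  norm_num at this

end HilbertBurch

section KernelLinear

variable {k : Type*} [Field k]

/-- The inclusion of `k[x, y]` into `k[x, y, a, b]`. -/
noncomputable def inclXY (k : Type*) [Field k] :
    MvPolynomial (Fin 2) k →ₐ[k] MvPolynomial (Fin 4) k :=
  aeval ![X 0, X 1]

/-- The map `k[x, y, a, b] → k[x, y][t]` with `a ↦ α₁ t` and `b ↦ α₂ t`. -/
noncomputable def evalAB (α₁ α₂ : MvPolynomial (Fin 2) k) :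
    MvPolynomial (Fin 4) k →ₐ[k] Polynomial (MvPolynomial (Fin 2) k) :=
  aeval ![Polynomial.C (X 0), Polynomial.C (X 1), Polynomial.C α₁ * Polynomial.X,
    Polynomial.C α₂ * Polynomial.X]

lemma evalAB_inclXY (α₁ α₂ p : MvPolynomial (Fin 2) k) :
    evalAB α₁ α₂ (inclXY k p) = Polynomial.C p := by
  have : (evalAB α₁ α₂).comp (inclXY k) = Polynomial.CAlgHom (R := k) := by
    ext i : 1
    fin_cases i <;> simp [inclXY, evalAB]
  exact DFunLike.congr_fun this p

lemma exists_eq_inclXY_of_dvd {d : MvPolynomial (Fin 4) k} {c : MvPolynomial (Fin 2) k}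
    (hc : c ≠ 0) (hd : d ∣ inclXY k c) : ∃ d', d = inclXY k d' := by
  let τ : MvPolynomial (Fin 4) k →ₐ[k] Polynomial (MvPolynomial (Fin 4) k) :=
    aeval ![Polynomial.C (X 0), Polynomial.C (X 1), Polynomial.C (X 2) * Polynomial.X,
      Polynomial.C (X 3) * Polynomial.X]
  have hτ : ∀ p, τ (inclXY k p) = Polynomial.C (inclXY k p) := by
    intro p
    have : τ.comp (inclXY k) = (Polynomial.CAlgHom (R := k)).comp (inclXY k) := by
      ext i : 1
      fin_cases i <;> simp [inclXY, τ]
    exact DFunLike.congr_fun this p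
  have h1 : ∀ f, Polynomial.eval 1 (τ f) = f := by
    intro f
    have : ((Polynomial.aeval (1 : MvPolynomial (Fin 4) k)).restrictScalars k).comp τ
        = AlgHom.id k _ := by
      ext i : 1
      fin_cases i <;> simp [τ]
    simpa [Polynomial.coe_aeval_eq_eval] using DFunLike.congr_fun this f
  have h0 : ∀ f, Polynomial.eval 0 (τ f) = inclXY k (aeval ![X 0, X 1, 0, 0] f) := by
    intro f
    have : ((Polynomial.aeval (0 : MvPolynomial (Fin 4) k)).restrictScalars k).comp τ
        = (inclXY k).comp (aeval ![X 0, X 1, 0, 0]) := by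
      ext i : 1
      fin_cases i <;> simp [τ, inclXY]
    simpa [Polynomial.coe_aeval_eq_eval] using DFunLike.congr_fun this f
  have hinj : inclXY k c ≠ 0 := by
    intro h
    have := evalAB_inclXY 0 0 c
    rw [h, map_zero, eq_comm, Polynomial.C_eq_zero] at this
    exact hc this
  have hdeg : (τ d).natDegree = 0 := by
    obtain ⟨e, he⟩ := hd
    have h2 : Polynomial.C (inclXY k c) = τ d * τ e := by rw [← hτ, he, map_mul]
    have h3 : τ d * τ e ≠ 0 := by rw [← h2]; simpa using hinj
    have h4 := Polynomial.natDegree_mul (left_ne_zero_of_mul h3) (right_ne_zero_of_mul h3)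
    rw [← h2, Polynomial.natDegree_C] at h4
    omega
  obtain ⟨z, hz⟩ := Polynomial.natDegree_eq_zero.1 hdeg
  refine ⟨aeval ![X 0, X 1, 0, 0] d, ?_⟩
  rw [← h0, ← hz, Polynomial.eval_C]
  conv_lhs => rw [← h1 d, ← hz, Polynomial.eval_C]

lemma evalAB_linear_eq_zero {g₁ g₂ α₁ α₂ : MvPolynomial (Fin 2) k} (hs : α₁ * g₁ + α₂ * g₂ = 0) :
    evalAB α₁ α₂ (X 2 * inclXY k g₁ + X 3 * inclXY k g₂) = 0 := by
  simp only [map_add, map_mul, evalAB_inclXY]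
  simp only [evalAB, aeval_X]
  simp only [Matrix.cons_val]
  rw [mul_right_comm, mul_right_comm _ Polynomial.X, ← Polynomial.C_mul, ← Polynomial.C_mul,
    ← add_mul, ← Polynomial.C_add, hs]
  simp

/-- If `g₁, g₂` are relatively prime, the kernel of the map given by a syzygy is generated by
the linear form `a g₁ + b g₂`. -/
lemma dvd_of_evalAB_eq_zero {g₁ g₂ α₁ α₂ : MvPolynomial (Fin 2) k} (hα₁ : α₁ ≠ 0) (hg₂ : g₂ ≠ 0)
    (hs : α₁ * g₁ + α₂ * g₂ = 0) (hrel : IsRelPrime g₁ g₂) {f : MvPolynomial (Fin 4) k}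
    (hf : evalAB α₁ α₂ f = 0) : X 2 * inclXY k g₁ + X 3 * inclXY k g₂ ∣ f := by
  set L := X 2 * inclXY k g₁ + X 3 * inclXY k g₂ with hL
  have hLs : evalAB α₁ α₂ L = 0 := evalAB_linear_eq_zero hs
  let ι : Polynomial (MvPolynomial (Fin 2) k) →+* MvPolynomial (Fin 4) k :=
    Polynomial.eval₂RingHom (inclXY k).toRingHom (X 2)
  have hι : ∀ r, ι (Polynomial.C r) = inclXY k r := fun r => by simp [ι]
  have hιX : ι Polynomial.X = X 2 := by simp [ι]
  have key : ∀ f : MvPolynomial (Fin 4) k, ∃ N r, L ∣ inclXY k g₂ ^ N * f - ι r := by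
    intro f
    induction f using MvPolynomial.induction_on with
    | C c =>
      refine ⟨0, Polynomial.C (C c), ?_⟩
      have : ι (Polynomial.C (C c)) = C c := by
        rw [hι, inclXY, aeval_C, algebraMap_eq]
      rw [this]
      simp
    | add p q hp hq =>
      obtain ⟨N, r, hr⟩ := hp
      obtain ⟨N', r', hr'⟩ := hq
      refine ⟨N + N', Polynomial.C g₂ ^ N' * r + Polynomial.C g₂ ^ N * r', ?_⟩
      have := dvd_add (hr.mul_left (inclXY k g₂ ^ N')) (hr'.mul_left (inclXY k g₂ ^ N))
      convert this using 1
      simp only [map_add, map_mul, map_pow, hι]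
      ring
    | mul_X p v hp =>
      obtain ⟨N, r, hr⟩ := hp
      fin_cases v
      · refine ⟨N, r * Polynomial.C (X 0), ?_⟩
        have hx : ι (Polynomial.C (X 0)) = X 0 := by rw [hι]; simp [inclXY]
        convert hr.mul_right (X 0) using 1
        rw [map_mul, hx]
        simp only [Fin.zero_eta]
        ring
      · refine ⟨N, r * Polynomial.C (X 1), ?_⟩
        have hx : ι (Polynomial.C (X 1)) = X 1 := by rw [hι]; simp [inclXY]
        convert hr.mul_right (X 1) using 1
        rw [map_mul, hx]
        simp only [Fin.mk_one]
        ring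
      · refine ⟨N, r * Polynomial.X, ?_⟩
        convert hr.mul_right (X 2) using 1
        rw [map_mul, hιX]
        simp only [Fin.reduceFinMk]
        ring
      · refine ⟨N + 1, -(Polynomial.C g₁ * Polynomial.X * r), ?_⟩
        have := dvd_sub (Dvd.intro (inclXY k g₂ ^ N * p) rfl : L ∣ L * (inclXY k g₂ ^ N * p))
          (hr.mul_left (inclXY k g₁ * X 2))
        convert this using 1
        simp only [Fin.reduceFinMk, map_neg, map_mul, hιX, hι, hL]
        ring
  obtain ⟨N, r, q, hq⟩ := key f
  have hr : r = 0 := by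
    have h1 := congrArg (evalAB α₁ α₂) hq
    rw [map_sub, map_mul, map_mul, hf, hLs, mul_zero, zero_mul, zero_sub, neg_eq_zero] at h1
    have h2 : evalAB α₁ α₂ (ι r) = r.comp (Polynomial.C α₁ * Polynomial.X) := by
      have : (evalAB α₁ α₂).toRingHom.comp ι
          = Polynomial.compRingHom (Polynomial.C α₁ * Polynomial.X) := by
        refine Polynomial.ringHom_ext (fun z => ?_) ?_
        · have := evalAB_inclXY α₁ α₂ z
          simpa [hι] using this
        · simp [hιX, evalAB]
      exact DFunLike.congr_fun this r
    rw [h2] at h1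
    ext1 i
    have h3 := congrArg (fun z => Polynomial.coeff z i) h1
    simp only [Polynomial.comp_C_mul_X_coeff, Polynomial.coeff_zero] at h3
    simpa [hα₁] using h3
  have hdvd : L ∣ inclXY k g₂ ^ N * f := ⟨q, by rw [← hq, hr]; simp⟩
  have hLg : IsRelPrime L (inclXY k g₂) := by
    intro d hdL hdg
    obtain ⟨d, rfl⟩ := exists_eq_inclXY_of_dvd hg₂ hdg
    have hret : ∀ p, (aeval ![X 0, X 1, 1, 0] : MvPolynomial (Fin 4) k →ₐ[k]
        MvPolynomial (Fin 2) k) (inclXY k p) = p := by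
      intro p
      have : (aeval ![X 0, X 1, 1, 0] : MvPolynomial (Fin 4) k →ₐ[k]
        MvPolynomial (Fin 2) k).comp (inclXY k) = AlgHom.id k _ := by
        ext i : 1
        fin_cases i <;> simp [inclXY]
      exact DFunLike.congr_fun this p
    have h1 := map_dvd (aeval ![X 0, X 1, 1, 0] : MvPolynomial (Fin 4) k →ₐ[k]
      MvPolynomial (Fin 2) k) hdL
    have h2 := map_dvd (aeval ![X 0, X 1, 1, 0] : MvPolynomial (Fin 4) k →ₐ[k]
      MvPolynomial (Fin 2) k) hdg
    rw [hret, hret] at h2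
    rw [hret, hL, map_add, map_mul, map_mul, hret, hret] at h1
    simp only [aeval_X] at h1
    simp only [Matrix.cons_val, one_mul, zero_mul, add_zero] at h1
    exact (hrel h1 h2).map (inclXY k)
  exact (hLg.pow_right).dvd_of_dvd_mul_left hdvd

end KernelLinear

section Generators

variable {B : Type*} [CommRing B]

/-- The form `Σ_{i < N} γ_{b+i} x^{N-i} yⁱ`. -/
def partialForm (x y : B) (γ : ℕ → B) (N b : ℕ) : B :=
  ∑ i ∈ Finset.range N, γ (b + i) * x ^ (N - i) * y ^ i

lemma partialForm_add (x y : B) (γ : ℕ → B) (N M b : ℕ) :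
    partialForm x y γ (N + M) b
      = x ^ M * partialForm x y γ N b + y ^ N * partialForm x y γ M (b + N) := by
  simp only [partialForm]
  rw [Finset.sum_range_add, Finset.mul_sum, Finset.mul_sum]
  congr 1
  · refine Finset.sum_congr rfl fun i hi => ?_
    have := Finset.mem_range.1 hi
    rw [show N + M - i = N - i + M by omega]
    ring
  · refine Finset.sum_congr rfl fun i _ => ?_
    rw [show N + M - (N + i) = M - i by omega, add_assoc b]
    ring

lemma sum_block_partialForm (x y a : B) (γ : ℕ → B) (σ f b : ℕ) :
    ∑ p ∈ Finset.range f, (a * y ^ σ) ^ p * (a * x ^ σ) ^ (f - 1 - p)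
        * (a * partialForm x y γ σ (b + p * σ))
      = a ^ f * partialForm x y γ (f * σ) b := by
  induction f with
  | zero => simp [partialForm]
  | succ f ih =>
    have h : ∀ p ∈ Finset.range f, (a * y ^ σ) ^ p * (a * x ^ σ) ^ (f + 1 - 1 - p)
        * (a * partialForm x y γ σ (b + p * σ))
        = (a * x ^ σ) * ((a * y ^ σ) ^ p * (a * x ^ σ) ^ (f - 1 - p)
        * (a * partialForm x y γ σ (b + p * σ))) := by
      intro p hp
      have := Finset.mem_range.1 hp
      rw [show f + 1 - 1 - p = f - 1 - p + 1 by omega]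
      ring
    rw [Finset.sum_range_succ, Finset.sum_congr rfl h, ← Finset.mul_sum, ih,
      show (f + 1) * σ = f * σ + σ by ring, partialForm_add]
    simp
    ring

/-- The form `Σ_{i ≤ n} γᵢ x^{n-i} yⁱ`, split after its first `N` terms. -/
lemma sum_eq_partialForm_add (x y : B) (γ : ℕ → B) {n N : ℕ} (hN : N ≤ n) :
    ∑ i ∈ Finset.range (n + 1), γ i * x ^ (n - i) * y ^ i
      = x ^ (n - N) * partialForm x y γ N 0
        + y ^ N * ∑ t ∈ Finset.range (n - N + 1), γ (N + t) * x ^ (n - N - t) * y ^ t := by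
  obtain ⟨M, rfl⟩ := Nat.exists_eq_add_of_le hN
  simp only [partialForm]
  rw [add_assoc, Finset.sum_range_add, Finset.mul_sum, Finset.mul_sum, Nat.add_sub_cancel_left]
  congr 1
  · refine Finset.sum_congr rfl fun i hi => ?_
    have := Finset.mem_range.1 hi
    rw [show N + M - i = N - i + M by omega, zero_add]
    ring
  · refine Finset.sum_congr rfl fun i _ => ?_
    rw [show N + M - (N + i) = M - i by omega]
    ring

lemma sum_reverse_eq (x y b : B) (γ : ℕ → B) {n N s σ j : ℕ} (hs : N + s = n) (hj : 1 ≤ j)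
    (hjs : j + s ≤ σ + 1) :
    ∑ t ∈ Finset.range (s + 1), γ (n - t) * (b * x ^ (j + t - 1) * y ^ (σ + 1 - (j + t)))
      = b * x ^ (j - 1) * y ^ (σ + 1 - j - s)
        * ∑ t ∈ Finset.range (s + 1), γ (N + t) * x ^ (s - t) * y ^ t := by
  rw [← Finset.sum_range_reflect, Finset.mul_sum]
  refine Finset.sum_congr rfl fun t ht => ?_
  have := Finset.mem_range.1 ht
  rw [show s + 1 - 1 - t = s - t by omega, show n - (s - t) = N + t by omega,
    show j + (s - t) - 1 = (j - 1) + (s - t) by omega,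
    show σ + 1 - (j + (s - t)) = (σ + 1 - j - s) + t by omega]
  ring

variable {k : Type*} [Field k] {m2 σ₁ σ₂ ρ n : ℕ} {col : Fin (m2 + 2) → MvPolynomial (Fin 2) k}
  (θ : MvPolynomial (Fin 2 ⊕ Fin (m2 + 2)) k →+* B)

/-- The image of `g` under a ring homomorphism. -/
noncomputable def gImage (n : ℕ) (col : Fin (m2 + 2) → MvPolynomial (Fin 2) k) : B :=
  ∑ i ∈ Finset.range (n + 1),
    θ (cCoeff k m2 n col i) * θ (X (Sum.inl 0)) ^ (n - i) * θ (X (Sum.inl 1)) ^ i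

/-- `θ` restricts to the standard parametrisation `T_{i,j} ↦ c x^{j-1} y^{σ+1-j}` of the `i`-th
rational normal curve. -/
def ParamBlock (σ₁ ρ i σ : ℕ) (c : B) : Prop :=
  ∀ j, 1 ≤ j → j ≤ σ + 1 → θ (TT k m2 σ₁ ρ i j)
    = c * θ (X (Sum.inl 0)) ^ (j - 1) * θ (X (Sum.inl 1)) ^ (σ + 1 - j)

variable {θ}

lemma ParamBlock.map_piPoly {i σ : ℕ} {c : B} (h : ParamBlock θ σ₁ ρ i σ c) (b : ℕ) :
    θ (piPoly k m2 σ₁ ρ n col i σ b)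
      = c * partialForm (θ (X (Sum.inl 0))) (θ (X (Sum.inl 1)))
          (fun t => θ (cCoeff k m2 n col t)) σ b := by
  simp only [piPoly, partialForm, map_sum, map_mul, Finset.mul_sum]
  refine Finset.sum_congr rfl fun t ht => ?_
  have := Finset.mem_range.1 ht
  rw [h _ (by omega) (by omega), show σ + 1 - t - 1 = σ - t by omega,
    show σ + 1 - (σ + 1 - t) = t by omega]
  ring

lemma ParamBlock.map_sum_piPoly {i σ : ℕ} {c : B} (h : ParamBlock θ σ₁ ρ i σ c) (f b : ℕ) :
    θ (∑ p ∈ Finset.range f, TT k m2 σ₁ ρ i 1 ^ p * TT k m2 σ₁ ρ i (σ + 1) ^ (f - 1 - p)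
        * piPoly k m2 σ₁ ρ n col i σ (b + p * σ))
      = c ^ f * partialForm (θ (X (Sum.inl 0))) (θ (X (Sum.inl 1)))
          (fun t => θ (cCoeff k m2 n col t)) (f * σ) b := by
  rw [← sum_block_partialForm, map_sum]
  refine Finset.sum_congr rfl fun p _ => ?_
  simp [h.map_piPoly, h 1 le_rfl (by omega), h (σ + 1) (by omega) le_rfl]

lemma ParamBlock.map_piPrimePoly {i σ s j N : ℕ} {c : B} (h : ParamBlock θ σ₁ ρ i σ c)
    (hs : N + s = n) (hj : 1 ≤ j) (hjs : j + s ≤ σ + 1) :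
    θ (piPrimePoly k m2 σ₁ ρ n col i s j)
      = c * θ (X (Sum.inl 0)) ^ (j - 1) * θ (X (Sum.inl 1)) ^ (σ + 1 - j - s)
        * θ (DeltaPoly k m2 n col N) := by
  have h1 := sum_reverse_eq (θ (X (Sum.inl 0))) (θ (X (Sum.inl 1))) c
    (fun t => θ (cCoeff k m2 n col t)) hs hj hjs
  simp only [piPrimePoly, DeltaPoly, map_sum, map_mul, map_pow]
  rw [show n - N = s by omega, ← h1]
  refine Finset.sum_congr rfl fun t ht => ?_
  have := Finset.mem_range.1 ht
  rw [h _ (by omega) (by omega)]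

lemma gImage_eq {N : ℕ} (hN : N ≤ n) :
    gImage θ n col = θ (X (Sum.inl 0)) ^ (n - N) *
        partialForm (θ (X (Sum.inl 0))) (θ (X (Sum.inl 1)))
          (fun t => θ (cCoeff k m2 n col t)) N 0
      + θ (X (Sum.inl 1)) ^ N * θ (DeltaPoly k m2 n col N) := by
  rw [gImage, sum_eq_partialForm_add _ _ _ hN]
  simp only [DeltaPoly, map_sum, map_mul, map_pow]

lemma fEmpty_spec (hn : 1 ≤ n) (hσ : 1 ≤ σ₁) :
    fEmpty n σ₁ * σ₁ < n ∧ n ≤ fEmpty n σ₁ * σ₁ + σ₁ ∧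
      σ₁ + 1 - rEmpty n σ₁ = n - fEmpty n σ₁ * σ₁ ∧
      rEmpty n σ₁ + n = fEmpty n σ₁ * σ₁ + σ₁ + 1 := by
  have h1 := Nat.div_add_mod (n - 1) σ₁
  have h2 := Nat.mod_lt (n - 1) hσ
  have h3 : σ₁ * (fEmpty n σ₁ + 1) = fEmpty n σ₁ * σ₁ + σ₁ := by ring
  rw [rEmpty, h3]
  have h4 : σ₁ * ((n - 1) / σ₁) = fEmpty n σ₁ * σ₁ := by rw [fEmpty, mul_comm]
  omega

lemma fOne_spec {a₁ : ℕ} (ha : a₁ * σ₁ < n) (hσ : 1 ≤ σ₂) :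
    a₁ * σ₁ + fOne n σ₁ σ₂ a₁ * σ₂ < n ∧ n ≤ a₁ * σ₁ + fOne n σ₁ σ₂ a₁ * σ₂ + σ₂ ∧
      σ₂ + 1 - rOne n σ₁ σ₂ a₁ = n - (a₁ * σ₁ + fOne n σ₁ σ₂ a₁ * σ₂) ∧
      rOne n σ₁ σ₂ a₁ + n = a₁ * σ₁ + fOne n σ₁ σ₂ a₁ * σ₂ + σ₂ + 1 := by
  have h1 := Nat.div_add_mod (n - a₁ * σ₁ - 1) σ₂
  have h2 := Nat.mod_lt (n - a₁ * σ₁ - 1) hσ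
  have h3 : (fOne n σ₁ σ₂ a₁ + 1) * σ₂ = fOne n σ₁ σ₂ a₁ * σ₂ + σ₂ := by ring
  rw [rOne, h3]
  have h4 : σ₂ * ((n - a₁ * σ₁ - 1) / σ₂) = fOne n σ₁ σ₂ a₁ * σ₂ := by rw [fOne, mul_comm]
  omega

lemma map_Gempty {a : B} (h₁ : ParamBlock θ σ₁ ρ 1 σ₁ a) (hn : 1 ≤ n) (hσ : 1 ≤ σ₁) {j : ℕ}
    (hj : 1 ≤ j) (hjr : j ≤ rEmpty n σ₁) :
    θ (Gempty k m2 σ₁ ρ n col j) = a ^ (fEmpty n σ₁ + 1) * θ (X (Sum.inl 0)) ^ (j - 1)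
      * θ (X (Sum.inl 1)) ^ (rEmpty n σ₁ - j) * gImage θ n col := by
  obtain ⟨h2, h3, h4, h5⟩ := fEmpty_spec hn hσ
  have hS := h₁.map_sum_piPoly (n := n) (col := col) (fEmpty n σ₁) 0
  simp only [zero_add] at hS
  rw [Gempty, map_add, map_mul, map_mul, hS, map_pow, h₁ 1 le_rfl (by omega), h4,
    h₁.map_piPrimePoly (N := fEmpty n σ₁ * σ₁) (by omega) hj (by omega),
    h₁ _ (by omega) (by omega), gImage_eq h2.le,
    show j + σ₁ + 1 - rEmpty n σ₁ - 1 = (j - 1) + (n - fEmpty n σ₁ * σ₁) by omega,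
    show σ₁ + 1 - (j + σ₁ + 1 - rEmpty n σ₁) = rEmpty n σ₁ - j by omega,
    show σ₁ + 1 - j - (n - fEmpty n σ₁ * σ₁) = rEmpty n σ₁ - j by omega]
  simp only [Nat.sub_self, pow_zero, mul_one, Nat.add_sub_cancel]
  ring

lemma map_Gone {a b : B} (h₁ : ParamBlock θ σ₁ ρ 1 σ₁ a) (h₂ : ParamBlock θ σ₁ ρ 2 σ₂ b)
    (hσ : 1 ≤ σ₂) {a₁ j : ℕ} (ha : a₁ * σ₁ < n) (hj : 1 ≤ j) (hjr : j ≤ rOne n σ₁ σ₂ a₁) :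
    θ (Gone k m2 σ₁ σ₂ ρ n col a₁ j) = a ^ a₁ * b ^ (fOne n σ₁ σ₂ a₁ + 1)
      * θ (X (Sum.inl 0)) ^ (j - 1) * θ (X (Sum.inl 1)) ^ (rOne n σ₁ σ₂ a₁ - j)
      * gImage θ n col := by
  obtain ⟨h3, h4, h5, h6⟩ := fOne_spec ha hσ
  have hS := h₁.map_sum_piPoly (n := n) (col := col) a₁ 0
  simp only [zero_add] at hS
  rw [Gone, map_add, map_add, map_mul, map_mul, map_mul, map_mul, map_mul, map_mul, hS,
    h₂.map_sum_piPoly, map_pow, map_pow, map_pow, h₁ 1 le_rfl (by omega),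
    h₂ 1 le_rfl (by omega), h5,
    h₂.map_piPrimePoly (N := a₁ * σ₁ + fOne n σ₁ σ₂ a₁ * σ₂) (by omega) hj (by omega),
    h₂ _ (by omega) (by omega), h₂ (σ₂ + 1) (by omega) le_rfl, gImage_eq h3.le, partialForm_add,
    show j + σ₂ + 1 - rOne n σ₁ σ₂ a₁ - 1
      = (j - 1) + (n - (a₁ * σ₁ + fOne n σ₁ σ₂ a₁ * σ₂)) by omega,
    show σ₂ + 1 - (j + σ₂ + 1 - rOne n σ₁ σ₂ a₁) = rOne n σ₁ σ₂ a₁ - j by omega,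
    show σ₂ + 1 - j - (n - (a₁ * σ₁ + fOne n σ₁ σ₂ a₁ * σ₂)) = rOne n σ₁ σ₂ a₁ - j by omega]
  simp only [Nat.sub_self, pow_zero, mul_one, Nat.add_sub_cancel, zero_add]
  ring

lemma map_Gtwo {a b : B} (h₁ : ParamBlock θ σ₁ ρ 1 σ₁ a) (h₂ : ParamBlock θ σ₁ ρ 2 σ₂ b)
    {a₁ a₂ : ℕ} (ha : a₁ * σ₁ + a₂ * σ₂ < n) :
    θ (Gtwo k m2 σ₁ σ₂ ρ n col a₁ a₂) = a ^ a₁ * b ^ a₂ * gImage θ n col := by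
  have hS := h₁.map_sum_piPoly (n := n) (col := col) a₁ 0
  simp only [zero_add] at hS
  rw [Gtwo, map_add, map_add, map_mul, map_mul, map_mul, map_mul, map_mul, map_mul, hS,
    h₂.map_sum_piPoly, map_pow, map_pow, map_pow, map_pow, h₁ 1 le_rfl (by omega),
    h₂ 1 le_rfl (by omega), h₂ (σ₂ + 1) (by omega) le_rfl, gImage_eq ha.le, partialForm_add,
    Nat.sub_sub]
  simp only [Nat.sub_self, pow_zero, mul_one, Nat.add_sub_cancel, zero_add]
  ring

end Generators

section ImageOfG

variable {k : Type*} [Field k] {m2 σ₁ n : ℕ} {col : Fin (m2 + 2) → MvPolynomial (Fin 2) k}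

lemma sum_monomial_eq_of_isHomogeneous {p : MvPolynomial (Fin 2) k} (hp : p.IsHomogeneous n) :
    ∑ i ∈ Finset.range (n + 1), monomial (Finsupp.single 0 (n - i) + Finsupp.single 1 i)
        (coeff (Finsupp.single 0 (n - i) + Finsupp.single 1 i) p) = p := by
  ext d
  simp only [coeff_sum, coeff_monomial]
  by_cases hd : coeff d p = 0
  · rw [hd]
    refine Finset.sum_eq_zero fun i _ => ?_
    split_ifs with h
    · rw [h, hd]
    · rfl
  · have hdeg := hp hd
    rw [Finsupp.weight_apply, Finsupp.sum_fintype _ _ (by simp), Fin.sum_univ_two] at hdeg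
    simp only [Pi.one_apply, smul_eq_mul, mul_one] at hdeg
    have hd' : Finsupp.single 0 (n - d 1) + Finsupp.single 1 (d 1) = d := by
      ext i
      fin_cases i
      · simp; omega
      · simp
    rw [Finset.sum_eq_single (d 1)]
    · rw [if_pos hd', hd']
    · intro i _ hi
      rw [if_neg]
      rintro rfl
      simp at hi
    · intro h
      exact absurd (Finset.mem_range.2 (by omega)) h

lemma inclXY_eq_sum {p : MvPolynomial (Fin 2) k} (hp : p.IsHomogeneous n) :
    inclXY k p = ∑ i ∈ Finset.range (n + 1),
      C (coeff (Finsupp.single 0 (n - i) + Finsupp.single 1 i) p) * X 0 ^ (n - i) * X 1 ^ i := by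
  conv_lhs => rw [← sum_monomial_eq_of_isHomogeneous hp]
  rw [map_sum]
  refine Finset.sum_congr rfl fun i _ => ?_
  rw [inclXY, aeval_monomial, Finsupp.prod_fintype _ _ (by simp), Fin.prod_univ_two,
    algebraMap_eq, mul_assoc]
  simp

lemma scrollParam_X_inr (hσ : σ₁ ≤ m2) (j : Fin (m2 + 2)) :
    scrollParam k m2 σ₁ (X (Sum.inr j)) = if (j : ℕ) ≤ σ₁ then X 2 * X 0 ^ (j : ℕ) * X 1 ^ (σ₁ - j)
      else X 3 * X 0 ^ ((j : ℕ) - σ₁ - 1) * X 1 ^ (m2 + 1 - j) := by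
  have hT : X (Sum.inr j) = Tvar k (m2 + 2) j := by rw [Tvar, dif_pos j.2]
  rw [hT]
  split_ifs with h
  · exact scrollParam_Tvar_fst k hσ h
  · have := scrollParam_Tvar_snd k hσ (j := j - σ₁ - 1) (by omega)
    rwa [show σ₁ + 1 + ((j : ℕ) - σ₁ - 1) = j by omega,
      show m2 - σ₁ - ((j : ℕ) - σ₁ - 1) = m2 + 1 - j by omega] at this

/-- The scroll parametrisation as a ring homomorphism. -/
noncomputable abbrev scrollHom (k : Type*) [Field k] (m2 σ₁ : ℕ) :
    MvPolynomial (Fin 2 ⊕ Fin (m2 + 2)) k →+* MvPolynomial (Fin 4) k :=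
  (scrollParam k m2 σ₁ : MvPolynomial (Fin 2 ⊕ Fin (m2 + 2)) k →+* MvPolynomial (Fin 4) k)

lemma gImage_scrollParam (hσ : σ₁ ≤ m2) (hcol : ∀ i, (col i).IsHomogeneous n) :
    gImage (scrollHom k m2 σ₁) n col
      = X 2 * inclXY k (gFst σ₁ col) + X 3 * inclXY k (gSnd σ₁ col) := by
  simp only [gImage, cCoeff, map_sum, Finset.sum_mul, RingHom.coe_coe, map_mul]
  rw [Finset.sum_comm, gFst, gSnd, map_sum, map_sum, Finset.mul_sum, Finset.mul_sum,
    ← Finset.sum_add_distrib]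
  refine Finset.sum_congr rfl fun j _ => ?_
  have hx : inclXY k (X 0) = X 0 := by simp [inclXY]
  have hy : inclXY k (X 1) = X 1 := by simp [inclXY]
  have hc : ∀ c : k, scrollParam k m2 σ₁ (C c) = C c := fun c => by
    rw [← algebraMap_eq, AlgHom.commutes]; rfl
  rw [map_mul, map_mul, inclXY_eq_sum (hcol j), scrollParam_X_inr hσ]
  simp only [hc, scrollParam_x, scrollParam_y]
  split_ifs with h
  all_goals
    simp only [map_mul, map_pow, map_zero, zero_mul, mul_zero, hx, hy, Finset.mul_sum,
      Finset.sum_const_zero, add_zero, zero_add]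
    exact Finset.sum_congr rfl fun i _ => by ring

lemma evalAB_comp_scrollParam {α₁ α₂ : MvPolynomial (Fin 2) k} (hσ : σ₁ ≤ m2)
    (hδ : ∀ i, hbDelta k m2 σ₁ col i = if (i : ℕ) ≤ σ₁ then α₁ * X 0 ^ (i : ℕ) * X 1 ^ (σ₁ - i)
        else α₂ * X 0 ^ ((i : ℕ) - σ₁ - 1) * X 1 ^ (m2 + 1 - i)) :
    (evalAB α₁ α₂).comp (scrollParam k m2 σ₁) = PiRees k m2 σ₁ col := by
  ext v : 1
  rw [AlgHom.comp_apply]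
  rcases v with v | j
  · fin_cases v <;> simp [PiRees, evalAB]
  · rw [scrollParam_X_inr hσ, PiRees, aeval_X, Sum.elim_inr, hδ]
    split_ifs
    all_goals
      simp [evalAB]
      ring

end ImageOfG

section Weight

variable {k : Type*} [Field k] {ι : Type*}

/-- If `P ≠ 0` is weighted homogeneous of weight `n` and all monomials of `P * h` have
nonnegative weight, then all monomials of `h` have weight at least `-n`. -/
lemma neg_le_weight_of_mul (w : ι → ℤ) {P h : MvPolynomial ι k} {n : ℤ} (hP : P ≠ 0)
    (hPn : IsWeightedHomogeneous w P n)
    (hPh : ∀ e, coeff e (P * h) ≠ 0 → 0 ≤ Finsupp.weight w e) {e : ι →₀ ℕ}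
    (he : coeff e h ≠ 0) : -n ≤ Finsupp.weight w e := by
  classical
  by_contra! hlt
  let _ := weightedGradedAlgebra k w
  have h1 := DirectSum.coe_decompose_mul_add_of_left_mem (weightedHomogeneousSubmodule k w)
    (j := Finsupp.weight w e) (b := h) hPn
  have h2 : ∀ (i : ℤ) (f : MvPolynomial ι k),
      (DirectSum.decompose (weightedHomogeneousSubmodule k w) f i : MvPolynomial ι k)
        = weightedHomogeneousComponent w i f := fun i f =>
    weightedDecomposition.decompose'_apply k w f i
  rw [h2, h2] at h1
  have h3 : weightedHomogeneousComponent w (n + Finsupp.weight w e) (P * h) = 0 := by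
    ext d
    rw [coeff_weightedHomogeneousComponent, coeff_zero]
    split_ifs with hd
    · by_contra hne
      have := hPh d hne
      omega
    · rfl
  rw [h3] at h1
  have h4 := (mul_eq_zero.1 h1.symm).resolve_left hP
  have h5 := congrArg (coeff e) h4
  rw [coeff_weightedHomogeneousComponent, if_pos rfl] at h5
  exact he h5

end Weight

section ReesIdeal

variable {k : Type*} [Field k] {m2 σ₁ σ₂ ρ n : ℕ} {col : Fin (m2 + 2) → MvPolynomial (Fin 2) k}

/-- The weights on `k[x, y, a, b]` whose nonnegative part contains the image of the scroll
parametrisation. -/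
def scrollWeight (s t : ℕ) : Fin 4 → ℤ := ![1, 1, -s, -t]

lemma weight_scrollWeight (s t : ℕ) (e : Fin 4 →₀ ℕ) :
    Finsupp.weight (scrollWeight s t) e = e 0 + e 1 - e 2 * s - e 3 * t := by
  rw [Finsupp.weight_apply, Finsupp.sum_fintype _ _ (by simp), Fin.sum_univ_four]
  simp [scrollWeight]
  ring

lemma isWeightedHomogeneous_scrollParam_X_inr (hσ : σ₁ ≤ m2) (j : Fin (m2 + 2)) :
    IsWeightedHomogeneous (scrollWeight σ₁ (m2 - σ₁))
      (scrollParam k m2 σ₁ (X (Sum.inr j))) 0 := by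
  have hX := isWeightedHomogeneous_X k (scrollWeight σ₁ (m2 - σ₁))
  rw [scrollParam_X_inr hσ]
  split_ifs with h
  · convert ((hX 2).mul ((hX 0).pow (j : ℕ))).mul ((hX 1).pow (σ₁ - j)) using 1
    simp [scrollWeight, Nat.cast_sub h]
  · convert ((hX 3).mul ((hX 0).pow ((j : ℕ) - σ₁ - 1))).mul ((hX 1).pow (m2 + 1 - j)) using 1
    simp [scrollWeight]
    omega

lemma isWeightedHomogeneous_gImage (hσ : σ₁ ≤ m2) :
    IsWeightedHomogeneous (scrollWeight σ₁ (m2 - σ₁))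
      (gImage (scrollHom k m2 σ₁) n col) n := by
  have hX := isWeightedHomogeneous_X k (scrollWeight σ₁ (m2 - σ₁))
  refine IsWeightedHomogeneous.sum _ _ _ fun i hi => ?_
  have hi := Finset.mem_range.1 hi
  have hc : IsWeightedHomogeneous (scrollWeight σ₁ (m2 - σ₁))
      (scrollParam k m2 σ₁ (cCoeff k m2 n col i)) 0 := by
    rw [cCoeff, map_sum]
    refine IsWeightedHomogeneous.sum _ _ _ fun j _ => ?_
    rw [map_mul, ← algebraMap_eq, AlgHom.commutes, algebraMap_eq]
    simpa using (isWeightedHomogeneous_C (scrollWeight σ₁ (m2 - σ₁)) _).mul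
      (isWeightedHomogeneous_scrollParam_X_inr hσ j)
  simp only [RingHom.coe_coe, scrollParam_x, scrollParam_y]
  convert (hc.mul ((hX 0).pow (n - i))).mul ((hX 1).pow i) using 1
  simp [scrollWeight]
  omega

lemma paramBlock_one (hσ : σ₁ ≤ m2) :
    ParamBlock (scrollHom k m2 σ₁) σ₁ ρ 1 σ₁
      (X 2) := by
  intro j hj hj'
  have := scrollParam_Tvar_fst k hσ (i := j - 1) (by omega)
  rw [TT, if_pos rfl]
  simp only [RingHom.coe_coe, scrollParam_x, scrollParam_y]
  rw [this, show σ₁ - (j - 1) = σ₁ + 1 - j by omega]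

lemma paramBlock_two (hσ : σ₁ + σ₂ = m2) :
    ParamBlock (scrollHom k m2 σ₁) σ₁ 2 2 σ₂
      (X 3) := by
  intro j hj hj'
  have := scrollParam_Tvar_snd k (show σ₁ ≤ m2 by omega) (j := j - 1) (by omega)
  rw [TT, if_neg (by norm_num), if_pos rfl]
  simp only [RingHom.coe_coe, scrollParam_x, scrollParam_y]
  rw [show σ₁ + j = σ₁ + 1 + (j - 1) by omega, this,
    show m2 - σ₁ - (j - 1) = σ₂ + 1 - j by omega]

lemma paramBlock_xy :
    ParamBlock (scrollHom k m2 σ₁) σ₁ 1 2 1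
      1 := by
  intro j hj hj'
  obtain rfl | rfl : j = 1 ∨ j = 2 := by omega
  all_goals simp [TT]

/-- The explicit equations `G_{(a,j)}` of the Rees algebra. -/
def gSet (k : Type*) [Field k] (m2 σ₁ σ₂ ρ n : ℕ)
    (col : Fin (m2 + 2) → MvPolynomial (Fin 2) k) :
    Set (MvPolynomial (Fin 2 ⊕ Fin (m2 + 2)) k) :=
  {p | (∃ j : ℕ, 1 ≤ j ∧ j ≤ rEmpty n σ₁ ∧ p = Gempty k m2 σ₁ ρ n col j)
    ∨ (∃ a₁ j : ℕ, a₁ * σ₁ < n ∧ 1 ≤ j ∧ j ≤ rOne n σ₁ σ₂ a₁ ∧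
        p = Gone k m2 σ₁ σ₂ ρ n col a₁ j)
    ∨ (ρ = 2 ∧ ∃ a₁ a₂ : ℕ, a₁ * σ₁ + a₂ * σ₂ < n ∧
        p = Gtwo k m2 σ₁ σ₂ ρ n col a₁ a₂)}

lemma ScrollData.le (h : ScrollData m2 σ₁ σ₂ ρ n) : σ₁ ≤ m2 := by
  obtain ⟨_, _, h | h⟩ := h <;> omega

lemma ScrollData.exists_paramBlock (h : ScrollData m2 σ₁ σ₂ ρ n) :
    ∃ b, ParamBlock (scrollHom k m2 σ₁)
      σ₁ ρ 2 σ₂ b := by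
  obtain ⟨_, _, ⟨rfl, _, rfl⟩ | ⟨rfl, _, _, h⟩⟩ := h
  · exact ⟨_, paramBlock_xy⟩
  · exact ⟨_, paramBlock_two h⟩

lemma gImage_dvd_of_mem_gSet (hdata : ScrollData m2 σ₁ σ₂ ρ n)
    {p : MvPolynomial (Fin 2 ⊕ Fin (m2 + 2)) k} (hp : p ∈ gSet k m2 σ₁ σ₂ ρ n col) :
    gImage (scrollHom k m2 σ₁) n col ∣ scrollParam k m2 σ₁ p := by
  obtain ⟨b, hb⟩ := hdata.exists_paramBlock (k := k)
  have ha := paramBlock_one (k := k) (ρ := ρ) hdata.le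
  have hσ₂ : 1 ≤ σ₂ := by obtain ⟨_, _, h | h⟩ := hdata <;> omega
  obtain ⟨hσ₁, hn, -⟩ := hdata
  rcases hp with ⟨j, hj, hj', rfl⟩ | ⟨a₁, j, h, hj, hj', rfl⟩ | ⟨-, a₁, a₂, h, rfl⟩
  · exact Dvd.intro_left _ (map_Gempty ha (by omega) hσ₁ hj hj').symm
  · exact Dvd.intro_left _ (map_Gone ha hb hσ₂ h hj hj').symm
  · exact Dvd.intro_left _ (map_Gtwo ha hb h).symm

lemma exists_mem_span_gSet_map_eq (hdata : ScrollData m2 σ₁ σ₂ ρ n) {p q α β : ℕ}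
    (h : p * σ₁ + q * (m2 - σ₁) ≤ α + β + n) :
    ∃ f ∈ Ideal.span (gSet k m2 σ₁ σ₂ ρ n col),
      scrollParam k m2 σ₁ f = X 2 ^ p * X 3 ^ q * (X 0 ^ α * X 1 ^ β) *
        gImage (scrollHom k m2 σ₁) n col := by
  have hσ := hdata.le
  have ha := paramBlock_one (k := k) (ρ := ρ) hσ
  obtain ⟨hσ₁, hn, hd⟩ := hdata
  suffices H : ∃ f ∈ gSet k m2 σ₁ σ₂ ρ n col, ∃ p₀ q₀ α₀ β₀,
      scrollParam k m2 σ₁ f = X 2 ^ p₀ * X 3 ^ q₀ * (X 0 ^ α₀ * X 1 ^ β₀) *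
        gImage (scrollHom k m2 σ₁) n col ∧
      p₀ ≤ p ∧ q₀ ≤ q ∧ α₀ ≤ α ∧ β₀ ≤ β ∧
      (p - p₀) * σ₁ + (q - q₀) * (m2 - σ₁) ≤ (α - α₀) + (β - β₀) by
    obtain ⟨f, hf, p₀, q₀, α₀, β₀, hfe, hp, hq, hα, hβ, hle⟩ := H
    obtain ⟨f', hf'⟩ := exists_scrollParam_eq k hσ hle
    refine ⟨f' * f, Ideal.mul_mem_left _ _ (Ideal.subset_span hf), ?_⟩
    obtain ⟨p, rfl⟩ := Nat.exists_eq_add_of_le hp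
    obtain ⟨q, rfl⟩ := Nat.exists_eq_add_of_le hq
    obtain ⟨α, rfl⟩ := Nat.exists_eq_add_of_le hα
    obtain ⟨β, rfl⟩ := Nat.exists_eq_add_of_le hβ
    rw [map_mul, hf', hfe]
    simp only [Nat.add_sub_cancel_left]
    ring
  rcases le_or_gt n (p * σ₁) with hp | hp
  · obtain ⟨h1, h2, h3, h4⟩ := fEmpty_spec (show 1 ≤ n by omega) hσ₁
    have hfp : fEmpty n σ₁ + 1 ≤ p := Nat.lt_of_mul_lt_mul_right (h1.trans_le hp)
    obtain ⟨p', rfl⟩ := Nat.exists_eq_add_of_le hfp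
    have h5 : (fEmpty n σ₁ + 1 + p') * σ₁ = fEmpty n σ₁ * σ₁ + σ₁ + p' * σ₁ := by ring
    refine ⟨_, Or.inl ⟨min α (rEmpty n σ₁ - 1) + 1, by omega, by omega, rfl⟩,
      fEmpty n σ₁ + 1, 0, min α (rEmpty n σ₁ - 1),
      rEmpty n σ₁ - 1 - min α (rEmpty n σ₁ - 1), ?_, hfp, by omega, by omega, by omega, ?_⟩
    · have := map_Gempty (n := n) (col := col) ha (by omega) hσ₁
        (j := min α (rEmpty n σ₁ - 1) + 1) (by omega) (by omega)
      refine this.trans ?_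
      simp only [RingHom.coe_coe, scrollParam_x, scrollParam_y]
      rw [Nat.add_sub_cancel, Nat.sub_sub, add_comm 1]
      ring
    · rw [Nat.add_sub_cancel_left, Nat.sub_zero]
      omega
  · rcases hd with ⟨rfl, rfl, rfl⟩ | ⟨rfl, hσ₂, -, hm⟩
    · obtain ⟨h1, h2, h3, h4⟩ := fOne_spec (σ₂ := 1) hp le_rfl
      have hr : rOne n σ₁ 1 p = 1 := by omega
      refine ⟨_, Or.inr (Or.inl ⟨p, 1, hp, le_rfl, by omega, rfl⟩), p, 0, 0, 0, ?_, le_rfl,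
        by omega, by omega, by omega, by simp⟩
      refine (map_Gone ha paramBlock_xy le_rfl hp le_rfl (by omega)).trans ?_
      simp [hr]
    · have hb := paramBlock_two (k := k) hm
      obtain rfl : σ₂ = m2 - σ₁ := by omega
      rcases lt_or_ge (p * σ₁ + q * (m2 - σ₁)) n with hq | hq
      · refine ⟨_, Or.inr (Or.inr ⟨rfl, p, q, hq, rfl⟩), p, q, 0, 0, ?_, le_rfl, le_rfl,
          by omega, by omega, by simp⟩
        refine (map_Gtwo ha hb hq).trans ?_
        simp
      · obtain ⟨h1, h2, h3, h4⟩ := fOne_spec hp hσ₂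
        set f := fOne n σ₁ (m2 - σ₁) p
        set r := rOne n σ₁ (m2 - σ₁) p with hr
        have hfq : f + 1 ≤ q := Nat.lt_of_mul_lt_mul_right (a := m2 - σ₁) (by omega)
        obtain ⟨q', rfl⟩ := Nat.exists_eq_add_of_le hfq
        have h5 : (f + 1 + q') * (m2 - σ₁)
          = f * (m2 - σ₁) + (m2 - σ₁) + q' * (m2 - σ₁) := by ring
        refine ⟨_, Or.inr (Or.inl ⟨p, min α (r - 1) + 1, hp, by omega, by omega, rfl⟩),
          p, f + 1, min α (r - 1), r - 1 - min α (r - 1), ?_, le_rfl, hfq, by omega, by omega, ?_⟩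
        · have := map_Gone (n := n) (col := col) ha hb hσ₂ hp
            (j := min α (r - 1) + 1) (by omega) (by omega)
          refine this.trans ?_
          simp only [RingHom.coe_coe, scrollParam_x, scrollParam_y, ← hr]
          rw [Nat.add_sub_cancel, Nat.sub_sub, add_comm 1]
          ring
        · rw [Nat.add_sub_cancel_left, Nat.sub_self, zero_mul]
          omega

lemma exists_mem_span_gSet_of_scrollParam_eq (hdata : ScrollData m2 σ₁ σ₂ ρ n)
    (hg : gImage (scrollHom k m2 σ₁) n col ≠ 0)
    {f : MvPolynomial (Fin 2 ⊕ Fin (m2 + 2)) k}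
    (hf : gImage (scrollHom k m2 σ₁) n col ∣ scrollParam k m2 σ₁ f) :
    ∃ f' ∈ Ideal.span (gSet k m2 σ₁ σ₂ ρ n col),
      scrollParam k m2 σ₁ f' = scrollParam k m2 σ₁ f := by
  have hσ := hdata.le
  obtain ⟨h, hh⟩ := hf
  have hmon : ∀ e : Fin 4 →₀ ℕ, ∃ f' ∈ Ideal.span (gSet k m2 σ₁ σ₂ ρ n col),
      scrollParam k m2 σ₁ f' = monomial e (coeff e h) *
        gImage (scrollHom k m2 σ₁) n col := by
    intro e
    by_cases he : coeff e h = 0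
    · exact ⟨0, zero_mem _, by simp [he]⟩
    have hw := neg_le_weight_of_mul (scrollWeight σ₁ (m2 - σ₁)) hg
      (isWeightedHomogeneous_gImage hσ) (fun d hd => by
        rw [← hh] at hd
        have : d 2 * σ₁ + d 3 * (m2 - σ₁) ≤ d 0 + d 1 :=
          mem_scrollCone_of_coeff_ne_zero k hσ hd
        rw [weight_scrollWeight]
        zify at this
        linarith) he
    rw [weight_scrollWeight] at hw
    have hw' : e 2 * σ₁ + e 3 * (m2 - σ₁) ≤ e 0 + e 1 + n := by
      zify
      linarith
    obtain ⟨f', hf', hfe⟩ := exists_mem_span_gSet_map_eq (k := k) (col := col) hdata hw'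
    refine ⟨C (coeff e h) * f', Ideal.mul_mem_left _ _ hf', ?_⟩
    rw [map_mul, hfe, ← algebraMap_eq, AlgHom.commutes, algebraMap_eq, monomial_eq,
      Finsupp.prod_fintype _ _ (by simp), Fin.prod_univ_four]
    ring
  choose F hF hFe using hmon
  refine ⟨∑ e ∈ h.support, F e, sum_mem fun e _ => hF e, ?_⟩
  rw [map_sum, hh, mul_comm]
  conv_rhs => rw [h.as_sum, Finset.sum_mul]
  exact Finset.sum_congr rfl fun e _ => hFe e

end ReesIdeal

/-!
STATEMENT 8 (Theorem A=L).  With the almost linearly presented setup, the defining ideal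
`𝒜` of the Rees algebra equals
`ℒ = H + ({G_{(a,j)} : a eligible, 1 ≤ j ≤ r(a)})`.
-/

theorem rees_ideal_eq_explicit_generators
    {k : Type*} [Field k] (m2 σ₁ σ₂ ρ n : ℕ)
    (hdata : ScrollData m2 σ₁ σ₂ ρ n)
    (col : Fin (m2 + 2) → MvPolynomial (Fin 2) k)
    (hI : ScrollIdealData k m2 σ₁ n col) :
    reesDefIdeal k m2 σ₁ col =
      scrollH k m2 σ₁ ⊔
        Ideal.span {p | (∃ j : ℕ, 1 ≤ j ∧ j ≤ rEmpty n σ₁ ∧ p = Gempty k m2 σ₁ ρ n col j)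
          ∨ (∃ a₁ j : ℕ, a₁ * σ₁ < n ∧ 1 ≤ j ∧ j ≤ rOne n σ₁ σ₂ a₁ ∧
              p = Gone k m2 σ₁ σ₂ ρ n col a₁ j)
          ∨ (ρ = 2 ∧ ∃ a₁ a₂ : ℕ, a₁ * σ₁ + a₂ * σ₂ < n ∧
              p = Gtwo k m2 σ₁ σ₂ ρ n col a₁ a₂)} := by
  have hσ := hdata.le
  obtain ⟨hcol, hht, hmin⟩ := hI
  have h0 : ∀ i, hbDelta k m2 σ₁ col i ≠ 0 := fun i h => hmin i (by rw [h]; exact zero_mem _)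
  obtain ⟨α₁, α₂, hα₁, hg₂, hs, hd₁, hd₂, hδ⟩ := exists_hbDelta_eq hσ h0
  have hrel : IsRelPrime (gFst σ₁ col) (gSnd σ₁ col) := by
    refine isRelPrime_of_idealHeight_eq_two hht (Ideal.span_le.2 ?_)
    rintro _ ⟨i, rfl⟩
    rw [SetLike.mem_coe, hδ]
    split_ifs
    · exact Ideal.mem_of_dvd _ ((hd₁.mul_right _).mul_right _) (Ideal.subset_span (by simp))
    · exact Ideal.mem_of_dvd _ ((hd₂.mul_right _).mul_right _) (Ideal.subset_span (by simp))
  have hPi := fun f => DFunLike.congr_fun (evalAB_comp_scrollParam hσ hδ) f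
  have hgi := gImage_scrollParam (k := k) hσ hcol
  have hg0 : gImage (scrollHom k m2 σ₁) n col ≠ 0 := by
    intro h
    rw [hgi] at h
    have := congrArg (evalAB (k := k) 0 1) h
    simp only [map_add, map_mul, evalAB_inclXY] at this
    simp [evalAB, hg₂] at this
  have hgk : evalAB α₁ α₂
      (gImage (scrollHom k m2 σ₁) n col) = 0 := by
    rw [hgi]
    exact evalAB_linear_eq_zero hs
  apply le_antisymm
  · intro f hf
    have hf : PiRees k m2 σ₁ col f = 0 := hf
    rw [← hPi, AlgHom.comp_apply] at hf
    have hdvd := dvd_of_evalAB_eq_zero hα₁ hg₂ hs hrel hf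
    rw [← hgi] at hdvd
    obtain ⟨f', hf', hff'⟩ := exists_mem_span_gSet_of_scrollParam_eq hdata hg0 hdvd
    have hH : f - f' ∈ scrollH k m2 σ₁ := by
      rw [← ker_scrollParam k hσ, RingHom.mem_ker, map_sub, hff', sub_self]
    rw [← sub_add_cancel f f']
    exact Submodule.add_mem_sup hH hf'
  · refine sup_le ?_ (Ideal.span_le.2 fun p hp => ?_)
    · intro f hf
      have := scrollH_le_ker_scrollParam k hσ hf
      rw [RingHom.mem_ker] at this
      change PiRees k m2 σ₁ col f = 0
      rw [← hPi, AlgHom.comp_apply, this, map_zero]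
    · obtain ⟨c, hc⟩ := gImage_dvd_of_mem_gSet hdata hp
      change PiRees k m2 σ₁ col p = 0
      rw [← hPi, AlgHom.comp_apply, hc, map_mul, hgk, zero_mul]
end

section
/- With notation as in the context, let s be a positive integer. The minimal homogeneous free resolution of I^s has the form 0 → R(−sd−1)^b ⊕ 𝔽 → R(−sd)^{b₀} → I^s → 0 with b₀ = b + a + 1, where: (1) if ρ = 1, then 𝔽 = ⊕_{u=0}^{a−1} R(−sd + uσ₁ − n), b = sd + C(a,2)σ₁ − an, and a = min{ s, ⌈(n−1)/σ₁⌉ }; (2) if ρ = 2 and σ₁ > σ₂, then 𝔽 = ⊕_{u=0}^{a−1} R(−sd + u(σ₁−σ₂) + (s−1)σ₂ − n), b = s(d + aσ₂) + C(a,2)(σ₁−σ₂) − a(n+σ₂), and a = min{ s, ⌈(n−(s−1)σ₂−1)/(σ₁−σ₂)⌉ } if s ≤ (n−2)/σ₂ + 1 and a = 0 if (n−1)/σ₂ + 1 ≤ s; (3) if ρ = 2 and σ₁ = σ₂, then 𝔽 = R(−sd + (s−1)σ₂ − n)^a, b = s(d + aσ₂) − a(n+σ₂), and a = s if s ≤ (n−2)/σ₂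 + 1 and a = 0 if (n−1)/σ₂ + 1 ≤ s. -/
open MvPolynomial

/-- An element `v` of the graded free module `⊕ᵢ R(−t₀ i)` over `R = k[x,y]` is
homogeneous of degree `e`; i.e. each component `v i` is homogeneous of degree `e - t₀ i`. -/
def VecIsHomogeneous {k : Type*} [Field k] {p : ℕ} (t0 : Fin p → ℕ) (e : ℕ)
    (v : Fin p → MvPolynomial (Fin 2) k) : Prop :=
  ∀ i, (v i).IsHomogeneous (e - t0 i) ∧ (v i ≠ 0 → t0 i ≤ e)

/-- `HasMinimalGradedResolution I t0 t1` says that the (necessarily unique up to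
isomorphism) minimal homogeneous free resolution of the ideal `I ⊆ k[x,y]` has the form
`0 → ⊕ⱼ R(−t1 j) → ⊕ⱼ R(−t0 j) → I → 0` :
there are homogeneous generators `g j` of `I` of degrees `t0 j`, no one of which is
redundant, and a homogeneous basis `s j` (of degrees `t1 j`) of the syzygy module of `g`,
with all entries of the syzygy matrix in the maximal homogeneous ideal. -/
def HasMinimalGradedResolution {k : Type*} [Field k] {p q : ℕ}
    (I : Ideal (MvPolynomial (Fin 2) k)) (t0 : Fin p → ℕ) (t1 : Fin q → ℕ) : Prop :=
  ∃ (g : Fin p → MvPolynomial (Fin 2) k) (s : Fin q → Fin p → MvPolynomial (Fin 2) k),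
    (∀ j, (g j).IsHomogeneous (t0 j)) ∧
    Ideal.span (Set.range g) = I ∧
    (∀ j, g j ∉ Ideal.span (g '' {j' | j' ≠ j})) ∧
    (∀ j, VecIsHomogeneous t0 (t1 j) (s j)) ∧
    (∀ j i, MvPolynomial.coeff 0 (s j i) = 0) ∧
    LinearIndependent (MvPolynomial (Fin 2) k) s ∧
    (∀ v : Fin p → MvPolynomial (Fin 2) k,
      (∑ i, v i * g i = 0) ↔ v ∈ Submodule.span (MvPolynomial (Fin 2) k) (Set.range s))

/-- The Castelnuovo-Mumford regularity `max_{i,j} (t_{i,j} - i)` read off from the twists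
of a free resolution `0 → ⊕ⱼ R(−t1 j) → ⊕ⱼ R(−t0 j) → I → 0`. -/
noncomputable def regOfTwists {p q : ℕ} (t0 : Fin p → ℕ) (t1 : Fin q → ℕ) : ℤ :=
  max ((Finset.univ.sup t0 : ℕ) : ℤ) (((Finset.univ.sup t1 : ℕ) : ℤ) - 1)

/-- `I ⊆ k[x,y]` has Castelnuovo-Mumford regularity `r` (for ideals of projective
dimension at most one). -/
def HasRegularity {k : Type*} [Field k] (I : Ideal (MvPolynomial (Fin 2) k)) (r : ℤ) : Prop :=
  ∃ (p q : ℕ) (t0 : Fin p → ℕ) (t1 : Fin q → ℕ),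
    HasMinimalGradedResolution I t0 t1 ∧ regOfTwists t0 t1 = r

/-- `J ⊆ k[x,y]` is generated by forms `g i`, `i : ι`, all of degree `T`, and the syzygies of `g`
have a homogeneous basis indexed by `κ` whose `j`-th element has entries of positive degree
`N j`. -/
def HasEquigeneratedResolution {k : Type*} [Field k] (ι : Type*) {κ : Type*} [Fintype ι]
    [Fintype κ] (J : Ideal (MvPolynomial (Fin 2) k)) (T : ℕ) (N : κ → ℕ) : Prop :=
  ∃ (g : ι → MvPolynomial (Fin 2) k) (s : κ → ι → MvPolynomial (Fin 2) k),
    (∀ i, (g i).IsHomogeneous T) ∧ Ideal.span (Set.range g) = J ∧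
    (∀ j, 1 ≤ N j) ∧ (∀ j i, (s j i).IsHomogeneous (N j)) ∧
    (∀ j, ∑ i, s j i * g i = 0) ∧
    (∀ c : κ → MvPolynomial (Fin 2) k, (∀ i, ∑ j, c j * s j i = 0) → ∀ j, c j = 0) ∧
    (∀ v : ι → MvPolynomial (Fin 2) k, ∑ i, v i * g i = 0 →
      ∃ c : κ → MvPolynomial (Fin 2) k, ∀ i, v i = ∑ j, c j * s j i)

theorem HasEquigeneratedResolution.reindex {k : Type*} [Field k] {ι κ ι' κ' : Type*} [Fintype ι]
    [Fintype κ] [Fintype ι'] [Fintype κ'] {J : Ideal (MvPolynomial (Fin 2) k)} {T : ℕ}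
    {N : κ → ℕ} (h : HasEquigeneratedResolution ι J T N) (e : ι' ≃ ι) (f : κ' ≃ κ) :
    HasEquigeneratedResolution ι' J T (N ∘ f) := by
  obtain ⟨g, s, hg, hJ, hN, hs, hsyz, hind, hgen⟩ := h
  refine ⟨g ∘ e, fun j i => s (f j) (e i), fun i => hg _, ?_, fun j => hN _, fun j i => hs _ _,
    fun j => ?_, fun c hc j => ?_, fun v hv => ?_⟩
  · rw [e.surjective.range_comp, hJ]
  · exact (e.sum_comp fun i => s (f j) i * g i).trans (hsyz _)
  · have := hind (c ∘ f.symm) (fun i => by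
      rw [← hc (e.symm i), ← f.sum_comp]
      simp) (f j)
    simpa using this
  · obtain ⟨c, hc⟩ := hgen (v ∘ e.symm) (by
      rw [← hv, ← e.sum_comp]
      simp)
    refine ⟨c ∘ f, fun i => ?_⟩
    have := hc (e i)
    simp only [Function.comp, Equiv.symm_apply_apply] at this ⊢
    rw [this, ← f.sum_comp]

/-- A form in the ideal spanned by forms of degree `T` is a combination of them with homogeneous
coefficients. -/
theorem exists_homogeneous_coeffs {k σ : Type*} [Field k] {ι : Type*} [Fintype ι]
    {g : ι → MvPolynomial σ k} {T N : ℕ} (hg : ∀ i, (g i).IsHomogeneous T)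
    {A : MvPolynomial σ k} (hA : A.IsHomogeneous (T + N))
    (hmem : A ∈ Ideal.span (Set.range g)) :
    ∃ α : ι → MvPolynomial σ k, (∀ i, (α i).IsHomogeneous N) ∧ ∑ i, α i * g i = A := by
  classical
  obtain ⟨c, hc⟩ := (Submodule.mem_span_range_iff_exists_fun _).1 hmem
  refine ⟨fun i => homogeneousComponent N (c i), fun i => homogeneousComponent_isHomogeneous _ _,
    ?_⟩
  rw [← homogeneousComponent_eq_self hA, ← hc, map_sum]
  refine Finset.sum_congr rfl fun i _ => ?_
  let := gradedAlgebra (σ := σ) (R := k)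
  have hdec (m : ℕ) (p : MvPolynomial σ k) :
      (DirectSum.decompose (homogeneousSubmodule σ k) p m : MvPolynomial σ k) =
        homogeneousComponent m p := decomposition.decompose'_apply p m
  have := DirectSum.coe_decompose_mul_of_right_mem_of_le (𝒜 := homogeneousSubmodule σ k)
    (a := c i) (n := T + N) (hg i) (Nat.le_add_right _ _)
  rw [Nat.add_sub_cancel_left, hdec, hdec] at this
  exact this.symm

/-- Equigenerated resolutions of `J₁` and `J₂` give one of `G J₁ + A J₂` when `A ∈ J₁` and `G ∈ J₂`
are relatively prime forms: there is one new syzygy, expressing `G A = A G`. -/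
theorem HasEquigeneratedResolution.join {k : Type*} [Field k] {ι₁ κ₁ ι₂ κ₂ : Type*} [Fintype ι₁]
    [Fintype κ₁] [Fintype ι₂] [Fintype κ₂] {J₁ J₂ : Ideal (MvPolynomial (Fin 2) k)}
    {T₁ T₂ : ℕ} {N₁ : κ₁ → ℕ} {N₂ : κ₂ → ℕ} (h₁ : HasEquigeneratedResolution ι₁ J₁ T₁ N₁)
    (h₂ : HasEquigeneratedResolution ι₂ J₂ T₂ N₂) {A G : MvPolynomial (Fin 2) k} {N : ℕ}
    (hN : 1 ≤ N) (hA : A.IsHomogeneous (T₁ + N)) (hG : G.IsHomogeneous (T₂ + N))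
    (hA0 : A ≠ 0) (hAG : IsRelPrime A G) (hAJ : A ∈ J₁) (hGJ : G ∈ J₂) :
    HasEquigeneratedResolution (ι₁ ⊕ ι₂) (Ideal.span {G} * J₁ + Ideal.span {A} * J₂)
      (T₁ + T₂ + N) (Sum.elim (Sum.elim N₁ N₂) fun _ : Unit => N) := by
  obtain ⟨g₁, s₁, hg₁, rfl, hN₁, hs₁, hsyz₁, hind₁, hgen₁⟩ := h₁
  obtain ⟨g₂, s₂, hg₂, rfl, hN₂, hs₂, hsyz₂, hind₂, hgen₂⟩ := h₂
  obtain ⟨α, hα, hαA⟩ := exists_homogeneous_coeffs hg₁ hA hAJ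
  obtain ⟨γ, hγ, hγG⟩ := exists_homogeneous_coeffs hg₂ hG hGJ
  refine ⟨Sum.elim (fun i => G * g₁ i) (fun i => A * g₂ i),
    Sum.elim (Sum.elim (fun j => Sum.elim (s₁ j) 0) (fun j => Sum.elim 0 (s₂ j)))
      (fun _ => Sum.elim α (-γ)), ?_, ?_, ?_, ?_, ?_, ?_, ?_⟩
  · rintro (i | i)
    · exact (show T₂ + N + T₁ = T₁ + T₂ + N by ring) ▸ hG.mul (hg₁ i)
    · exact (show T₁ + N + T₂ = T₁ + T₂ + N by ring) ▸ hA.mul (hg₂ i)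
  · rw [Set.Sum.elim_range, Ideal.span_union, Ideal.span_mul_span', Ideal.span_mul_span',
      Set.singleton_mul, Set.singleton_mul, ← Set.range_comp, ← Set.range_comp]
    rfl
  · rintro ((j | j) | j)
    exacts [hN₁ j, hN₂ j, hN]
  · rintro ((j | j) | j) (i | i)
    exacts [hs₁ j i, isHomogeneous_zero _ _ _, isHomogeneous_zero _ _ _, hs₂ j i, hα i,
      (hγ i).neg]
  · have e₁ (v : ι₁ → MvPolynomial (Fin 2) k) : ∑ i, v i * (G * g₁ i) = G * ∑ i, v i * g₁ i := by
      rw [Finset.mul_sum]; exact Finset.sum_congr rfl fun i _ => by ring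
    have e₂ (v : ι₂ → MvPolynomial (Fin 2) k) : ∑ i, v i * (A * g₂ i) = A * ∑ i, v i * g₂ i := by
      rw [Finset.mul_sum]; exact Finset.sum_congr rfl fun i _ => by ring
    rintro ((j | j) | j)
    · simp [e₁, hsyz₁]
    · simp [e₂, hsyz₂]
    · simp only [Fintype.sum_sum_type, Sum.elim_inl, Sum.elim_inr, e₁, e₂, Pi.neg_apply, neg_mul,
        Finset.sum_neg_distrib, hαA, hγG]
      ring
  · intro c hc
    have hc₁ (i : ι₁) := hc (Sum.inl i)
    have hc₂ (i : ι₂) := hc (Sum.inr i)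
    simp only [Fintype.sum_sum_type, Sum.elim_inl, Sum.elim_inr, Pi.zero_apply, mul_zero,
      Finset.sum_const_zero, add_zero, zero_add, Pi.neg_apply, Finset.univ_unique,
      Finset.sum_singleton] at hc₁ hc₂
    have h0 : c (Sum.inr default) = 0 := by
      have : ∑ i, (∑ j, c (Sum.inl (Sum.inl j)) * s₁ j i + c (Sum.inr default) * α i) * g₁ i
          = 0 := Finset.sum_eq_zero fun i _ => by rw [hc₁ i, zero_mul]
      simp only [add_mul, Finset.sum_add_distrib, Finset.sum_mul, mul_assoc] at this
      rw [Finset.sum_comm, ← Finset.mul_sum, hαA] at this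
      simp only [← Finset.mul_sum, hsyz₁, mul_zero, Finset.sum_const_zero, zero_add] at this
      exact (mul_eq_zero.1 this).resolve_right hA0
    simp only [h0, zero_mul, add_zero] at hc₁ hc₂
    rintro ((j | j) | j)
    · exact hind₁ (fun j => c (Sum.inl (Sum.inl j))) hc₁ j
    · exact hind₂ (fun j => c (Sum.inl (Sum.inr j))) (by simpa using hc₂) j
    · exact h0
  · intro v hv
    simp only [Fintype.sum_sum_type, Sum.elim_inl, Sum.elim_inr] at hv
    have hv' : G * ∑ i, v (Sum.inl i) * g₁ i + A * ∑ i, v (Sum.inr i) * g₂ i = 0 := by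
      rw [← hv, Finset.mul_sum, Finset.mul_sum]
      congr 1 <;> exact Finset.sum_congr rfl fun i _ => by ring
    obtain ⟨h, hh⟩ : A ∣ ∑ i, v (Sum.inl i) * g₁ i :=
      hAG.dvd_of_dvd_mul_left ⟨-∑ i, v (Sum.inr i) * g₂ i, by linear_combination hv'⟩
    have hh' : ∑ i, v (Sum.inr i) * g₂ i = -(h * G) := by
      apply mul_left_cancel₀ hA0
      rw [hh] at hv'
      linear_combination hv'
    obtain ⟨c₁, hc₁⟩ := hgen₁ (fun i => v (Sum.inl i) - h * α i) (by
      simp only [sub_mul, Finset.sum_sub_distrib, mul_assoc, ← Finset.mul_sum, hαA, hh]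
      ring)
    obtain ⟨c₂, hc₂⟩ := hgen₂ (fun i => v (Sum.inr i) + h * γ i) (by
      simp only [add_mul, Finset.sum_add_distrib, mul_assoc, ← Finset.mul_sum, hγG, hh']
      ring)
    refine ⟨Sum.elim (Sum.elim c₁ c₂) fun _ => h, ?_⟩
    rintro (i | i)
    · simp [← hc₁]
    · simp [← hc₂]

/-- An equigenerated resolution all of whose entries have positive degree is minimal. -/
theorem HasEquigeneratedResolution.hasMinimalGradedResolution {k : Type*} [Field k] {p q : ℕ}
    {J : Ideal (MvPolynomial (Fin 2) k)} {T : ℕ} {N : Fin q → ℕ}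
    (h : HasEquigeneratedResolution (Fin p) J T N) {t1 : Fin q → ℕ} (ht : ∀ j, t1 j = T + N j) :
    HasMinimalGradedResolution J (fun _ : Fin p => T) t1 := by
  obtain ⟨g, s, hg, hJ, hN, hs, hsyz, hind, hgen⟩ := h
  have hcoeff : ∀ j i, MvPolynomial.coeff 0 (s j i) = 0 := fun j i =>
    (hs j i).coeff_eq_zero (by have := hN j; simp; omega)
  refine ⟨g, s, hg, hJ, fun j hj => ?_, fun j i => ?_, hcoeff, ?_, fun v => ⟨fun hv => ?_, ?_⟩⟩
  · rw [Ideal.span, Finsupp.mem_span_image_iff_linearCombination] at hj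
    obtain ⟨l, hl, hlj⟩ := hj
    have hlj0 : l j = 0 := by
      by_contra hne
      exact (Finsupp.mem_supported _ _).1 hl (Finsupp.mem_support_iff.2 hne) rfl
    rw [Finsupp.linearCombination_apply, Finsupp.sum_fintype _ _ (by simp)] at hlj
    obtain ⟨c, hc⟩ := hgen (fun i => Pi.single (M := fun _ => MvPolynomial (Fin 2) k) j 1 i - l i)
      (by simp [sub_mul, ← hlj, Pi.single_apply])
    have h1 := congrArg constantCoeff (hc j)
    have hcc : ∀ i, constantCoeff (s i j) = 0 := fun i => hcoeff i j
    simp only [Pi.single_eq_same, hlj0, sub_zero, map_one, map_sum, map_mul, hcc, mul_zero,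
      Finset.sum_const_zero, one_ne_zero] at h1
  · rw [ht j, Nat.add_sub_cancel_left]
    exact ⟨hs j i, fun _ => Nat.le_add_right _ _⟩
  · refine Fintype.linearIndependent_iff.2 fun c hc => hind c fun i => ?_
    simpa using congrFun hc i
  · obtain ⟨c, hc⟩ := hgen v hv
    refine (Submodule.mem_span_range_iff_exists_fun _).2 ⟨c, ?_⟩
    ext1 i
    simp [hc i]
  · intro hv
    obtain ⟨c, rfl⟩ := (Submodule.mem_span_range_iff_exists_fun _).1 hv
    simp only [Finset.sum_apply, Pi.smul_apply, smul_eq_mul, Finset.sum_mul, mul_assoc]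
    rw [Finset.sum_comm]
    simp [← Finset.mul_sum, hsyz]

theorem finrank_homogeneousSubmodule_fin_two (k : Type*) [Field k] (e : ℕ) :
    Module.finrank k (homogeneousSubmodule (Fin 2) k e) = e + 1 := by
  classical
  have hfin : ({d : Fin 2 →₀ ℕ | d.degree = e}) =
      ((Finset.univ : Finset (Fin 2)).finsuppAntidiag e : Set (Fin 2 →₀ ℕ)) := by
    ext d
    simp [Finset.mem_finsuppAntidiag, Finsupp.degree_eq_sum]
  have h1 : homogeneousSubmodule (Fin 2) k e = restrictSupport k {d | d.degree = e} :=
    homogeneousSubmodule_eq_finsupp_supported _ _ _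
  rw [h1, Module.finrank_eq_nat_card_basis (basisRestrictSupport k _), hfin]
  rw [Nat.card_coe_set_eq, Set.ncard_coe_finset, ← Finset.Nat.card_antidiagonal]
  refine Finset.card_bij (fun d _ => (d 0, d 1)) ?_ ?_ ?_
  · intro d hd
    simpa [Finset.mem_finsuppAntidiag] using hd
  · intro d _ d' _ h
    ext i
    fin_cases i
    exacts [congrArg Prod.fst h, congrArg Prod.snd h]
  · rintro ⟨i, j⟩ h
    exact ⟨Finsupp.equivFunOnFinite.symm ![i, j],
      by simpa [Finset.mem_finsuppAntidiag] using h, by simp⟩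

theorem MvPolynomial.IsHomogeneous.mem_pow_idealOfVars {k σ : Type*} [Field k]
    {p : MvPolynomial σ k} {d e : ℕ}
    (hp : p.IsHomogeneous d) (h : e ≤ d) : p ∈ idealOfVars σ k ^ e := by
  rw [mem_pow_idealOfVars_iff']
  intro x hx
  exact hp.coeff_eq_zero (by omega)

/-- If `F`, `G` are relatively prime forms in `k[x,y]` of degrees `p`, `q`, every form of degree at
least `p + q - 1` lies in `(F, G)`. -/
theorem pow_idealOfVars_le_of_isRelPrime {k : Type*} [Field k] {F G : MvPolynomial (Fin 2) k}
    {p q : ℕ} (hF : F.IsHomogeneous (p + 1)) (hG : G.IsHomogeneous (q + 1)) (hF0 : F ≠ 0)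
    (hFG : IsRelPrime F G) (l : ℕ) :
    idealOfVars (Fin 2) k ^ (p + q + 1 + l) ≤
      Ideal.span {G} * idealOfVars (Fin 2) k ^ (p + l) +
        Ideal.span {F} * idealOfVars (Fin 2) k ^ (q + l) := by
  have base : ∀ P : MvPolynomial (Fin 2) k, P.IsHomogeneous (p + q + 1) →
      ∃ u v : MvPolynomial (Fin 2) k, u.IsHomogeneous p ∧ v.IsHomogeneous q ∧
        G * u + F * v = P := by
    let Φ : (homogeneousSubmodule (Fin 2) k p × homogeneousSubmodule (Fin 2) k q) →ₗ[k]
        homogeneousSubmodule (Fin 2) k (p + q + 1) :=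
      LinearMap.codRestrict _
        (((LinearMap.mulLeft k G).comp (Submodule.subtype _)).coprod
          ((LinearMap.mulLeft k F).comp (Submodule.subtype _))) fun x => by
        have h1 := hG.mul x.1.2
        have h2 := hF.mul x.2.2
        rw [show q + 1 + p = p + q + 1 by ring] at h1
        rw [show p + 1 + q = p + q + 1 by ring] at h2
        exact h1.add h2
    have hinj : Function.Injective Φ := by
      rw [← LinearMap.ker_eq_bot, LinearMap.ker_eq_bot']
      rintro ⟨⟨u, hu⟩, ⟨v, hv⟩⟩ h
      have h : G * u + F * v = 0 := congrArg Subtype.val h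
      obtain ⟨w, rfl⟩ : F ∣ u := hFG.dvd_of_dvd_mul_left ⟨-v, by linear_combination h⟩
      have hw : w = 0 := by
        by_contra hw
        have h1 := IsHomogeneous.totalDegree hu (mul_ne_zero hF0 hw)
        rw [totalDegree_mul_of_isDomain hF0 hw, hF.totalDegree hF0] at h1
        omega
      subst hw
      have hv0 : v = 0 := by simpa [hF0] using h
      subst hv0
      simp
    have hsurj : Function.Surjective Φ := by
      have : FiniteDimensional k (homogeneousSubmodule (Fin 2) k p) :=
        Module.finite_of_finrank_pos (by rw [finrank_homogeneousSubmodule_fin_two]; omega)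
      have : FiniteDimensional k (homogeneousSubmodule (Fin 2) k q) :=
        Module.finite_of_finrank_pos (by rw [finrank_homogeneousSubmodule_fin_two]; omega)
      have : FiniteDimensional k (homogeneousSubmodule (Fin 2) k (p + q + 1)) :=
        Module.finite_of_finrank_pos (by rw [finrank_homogeneousSubmodule_fin_two]; omega)
      refine (LinearMap.injective_iff_surjective_of_finrank_eq_finrank ?_).1 hinj
      simp only [Module.finrank_prod, finrank_homogeneousSubmodule_fin_two]
      omega
    intro P hP
    obtain ⟨⟨⟨u, hu⟩, ⟨v, hv⟩⟩, h⟩ := hsurj ⟨P, hP⟩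
    exact ⟨u, v, hu, hv, congrArg Subtype.val h⟩
  have hbase : idealOfVars (Fin 2) k ^ (p + q + 1) ≤
      Ideal.span {G} * idealOfVars (Fin 2) k ^ p +
        Ideal.span {F} * idealOfVars (Fin 2) k ^ q := by
    rw [pow_idealOfVars_eq_span, Ideal.span_le]
    rintro _ ⟨x, hx, rfl⟩
    obtain ⟨u, v, hu, hv, h⟩ := base _ (isHomogeneous_monomial (1 : k) hx)
    simp only [SetLike.mem_coe, ← h]
    exact Submodule.add_mem_sup
      (Ideal.mul_mem_mul (Ideal.mem_span_singleton_self _)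
        (IsHomogeneous.mem_pow_idealOfVars (p := u) hu le_rfl))
      (Ideal.mul_mem_mul (Ideal.mem_span_singleton_self _)
        (IsHomogeneous.mem_pow_idealOfVars (p := v) hv le_rfl))
  rw [pow_add _ (p + q + 1), pow_add _ p, pow_add _ q, ← mul_assoc, ← mul_assoc, ← add_mul]
  exact Ideal.mul_mono_left hbase

theorem Ideal.add_pow_succ_eq {R : Type*} [CommRing R] (a b : Ideal R) (r : ℕ) :
    (a + b) ^ (r + 1) = b ^ (r + 1) + a * (a + b) ^ r := by
  induction r with
  | zero => simp [add_comm]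
  | succ r ih =>
    have h : a * b ^ (r + 1) ≤ a * (a + b) ^ (r + 1) :=
      Ideal.mul_mono_right (Ideal.pow_right_mono le_sup_right _)
    have e : (a + b) ^ (r + 1 + 1) =
        a * (a + b) ^ (r + 1) + b ^ (r + 1 + 1) + b * (a * (a + b) ^ r) := by
      rw [pow_succ', add_mul]
      nth_rewrite 2 [ih]
      ring
    have h2 : b * (a * (a + b) ^ r) ≤ a * (a + b) ^ (r + 1) := by
      rw [mul_left_comm, pow_succ']
      exact Ideal.mul_mono_right (Ideal.mul_mono_left le_sup_right)
    rw [e, Submodule.add_eq_sup, Submodule.add_eq_sup, sup_comm _ (b ^ (r + 1 + 1)),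
      sup_assoc, sup_eq_left.2 h2, Submodule.add_eq_sup, Submodule.add_eq_sup]

theorem idealOfVars_fin_two (k : Type*) [Field k] :
    idealOfVars (Fin 2) k = Ideal.span {X 0} + Ideal.span {X 1} := by
  rw [idealOfVars, Submodule.add_eq_sup, ← Ideal.span_union]
  congr 1
  ext p
  simp [Fin.exists_fin_two, eq_comm, or_comm]

theorem pow_idealOfVars_fin_two_succ (k : Type*) [Field k] (D : ℕ) :
    idealOfVars (Fin 2) k ^ (D + 1) =
      Ideal.span {X 1 ^ (D + 1)} + Ideal.span {X 0} * idealOfVars (Fin 2) k ^ D := by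
  rw [idealOfVars_fin_two, Ideal.add_pow_succ_eq, Ideal.span_singleton_pow]

theorem pow_idealOfVars_fin_two_eq_span (k : Type*) [Field k] (D : ℕ) :
    idealOfVars (Fin 2) k ^ D =
      Ideal.span {p | ∃ i j : ℕ, i + j = D ∧ p = X 0 ^ i * X 1 ^ j} := by
  apply le_antisymm
  · rw [pow_idealOfVars_eq_span, Ideal.span_le]
    rintro _ ⟨x, hx, rfl⟩
    refine Ideal.subset_span ⟨x 0, x 1, ?_, ?_⟩
    · simpa [Finsupp.degree_eq_sum] using hx
    · simp [monomial_eq, Finsupp.prod_fintype]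
  · rw [Ideal.span_le]
    rintro _ ⟨i, j, h, rfl⟩
    exact IsHomogeneous.mem_pow_idealOfVars
      ((isHomogeneous_X_pow 0 i).mul (isHomogeneous_X_pow 1 j)) h.ge

theorem hasEquigeneratedResolution_pow_idealOfVars (k : Type*) [Field k] (D : ℕ) :
    HasEquigeneratedResolution (Fin (D + 1)) (idealOfVars (Fin 2) k ^ D) D
      fun _ : Fin D => 1 := by
  have h0 : HasEquigeneratedResolution (Fin 1) (idealOfVars (Fin 2) k ^ 0) 0
      fun _ : Fin 0 => 1 :=
    ⟨fun _ => 1, fun j => j.elim0, fun _ => isHomogeneous_one _ _, by simp, fun j => j.elim0,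
      fun j => j.elim0, fun j => j.elim0, fun _ _ j => j.elim0, fun v hv =>
        ⟨fun j => j.elim0, fun i => by simpa [Subsingleton.elim i 0] using hv⟩⟩
  induction D with
  | zero => exact h0
  | succ D ih =>
    have hrel : IsRelPrime (X 0 : MvPolynomial (Fin 2) k) (X 1 ^ (D + 1)) := by
      apply IsRelPrime.pow_right
      rw [(X_prime (R := k) (i := (0 : Fin 2))).irreducible.isRelPrime_iff_not_dvd]
      simp
    have hX : (X 1 ^ (D + 1) : MvPolynomial (Fin 2) k).IsHomogeneous (D + 1) :=
      isHomogeneous_X_pow 1 (D + 1)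
    have h := h0.join ih (A := X 0) (G := X 1 ^ (D + 1)) (N := 1) le_rfl (isHomogeneous_X k 0)
      hX (X_ne_zero 0) hrel (by simp) (hX.mem_pow_idealOfVars (Nat.le_succ D))
    rw [pow_zero, mul_one, ← pow_idealOfVars_fin_two_succ, zero_add] at h
    have e : Fin (D + 1 + 1) ≃ Fin 1 ⊕ Fin (D + 1) :=
      Fintype.equivOfCardEq (by simp; ring)
    have f : Fin (D + 1) ≃ (Fin 0 ⊕ Fin D) ⊕ Unit := Fintype.equivOfCardEq (by simp)
    have h' := h.reindex e f
    convert! h' using 1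
    funext j
    obtain ⟨j', hj⟩ := f.symm.surjective j
    subst hj
    rcases j' with ((j | j) | j) <;> simp

theorem HasEquigeneratedResolution.join_pow_idealOfVars {k : Type*} [Field k] {e b a : ℕ}
    {J : Ideal (MvPolynomial (Fin 2) k)} {T : ℕ} {N : Fin a → ℕ}
    (h : HasEquigeneratedResolution (Fin (b + a + 1)) J T (Sum.elim (fun _ : Fin b => 1) N))
    {A G : MvPolynomial (Fin 2) k} {N₀ : ℕ}
    (hN : 1 ≤ N₀) (hA : A.IsHomogeneous (e + N₀)) (hG : G.IsHomogeneous (T + N₀))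
    (hA0 : A ≠ 0) (hAG : IsRelPrime A G) (hGJ : G ∈ J) :
    HasEquigeneratedResolution (Fin (e + b + (a + 1) + 1))
      (Ideal.span {G} * idealOfVars (Fin 2) k ^ e + Ideal.span {A} * J) (e + T + N₀)
      (Sum.elim (fun _ : Fin (e + b) => 1) (Fin.cons N₀ N : Fin (a + 1) → ℕ)) := by
  have h' := (hasEquigeneratedResolution_pow_idealOfVars k e).join h hN hA hG hA0 hAG
    (hA.mem_pow_idealOfVars (Nat.le_add_right _ _)) hGJ
  have i : Fin (e + b + (a + 1) + 1) ≃ Fin (e + 1) ⊕ Fin (b + a + 1) :=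
    Fintype.equivOfCardEq (by simp; ring)
  let f : (Fin e ⊕ Fin b ⊕ Fin a) ⊕ Unit ≃ Fin (e + b) ⊕ Fin (a + 1) :=
    ((Equiv.sumAssoc _ _ _).symm.sumCongr (Equiv.refl _)).trans <|
      (Equiv.sumAssoc _ _ _).trans <| finSumFinEquiv.sumCongr <|
        (Equiv.optionEquivSumPUnit _).symm.trans (finSuccEquiv a).symm
  convert! h'.reindex i f.symm using 1
  funext j
  obtain ⟨j', hj⟩ := f.surjective j
  subst hj
  rcases j' with ((j | j | j) | j) <;> simp [f]

theorem pow_idealOfVars_mul_pow_succ {k : Type*} [Field k] (A B : MvPolynomial (Fin 2) k)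
    (σ τ r i : ℕ) :
    idealOfVars (Fin 2) k ^ (i * σ) * (Ideal.span {A} * idealOfVars (Fin 2) k ^ σ +
        Ideal.span {B} * idealOfVars (Fin 2) k ^ τ) ^ (r + 1) =
      Ideal.span {B ^ (r + 1)} * idealOfVars (Fin 2) k ^ (i * σ + (r + 1) * τ) +
        Ideal.span {A} * (idealOfVars (Fin 2) k ^ ((i + 1) * σ) *
          (Ideal.span {A} * idealOfVars (Fin 2) k ^ σ +
            Ideal.span {B} * idealOfVars (Fin 2) k ^ τ) ^ r) := by
  rw [Ideal.add_pow_succ_eq, mul_pow, Ideal.span_singleton_pow]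
  ring

section PowersOfTwoBlockIdeal

variable {k : Type*} [Field k] {A B : MvPolynomial (Fin 2) k} {n τ Δ : ℕ}

theorem pow_idealOfVars_mul_pow_eq (hA : A.IsHomogeneous (n + τ))
    (hB : B.IsHomogeneous (n + τ + Δ)) (hA0 : A ≠ 0) (hAB : IsRelPrime A B) (hn : 1 ≤ n)
    (r i : ℕ) (hhigh : ∀ j, i ≤ j → j < r + i → n ≤ 1 + (r + i - 1) * τ + j * Δ) :
    idealOfVars (Fin 2) k ^ (i * (τ + Δ)) *
      (Ideal.span {A} * idealOfVars (Fin 2) k ^ (τ + Δ) +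
        Ideal.span {B} * idealOfVars (Fin 2) k ^ τ) ^ r =
      idealOfVars (Fin 2) k ^ (i * (τ + Δ) + r * (n + 2 * τ + Δ)) := by
  induction r generalizing i with
  | zero => simp
  | succ r ih =>
    rw [pow_idealOfVars_mul_pow_succ, ih (i + 1) fun j h1 h2 => by
      have := hhigh j (by omega) (by omega)
      rwa [show r + 1 + i = r + (i + 1) by ring] at this]
    have hi := hhigh i le_rfl (by omega)
    rw [show r + 1 + i - 1 = r + i by omega] at hi
    have hG : (B ^ (r + 1)).IsHomogeneous ((n + τ + Δ) * (r + 1)) := hB.pow _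
    obtain ⟨p, hp⟩ : ∃ p, n + τ = p + 1 := ⟨n + τ - 1, by omega⟩
    obtain ⟨l, hl⟩ : ∃ l, i * (τ + Δ) + (r + 1) * τ = p + l :=
      ⟨i * (τ + Δ) + (r + 1) * τ - p, by
        have : n + τ ≤ i * (τ + Δ) + (r + 1) * τ + 1 := by linarith
        omega⟩
    obtain ⟨q, hq⟩ : ∃ q, (n + τ + Δ) * (r + 1) = q + 1 :=
      Nat.exists_eq_succ_of_ne_zero (by positivity)
    have key := pow_idealOfVars_le_of_isRelPrime (hp ▸ hA) (hq ▸ hG) hA0 hAB.pow_right l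
    have e1 : (i + 1) * (τ + Δ) + r * (n + 2 * τ + Δ) = q + l := by linarith
    have e2 : i * (τ + Δ) + (r + 1) * (n + 2 * τ + Δ) = p + q + 1 + l := by linarith
    rw [hl, e1, e2]
    refine le_antisymm (sup_le ?_ ?_) key
    · rw [show p + q + 1 + l = q + 1 + (p + l) by ring, pow_add _ (q + 1)]
      refine Ideal.mul_mono_left ((Ideal.span_singleton_le_iff_mem _).2 ?_)
      exact hG.mem_pow_idealOfVars hq.ge
    · rw [show p + q + 1 + l = p + 1 + (q + l) by ring, pow_add _ (p + 1)]
      refine Ideal.mul_mono_left ((Ideal.span_singleton_le_iff_mem _).2 ?_)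
      exact hA.mem_pow_idealOfVars hp.ge

theorem exists_hasEquigeneratedResolution_pow_mul_pow (hA : A.IsHomogeneous (n + τ))
    (hB : B.IsHomogeneous (n + τ + Δ)) (hA0 : A ≠ 0) (hAB : IsRelPrime A B) (hn : 1 ≤ n)
    (r₀ a : ℕ) (hlow : ∀ j, j < a → 2 + (r₀ + a - 1) * τ + j * Δ ≤ n)
    (hhigh : ∀ j, a ≤ j → j < r₀ + a → n ≤ 1 + (r₀ + a - 1) * τ + j * Δ)
    (l i : ℕ) (hli : i + l = a) :
    ∃ b : ℕ, b + ∑ v ∈ Finset.range i, (v * Δ + (r₀ + a) * τ) =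
        a * (τ + Δ) + r₀ * (n + 2 * τ + Δ) + ∑ v ∈ Finset.range a, (v * Δ + (r₀ + a) * τ) ∧
      HasEquigeneratedResolution (Fin (b + l + 1))
        (idealOfVars (Fin 2) k ^ (i * (τ + Δ)) *
          (Ideal.span {A} * idealOfVars (Fin 2) k ^ (τ + Δ) +
            Ideal.span {B} * idealOfVars (Fin 2) k ^ τ) ^ (r₀ + l))
        (i * (τ + Δ) + (r₀ + l) * (n + 2 * τ + Δ))
        (Sum.elim (fun _ : Fin b => 1)
          fun u : Fin l => n - ((i + u) * Δ + (r₀ + a - 1) * τ)) := by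
  induction l generalizing i with
  | zero =>
    obtain rfl : i = a := by omega
    refine ⟨_, rfl, ?_⟩
    rw [add_zero r₀, pow_idealOfVars_mul_pow_eq hA hB hA0 hAB hn r₀ i hhigh]
    convert! (hasEquigeneratedResolution_pow_idealOfVars k
      (i * (τ + Δ) + r₀ * (n + 2 * τ + Δ))).reindex (Equiv.refl _)
        (Equiv.sumEmpty _ (Fin 0)) using 1
    funext j
    rcases j with j | j
    · rfl
    · exact j.elim0
  | succ l ih =>
    obtain ⟨b, hb, hres⟩ := ih (i + 1) (by omega)
    have hi := hlow i (by omega)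
    have hra : r₀ + a - 1 = r₀ + l + i := by omega
    have hra' : r₀ + a = r₀ + l + i + 1 := by omega
    obtain ⟨N₀, hN₀⟩ : ∃ N₀, n = N₀ + (i * Δ + (r₀ + l + i) * τ) :=
      ⟨n - (i * Δ + (r₀ + l + i) * τ), by rw [hra] at hi; omega⟩
    have hN₀2 : 2 ≤ N₀ := by rw [hra] at hi; omega
    have hG : (B ^ (r₀ + l + 1)).IsHomogeneous ((n + τ + Δ) * (r₀ + l + 1)) := hB.pow _
    have hdG : (n + τ + Δ) * (r₀ + l + 1) =
        (i + 1) * (τ + Δ) + (r₀ + l) * (n + 2 * τ + Δ) + N₀ := by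
      linarith
    have hdA : n + τ = i * (τ + Δ) + (r₀ + l + 1) * τ + N₀ := by linarith
    have hGJ : B ^ (r₀ + l + 1) ∈ idealOfVars (Fin 2) k ^ ((i + 1) * (τ + Δ)) *
          (Ideal.span {A} * idealOfVars (Fin 2) k ^ (τ + Δ) +
            Ideal.span {B} * idealOfVars (Fin 2) k ^ τ) ^ (r₀ + l) := by
      have h1 : idealOfVars (Fin 2) k ^ ((i + 1) * (τ + Δ) + τ * (r₀ + l)) *
          Ideal.span {B ^ (r₀ + l)} ≤ idealOfVars (Fin 2) k ^ ((i + 1) * (τ + Δ)) *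
          (Ideal.span {A} * idealOfVars (Fin 2) k ^ (τ + Δ) +
            Ideal.span {B} * idealOfVars (Fin 2) k ^ τ) ^ (r₀ + l) := by
        rw [pow_add, mul_assoc, pow_mul _ τ, ← Ideal.span_singleton_pow, ← mul_pow,
          mul_comm _ (Ideal.span {B})]
        exact Ideal.mul_mono_right (Ideal.pow_right_mono le_sup_right _)
      apply h1
      rw [pow_succ']
      refine Ideal.mul_mem_mul (hB.mem_pow_idealOfVars ?_) (Ideal.mem_span_singleton_self _)
      linarith
    refine ⟨i * (τ + Δ) + (r₀ + l + 1) * τ + b, ?_, ?_⟩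
    · rw [← hb, Finset.sum_range_succ, hra']
      ring
    · have h := hres.join_pow_idealOfVars (N₀ := N₀) (by omega) (hdA ▸ hA) (hdG ▸ hG) hA0
        hAB.pow_right hGJ
      rw [← pow_idealOfVars_mul_pow_succ] at h
      convert! h using 1
      · linarith
      · congr 1
        funext u
        refine Fin.cases ?_ (fun u => ?_) u
        · simp only [Fin.val_zero, add_zero, Fin.cons_zero, hra]
          omega
        · simp only [Fin.val_succ, Fin.cons_succ]
          rw [show i + ((u : ℕ) + 1) = i + 1 + u by ring]

/-- The minimal resolution of the powers of `A (x,y)^(τ+Δ) + B (x,y)^τ`, for relatively prime forms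
`A`, `B` of degrees `n + τ` and `n + τ + Δ`. -/
theorem exists_hasEquigeneratedResolution_pow (hA : A.IsHomogeneous (n + τ))
    (hB : B.IsHomogeneous (n + τ + Δ)) (hA0 : A ≠ 0) (hAB : IsRelPrime A B) (hn : 1 ≤ n)
    (s a : ℕ) (has : a ≤ s) (hlow : ∀ j, j < a → 2 + (s - 1) * τ + j * Δ ≤ n)
    (hhigh : ∀ j, a ≤ j → j < s → n ≤ 1 + (s - 1) * τ + j * Δ) :
    ∃ b : ℕ, (b : ℤ) = s * (n + 2 * τ + Δ + a * τ) + a.choose 2 * Δ - a * (n + τ) ∧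
      HasEquigeneratedResolution (Fin (b + a + 1))
        ((Ideal.span {A} * idealOfVars (Fin 2) k ^ (τ + Δ) +
            Ideal.span {B} * idealOfVars (Fin 2) k ^ τ) ^ s)
        (s * (n + 2 * τ + Δ))
        (Sum.elim (fun _ : Fin b => 1) fun u : Fin a => n - (u * Δ + (s - 1) * τ)) := by
  obtain ⟨r₀, rfl⟩ : ∃ r₀, s = r₀ + a := ⟨s - a, by omega⟩
  obtain ⟨b, hb, hres⟩ := exists_hasEquigeneratedResolution_pow_mul_pow hA hB hA0 hAB hn r₀ a
    hlow hhigh a 0 (zero_add a)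
  refine ⟨b, ?_, by simpa using hres⟩
  have hsum : ∀ m, ∑ v ∈ Finset.range a, (v * Δ + m) = a.choose 2 * Δ + a * m := by
    intro m
    clear * -
    induction a with
    | zero => simp
    | succ a ih =>
      rw [Finset.sum_range_succ, ih, Nat.choose_succ_succ' a 1, Nat.choose_one_right]
      ring
  rw [hsum, Finset.range_zero, Finset.sum_empty, add_zero] at hb
  rw [hb]
  push_cast
  ring

end PowersOfTwoBlockIdeal

theorem sum_hbMatrix_mul_hbDelta (k : Type*) [Field k] (m2 σ₁ : ℕ)
    (col : Fin (m2 + 2) → MvPolynomial (Fin 2) k) (j : Fin (m2 + 1)) :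
    ∑ i, hbMatrix k m2 σ₁ col i j * hbDelta k m2 σ₁ col i = 0 := by
  let M : Matrix (Fin (m2 + 2)) (Fin (m2 + 2)) (MvPolynomial (Fin 2) k) :=
    Matrix.of fun i => Fin.cons (hbMatrix k m2 σ₁ col i j) (hbMatrix k m2 σ₁ col i)
  have h0 : M.det = 0 :=
    Matrix.det_zero_of_column_eq (Fin.succ_ne_zero j).symm fun i => by simp [M]
  rw [Matrix.det_succ_column_zero] at h0
  rw [← h0]
  refine Finset.sum_congr rfl fun i _ => ?_
  have : M.submatrix i.succAbove Fin.succ =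
      (hbMatrix k m2 σ₁ col).submatrix i.succAbove id := by
    ext a b
    simp [M]
  rw [this, hbDelta]
  simp only [M, Matrix.of_apply, Fin.cons_zero]
  ring

theorem X_mul_hbDelta_of_lt (k : Type*) [Field k] {m2 σ₁ : ℕ} (hσ : σ₁ ≤ m2)
    (col : Fin (m2 + 2) → MvPolynomial (Fin 2) k) (j : ℕ) (hj : j < σ₁) :
    X 0 * hbDelta k m2 σ₁ col ⟨j, by omega⟩ = X 1 * hbDelta k m2 σ₁ col ⟨j + 1, by omega⟩ := by
  have h := sum_hbMatrix_mul_hbDelta k m2 σ₁ col ⟨j, by omega⟩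
  rw [Fintype.sum_eq_add (⟨j, by omega⟩ : Fin (m2 + 2)) ⟨j + 1, by omega⟩ (by simp)] at h
  · simp [hbMatrix, hj, show j ≠ m2 by omega] at h
    linear_combination h
  · rintro i ⟨h1, h2⟩
    rw [Ne, Fin.ext_iff] at h1 h2
    simp only [hbMatrix, Matrix.of_apply]
    simp [hj, show j ≠ m2 by omega, h1, h2]

theorem X_mul_hbDelta_of_le (k : Type*) [Field k] {m2 σ₁ : ℕ}
    (col : Fin (m2 + 2) → MvPolynomial (Fin 2) k) (j : ℕ) (hj : σ₁ ≤ j) (hj2 : j < m2) :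
    X 0 * hbDelta k m2 σ₁ col ⟨j + 1, by omega⟩ =
      X 1 * hbDelta k m2 σ₁ col ⟨j + 2, by omega⟩ := by
  have h := sum_hbMatrix_mul_hbDelta k m2 σ₁ col ⟨j, by omega⟩
  rw [Fintype.sum_eq_add (⟨j + 1, by omega⟩ : Fin (m2 + 2)) ⟨j + 2, by omega⟩ (by simp)] at h
  · simp [hbMatrix, hj.not_gt, show j ≠ m2 by omega] at h
    linear_combination h
  · rintro i ⟨h1, h2⟩
    rw [Ne, Fin.ext_iff] at h1 h2
    simp only [hbMatrix, Matrix.of_apply]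
    simp [hj.not_gt, show j ≠ m2 by omega, h1, h2]

theorem exists_eq_X_pow_mul_X_pow_mul {k : Type*} [Field k] (σ : ℕ)
    (f : ℕ → MvPolynomial (Fin 2) k) (hf : ∀ j < σ, X 0 * f j = X 1 * f (j + 1)) :
    ∃ A : MvPolynomial (Fin 2) k, ∀ j ≤ σ, f j = A * (X 0 ^ j * X 1 ^ (σ - j)) := by
  induction σ with
  | zero => exact ⟨f 0, fun j hj => by simp [Nat.le_zero.1 hj]⟩
  | succ σ ih =>
    obtain ⟨A, hA⟩ := ih fun j hj => hf j (by omega)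
    have h := hf σ (Nat.lt_succ_self σ)
    rw [hA σ le_rfl] at h
    have hp : Prime (X 1 : MvPolynomial (Fin 2) k) := X_prime
    obtain ⟨C, rfl⟩ : X 1 ∣ A := by
      have hd : X 1 ∣ A * X 0 ^ (σ + 1) := ⟨f (σ + 1), by rw [← h]; simp; ring⟩
      refine (hp.dvd_or_dvd hd).resolve_right fun h => ?_
      have := hp.dvd_of_dvd_pow h
      simp at this
    refine ⟨C, fun j hj => ?_⟩
    rcases Nat.lt_or_eq_of_le hj with hj | rfl
    · rw [hA j (by omega), show σ + 1 - j = σ - j + 1 by omega]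
      ring
    · apply mul_left_cancel₀ hp.ne_zero
      rw [← h]
      simp
      ring

theorem isHomogeneous_hbDelta {k : Type*} [Field k] {m2 σ₁ n : ℕ}
    {col : Fin (m2 + 2) → MvPolynomial (Fin 2) k} (hcol : ∀ i, (col i).IsHomogeneous n)
    (i : Fin (m2 + 2)) : (hbDelta k m2 σ₁ col i).IsHomogeneous (n + m2) := by
  have hentry (i : Fin (m2 + 2)) (j : Fin (m2 + 1)) :
      (hbMatrix k m2 σ₁ col i j).IsHomogeneous (if (j : ℕ) = m2 then n else 1) := by
    simp only [hbMatrix, Matrix.of_apply]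
    split_ifs <;>
      first
      | exact hcol i
      | exact isHomogeneous_X _ _
      | exact (isHomogeneous_X _ _).neg
      | exact isHomogeneous_zero _ _ _
  have hsum : ∑ j : Fin (m2 + 1), (if (j : ℕ) = m2 then n else 1) = n + m2 := by
    rw [Fin.sum_univ_castSucc]
    simp [fun x : Fin m2 => x.isLt.ne, add_comm]
  have hdet : ((hbMatrix k m2 σ₁ col).submatrix i.succAbove id).det.IsHomogeneous (n + m2) := by
    rw [Matrix.det_apply]
    refine IsHomogeneous.sum _ _ _ fun π _ => ?_
    have h := hsum ▸ IsHomogeneous.prod Finset.univ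
      (fun j => (hbMatrix k m2 σ₁ col).submatrix i.succAbove id (π j) j) _
      fun j _ => hentry (i.succAbove (π j)) j
    rcases Int.units_eq_one_or (Equiv.Perm.sign π) with hπ | hπ
    · simpa [hπ] using h
    · simpa [hπ] using h.neg
  rw [hbDelta]
  rcases neg_one_pow_eq_or (MvPolynomial (Fin 2) k) (i : ℕ) with hi | hi
  · simpa [hi] using hdet
  · simpa [hi] using hdet.neg

theorem MvPolynomial.IsHomogeneous.of_mul_monomial {k σ : Type*} [Field k]
    {A : MvPolynomial σ k} {m : σ →₀ ℕ} {e : ℕ}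
    (h : (A * monomial m 1).IsHomogeneous (e + m.degree)) : A.IsHomogeneous e := by
  intro d hd
  change Finsupp.weight 1 d = e
  rw [show Finsupp.weight (1 : σ → ℕ) d = d.degree from
    (congrFun (congrArg DFunLike.coe Finsupp.degree_eq_weight_one) d).symm]
  by_contra hne
  refine hd ?_
  have h0 := h.coeff_eq_zero (d := d + m) (by simpa using hne)
  rwa [coeff_mul_monomial, mul_one] at h0

theorem not_isUnit_of_isHomogeneous {k σ : Type*} [Field k] {A : MvPolynomial σ k} {e : ℕ}
    (hA : A.IsHomogeneous e) (he : 1 ≤ e) : ¬ IsUnit A := by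
  intro h
  have h1 := (h.map (constantCoeff (R := k) (σ := σ))).ne_zero
  exact h1 (hA.coeff_eq_zero (by simp; omega))

theorem not_le_span_singleton_of_idealHeight {R : Type*} [CommRing R] [IsNoetherianRing R]
    {I : Ideal R} (hI : idealHeight I = 2) {f : R} (hf : Prime f) : ¬ I ≤ Ideal.span {f} := by
  intro hle
  have hprime : (Ideal.span {f}).IsPrime := (Ideal.span_singleton_prime hf.ne_zero).2 hf
  have h2 : idealHeight I ≤ Order.height (⟨Ideal.span {f}, hprime⟩ : PrimeSpectrum R) :=
    iInf₂_le (f := fun (p : PrimeSpectrum R) (_ : I ≤ p.asIdeal) => Order.height p)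
      ⟨Ideal.span {f}, hprime⟩ hle
  rw [hI, ← PrimeSpectrum.height_eq_orderHeight] at h2
  have h1 : (Ideal.span {f}).height ≤ 1 :=
    Ideal.height_le_one_of_isPrincipal_of_mem_minimalPrimes (Ideal.span {f}) _
      (by rw [Ideal.minimalPrimes_eq_subsingleton_self]; exact rfl)
  exact absurd (h2.trans h1) (by decide)

/-- The ideal `I` is `A (x,y)^σ₁ + B (x,y)^τ` for relatively prime forms `A`, `B`. -/
theorem exists_hbIdeal_eq {k : Type*} [Field k] {m2 σ₁ τ n : ℕ} (hσ : σ₁ + τ = m2) (hn : 1 ≤ n)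
    {col : Fin (m2 + 2) → MvPolynomial (Fin 2) k} (hcol : ∀ i, (col i).IsHomogeneous n)
    (hht : idealHeight (hbIdeal k m2 σ₁ col) = 2) :
    ∃ A B : MvPolynomial (Fin 2) k, A.IsHomogeneous (n + τ) ∧ B.IsHomogeneous (n + σ₁) ∧
      A ≠ 0 ∧ IsRelPrime A B ∧
      hbIdeal k m2 σ₁ col = Ideal.span {A} * idealOfVars (Fin 2) k ^ σ₁ +
        Ideal.span {B} * idealOfVars (Fin 2) k ^ τ := by
  obtain ⟨A, hA⟩ := exists_eq_X_pow_mul_X_pow_mul σ₁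
    (fun j => if h : j < m2 + 2 then hbDelta k m2 σ₁ col ⟨j, h⟩ else 0) fun j hj => by
      simpa [show j < m2 + 2 by omega, show j + 1 < m2 + 2 by omega] using
        X_mul_hbDelta_of_lt k (by omega) col j hj
  obtain ⟨B, hB⟩ := exists_eq_X_pow_mul_X_pow_mul τ
    (fun j => if h : σ₁ + j + 1 < m2 + 2 then hbDelta k m2 σ₁ col ⟨σ₁ + j + 1, h⟩ else 0)
    fun j hj => by
      rw [dif_pos (by omega), dif_pos (by omega)]
      exact X_mul_hbDelta_of_le k col (σ₁ + j) (by omega) (by omega)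
  have hlt {j : ℕ} (hj : j ≤ σ₁) : j < m2 + 2 := by omega
  have hlt' {j : ℕ} (hj : j ≤ τ) : σ₁ + j + 1 < m2 + 2 := by omega
  replace hA (j : ℕ) (hj : j ≤ σ₁) :
      hbDelta k m2 σ₁ col ⟨j, hlt hj⟩ = A * (X 0 ^ j * X 1 ^ (σ₁ - j)) := by
    simpa [show j < m2 + 2 by omega] using hA j hj
  replace hB (j : ℕ) (hj : j ≤ τ) :
      hbDelta k m2 σ₁ col ⟨σ₁ + j + 1, hlt' hj⟩ = B * (X 0 ^ j * X 1 ^ (τ - j)) := by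
    simpa [show σ₁ + j + 1 < m2 + 2 by omega] using hB j hj
  have hAhom : A.IsHomogeneous (n + τ) := by
    have h := isHomogeneous_hbDelta hcol (σ₁ := σ₁) ⟨0, hlt (Nat.zero_le _)⟩
    rw [hA 0 (Nat.zero_le _), pow_zero, one_mul, Nat.sub_zero, X_pow_eq_monomial] at h
    refine IsHomogeneous.of_mul_monomial (m := Finsupp.single 1 σ₁) ?_
    rwa [Finsupp.degree_single, show n + τ + σ₁ = n + m2 by omega]
  have hBhom : B.IsHomogeneous (n + σ₁) := by
    have h := isHomogeneous_hbDelta hcol (σ₁ := σ₁) ⟨σ₁ + 0 + 1, hlt' (Nat.zero_le _)⟩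
    rw [hB 0 (Nat.zero_le _), pow_zero, one_mul, Nat.sub_zero, X_pow_eq_monomial] at h
    refine IsHomogeneous.of_mul_monomial (m := Finsupp.single 1 τ) ?_
    rwa [Finsupp.degree_single, show n + σ₁ + τ = n + m2 by omega]
  have hcases (i : Fin (m2 + 2)) : (∃ j, ∃ h : j ≤ σ₁, i = ⟨j, hlt h⟩) ∨
      ∃ j, ∃ h : j ≤ τ, i = ⟨σ₁ + j + 1, hlt' h⟩ := by
    rcases le_or_gt (i : ℕ) σ₁ with h | h
    · exact Or.inl ⟨i, h, rfl⟩
    · have hi : (i : ℕ) - σ₁ - 1 ≤ τ := by have := i.isLt; omega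
      refine Or.inr ⟨i - σ₁ - 1, hi, Fin.ext ?_⟩
      change (i : ℕ) = σ₁ + (i - σ₁ - 1) + 1
      omega
  have hnodvd (f : MvPolynomial (Fin 2) k) (hf : Prime f) (hfA : f ∣ A) (hfB : f ∣ B) : False := by
    refine not_le_span_singleton_of_idealHeight hht hf ?_
    rw [hbIdeal, Ideal.span_le]
    rintro _ ⟨i, rfl⟩
    rw [SetLike.mem_coe, Ideal.mem_span_singleton]
    rcases hcases i with ⟨j, hj, rfl⟩ | ⟨j, hj, rfl⟩
    · exact hA j hj ▸ hfA.mul_right _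
    · exact hB j hj ▸ hfB.mul_right _
  have hrel : IsRelPrime A B := by
    refine WfDvdMonoid.isRelPrime_of_no_irreducible_factors ?_ fun f hf hfA hfB =>
      hnodvd f hf.prime hfA hfB
    rintro ⟨rfl, rfl⟩
    exact hnodvd (X 0) X_prime (dvd_zero _) (dvd_zero _)
  have hA0 : A ≠ 0 := by
    rintro rfl
    exact not_isUnit_of_isHomogeneous hBhom (by omega) (isRelPrime_zero_left.1 hrel)
  refine ⟨A, B, hAhom, hBhom, hA0, hrel, le_antisymm ?_ (sup_le ?_ ?_)⟩
  · rw [hbIdeal, Ideal.span_le]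
    rintro _ ⟨i, rfl⟩
    rcases hcases i with ⟨j, hj, rfl⟩ | ⟨j, hj, rfl⟩
    · rw [hA j hj]
      refine Ideal.mem_sup_left (Ideal.mul_mem_mul (Ideal.mem_span_singleton_self _) ?_)
      rw [pow_idealOfVars_fin_two_eq_span]
      exact Ideal.subset_span ⟨j, σ₁ - j, by omega, rfl⟩
    · rw [hB j hj]
      refine Ideal.mem_sup_right (Ideal.mul_mem_mul (Ideal.mem_span_singleton_self _) ?_)
      rw [pow_idealOfVars_fin_two_eq_span]
      exact Ideal.subset_span ⟨j, τ - j, by omega, rfl⟩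
  · rw [pow_idealOfVars_fin_two_eq_span, Ideal.span_mul_span', Ideal.span_le]
    rintro _ ⟨_, rfl, _, ⟨i, j, hij, rfl⟩, rfl⟩
    obtain rfl : j = σ₁ - i := by omega
    simp only [SetLike.mem_coe, ← hA i (by omega)]
    exact Ideal.subset_span ⟨_, rfl⟩
  · rw [pow_idealOfVars_fin_two_eq_span, Ideal.span_mul_span', Ideal.span_le]
    rintro _ ⟨_, rfl, _, ⟨i, j, hij, rfl⟩, rfl⟩
    obtain rfl : j = τ - i := by omega
    simp only [SetLike.mem_coe, ← hB i (by omega)]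
    exact Ideal.subset_span ⟨_, rfl⟩

theorem exists_nat_eq_min_ceil_div {n t Δ : ℕ} (s : ℕ) (hΔ : 0 < Δ) (ht : t + 1 ≤ n) :
    ∃ a : ℕ, (a : ℤ) = min (s : ℤ) ⌈((n : ℚ) - t - 1) / Δ⌉ ∧ a ≤ s ∧
      (∀ j, j < a → 2 + t + j * Δ ≤ n) ∧ ∀ j, a ≤ j → j < s → n ≤ 1 + t + j * Δ := by
  have hΔ' : (0 : ℚ) < Δ := by exact_mod_cast hΔ
  have ht' : (t : ℚ) + 1 ≤ n := by exact_mod_cast ht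
  have hceil : (0 : ℤ) ≤ ⌈((n : ℚ) - t - 1) / Δ⌉ :=
    Int.ceil_nonneg (div_nonneg (by linarith) hΔ'.le)
  have hlt (j : ℕ) : (j : ℤ) < ⌈((n : ℚ) - t - 1) / Δ⌉ ↔ 2 + t + j * Δ ≤ n := by
    rw [Int.lt_ceil, lt_div_iff₀ hΔ', Int.cast_natCast, lt_sub_iff_add_lt, lt_sub_iff_add_lt]
    norm_cast
    omega
  obtain ⟨a, ha⟩ := Int.eq_ofNat_of_zero_le (le_min (Int.natCast_nonneg s) hceil)
  refine ⟨a, ha.symm, by omega, fun j hj => (hlt j).1 (by omega), fun j hj hjs => ?_⟩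
  have := (hlt j).not.1 (by omega)
  omega

theorem exists_hasMinimalGradedResolution_hbIdeal_pow {k : Type*} [Field k] {m2 σ₁ n τ Δ : ℕ}
    (hσ : σ₁ + τ = m2) (hΔ : τ + Δ = σ₁) (hn : 1 ≤ n)
    {col : Fin (m2 + 2) → MvPolynomial (Fin 2) k} (hcol : ∀ i, (col i).IsHomogeneous n)
    (hht : idealHeight (hbIdeal k m2 σ₁ col) = 2) (s a : ℕ) (has : a ≤ s)
    (hlow : ∀ j, j < a → 2 + (s - 1) * τ + j * Δ ≤ n)
    (hhigh : ∀ j, a ≤ j → j < s → n ≤ 1 + (s - 1) * τ + j * Δ) :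
    ∃ b : ℕ,
      (b : ℤ) = s * ((n + m2 : ℕ) + a * τ) + a.choose 2 * Δ - a * (n + τ) ∧
      HasMinimalGradedResolution (hbIdeal k m2 σ₁ col ^ s)
        (fun _ : Fin (b + a + 1) => s * (n + m2))
        (fun j : Fin (b + a) =>
          if (j : ℕ) < b then s * (n + m2) + 1
          else s * (n + m2) + (n - (((j : ℕ) - b) * Δ + (s - 1) * τ))) := by
  obtain ⟨A, B, hA, hB, hA0, hAB, hI⟩ := exists_hbIdeal_eq hσ hn hcol hht
  subst hΔ
  obtain ⟨b, hb, hres⟩ := exists_hasEquigeneratedResolution_pow hA (by rwa [add_assoc]) hA0 hAB hn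
    s a has hlow hhigh
  rw [show n + 2 * τ + Δ = n + m2 by omega, ← hI] at hres
  refine ⟨b, ?_, (hres.reindex (Equiv.refl _) finSumFinEquiv.symm).hasMinimalGradedResolution
    fun j => ?_⟩
  · rw [hb, ← hσ]
    push_cast
    ring
  · refine Fin.addCases (fun i => ?_) (fun i => ?_) j
    · simp
    · simp

/-!
STATEMENT 17 (Theorem pwrs4).  With the almost linearly presented setup above and
`d = n + m − 2`, for every `s ≥ 1` the minimal homogeneous free resolution of `I^s`
has the form `0 → R(−sd−1)^b ⊕ 𝔽 → R(−sd)^{b₀} → I^s → 0` with `b₀ = b + a + 1`,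
where `a`, `b` and the twists of `𝔽` are as in cases (1), (2), (3) of the theorem.
(The syzygy twists are indexed by `Fin (b+a)`: the first `b` equal `sd+1`, the rest
are the twists of `𝔽`.)
-/

theorem minimal_resolution_of_powers
    {k : Type*} [Field k] (m2 σ₁ σ₂ ρ n : ℕ)
    (hdata : ScrollData m2 σ₁ σ₂ ρ n)
    (col : Fin (m2 + 2) → MvPolynomial (Fin 2) k)
    (hI : ScrollIdealData k m2 σ₁ n col)
    (d : ℕ) (hd : d = n + m2)
    (s : ℕ) (hs : 1 ≤ s) :
    -- (1) ρ = 1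
    (ρ = 1 → ∃ a b : ℕ,
      (a : ℤ) = min (s : ℤ) ⌈((n : ℚ) - 1) / (σ₁ : ℚ)⌉ ∧
      (b : ℤ) = (s : ℤ) * d + (a.choose 2 : ℤ) * σ₁ - (a : ℤ) * n ∧
      HasMinimalGradedResolution ((hbIdeal k m2 σ₁ col) ^ s)
        (fun _ : Fin (b + a + 1) => s * d)
        (fun j : Fin (b + a) =>
          if (j : ℕ) < b then s * d + 1 else s * d + (n - ((j : ℕ) - b) * σ₁))) ∧
    -- (2) ρ = 2 and σ₁ > σ₂
    (ρ = 2 → σ₂ < σ₁ → ∃ a b : ℕ,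
      ((s : ℚ) ≤ ((n : ℚ) - 2) / (σ₂ : ℚ) + 1 →
        (a : ℤ) = min (s : ℤ)
          ⌈((n : ℚ) - ((s : ℚ) - 1) * (σ₂ : ℚ) - 1) / ((σ₁ : ℚ) - (σ₂ : ℚ))⌉) ∧
      (((n : ℚ) - 1) / (σ₂ : ℚ) + 1 ≤ (s : ℚ) → a = 0) ∧
      (b : ℤ) = (s : ℤ) * ((d : ℤ) + (a : ℤ) * σ₂) + (a.choose 2 : ℤ) * ((σ₁ : ℤ) - σ₂)
        - (a : ℤ) * ((n : ℤ) + σ₂) ∧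
      HasMinimalGradedResolution ((hbIdeal k m2 σ₁ col) ^ s)
        (fun _ : Fin (b + a + 1) => s * d)
        (fun j : Fin (b + a) =>
          if (j : ℕ) < b then s * d + 1
          else s * d + (n - (((j : ℕ) - b) * (σ₁ - σ₂) + (s - 1) * σ₂)))) ∧
    -- (3) ρ = 2 and σ₁ = σ₂
    (ρ = 2 → σ₁ = σ₂ → ∃ a b : ℕ,
      ((s : ℚ) ≤ ((n : ℚ) - 2) / (σ₂ : ℚ) + 1 → a = s) ∧
      (((n : ℚ) - 1) / (σ₂ : ℚ) + 1 ≤ (s : ℚ) → a = 0) ∧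
      (b : ℤ) = (s : ℤ) * ((d : ℤ) + (a : ℤ) * σ₂) - (a : ℤ) * ((n : ℤ) + σ₂) ∧
      HasMinimalGradedResolution ((hbIdeal k m2 σ₁ col) ^ s)
        (fun _ : Fin (b + a + 1) => s * d)
        (fun j : Fin (b + a) =>
          if (j : ℕ) < b then s * d + 1 else s * d + (n - (s - 1) * σ₂))) := by
  obtain ⟨hσ₁, hn, hρ⟩ := hdata
  obtain ⟨hcol, hht, -⟩ := hI
  subst hd
  refine ⟨fun h1 => ?_, fun h2 hlt => ?_, fun h2 heq => ?_⟩
  · have hσ : σ₁ + 0 = m2 := by omega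
    obtain ⟨a, ha, has, hlow, hhigh⟩ :=
      exists_nat_eq_min_ceil_div (n := n) (t := 0) s hσ₁ (by omega)
    obtain ⟨b, hb, hres⟩ := exists_hasMinimalGradedResolution_hbIdeal_pow hσ
      (zero_add σ₁) (by omega) hcol hht s a has (by simpa using hlow) (by simpa using hhigh)
    exact ⟨a, b, by simpa using ha, by simpa using hb, by simpa using hres⟩
  all_goals
    have hσ₂ : 1 ≤ σ₂ := by omega
    have hσ : σ₁ + σ₂ = m2 := by omega
    have hσ₂' : (0 : ℚ) < σ₂ := by exact_mod_cast hσ₂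
    have hs' : ((s - 1 : ℕ) : ℚ) = s - 1 := by simp [hs]
    have hle : (s : ℚ) ≤ ((n : ℚ) - 2) / σ₂ + 1 ↔ 2 + (s - 1) * σ₂ ≤ n := by
      rw [← sub_le_iff_le_add, le_div_iff₀ hσ₂', ← hs', le_sub_iff_add_le, add_comm]
      norm_cast
    have hge : ((n : ℚ) - 1) / σ₂ + 1 ≤ s ↔ n ≤ 1 + (s - 1) * σ₂ := by
      rw [← le_sub_iff_add_le, div_le_iff₀ hσ₂', ← hs', sub_le_iff_le_add, add_comm]
      norm_cast
    rw [hle, hge]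
  · by_cases hsn : 2 + (s - 1) * σ₂ ≤ n
    · obtain ⟨a, ha, has, hlow, hhigh⟩ :=
        exists_nat_eq_min_ceil_div (n := n) (t := (s - 1) * σ₂) s (Nat.sub_pos_of_lt hlt) (by omega)
      obtain ⟨b, hb, hres⟩ := exists_hasMinimalGradedResolution_hbIdeal_pow hσ
        (Nat.add_sub_of_le hlt.le) (by omega) hcol hht s a has hlow hhigh
      rw [Nat.cast_sub hlt.le] at ha hb
      rw [Nat.cast_mul, hs'] at ha
      exact ⟨a, b, fun _ => ha, fun h => by omega, hb, hres⟩
    · obtain ⟨b, hb, hres⟩ := exists_hasMinimalGradedResolution_hbIdeal_pow hσ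
        (Nat.add_sub_of_le hlt.le) (by omega) hcol hht s 0 (Nat.zero_le s) (by simp)
        fun j _ _ => by omega
      rw [Nat.cast_sub hlt.le] at hb
      exact ⟨0, b, fun h => absurd h hsn, fun _ => rfl, hb, hres⟩
  · subst heq
    by_cases hsn : 2 + (s - 1) * σ₁ ≤ n
    · obtain ⟨b, hb, hres⟩ := exists_hasMinimalGradedResolution_hbIdeal_pow hσ
        (add_zero σ₁) (by omega) hcol hht s s le_rfl (by simpa using fun _ _ => hsn)
        fun j _ _ => by omega
      exact ⟨s, b, fun _ => rfl, fun h => by omega, by simpa using hb, by simpa using hres⟩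
    · obtain ⟨b, hb, hres⟩ := exists_hasMinimalGradedResolution_hbIdeal_pow hσ
        (add_zero σ₁) (by omega) hcol hht s 0 (Nat.zero_le s) (by simp)
        fun j _ _ => by omega
      exact ⟨0, b, fun h => absurd h hsn, fun _ => rfl, by simpa using hb, by simpa using hres⟩
end

section
/- Let M be a homogeneous module of projective dimension one over a standard graded polynomial ring R, with all generators of M in degree D. Suppose b₀, b₁ and t₁ ≤ t₂ ≤ ⋯ ≤ t_{b₁} are integers with D < t₁ such that λ(M_z) = b₀·λ(R(−D)_z) − Σ_{i=1}^{b₁} λ(R(−t_i)_z) for all integers z. Then the minimal homogeneous free resolution of M has the form 0 → ⊕_{i=1}^{b₁} R(−t_i) → R(−D)^{b₀} → M → 0. -/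
open MvPolynomial

/-- The degree-`s` homogeneous component (`s ∈ ℤ`) of `k[x_i : i ∈ ι]`. -/
noncomputable def homogZ (ι : Type*) (k : Type*) [CommSemiring k] (s : ℤ) :
    Submodule k (MvPolynomial ι k) :=
  if 0 ≤ s then homogeneousSubmodule ι k s.toNat else ⊥

namespace MvPolynomial

section VecComponent

variable {σ ι k : Type*} [Field k]

/-- The degree-`s` homogeneous component of a vector of polynomials, taken coordinatewise. -/
noncomputable def vecComponent (ι : Type*) (s : ℕ) :
    (ι → MvPolynomial σ k) →ₗ[k] (ι → MvPolynomial σ k) :=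
  LinearMap.pi fun j => homogeneousComponent s ∘ₗ LinearMap.proj j

@[simp]
lemma vecComponent_apply (s : ℕ) (v : ι → MvPolynomial σ k) (j : ι) :
    vecComponent ι s v j = homogeneousComponent s (v j) := rfl

lemma vecComponent_isHomogeneous (s : ℕ) (v : ι → MvPolynomial σ k) (j : ι) :
    (vecComponent ι s v j).IsHomogeneous s :=
  homogeneousComponent_isHomogeneous s (v j)

lemma vecComponent_of_isHomogeneous {e : ℕ} {v : ι → MvPolynomial σ k}
    (hv : ∀ j, (v j).IsHomogeneous e) (d : ℕ) :
    vecComponent ι d v = if d = e then v else 0 := by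
  ext1 j
  rw [vecComponent_apply, homogeneousComponent_of_mem (hv j)]
  split_ifs <;> rfl

lemma exists_sum_vecComponent_eq [Finite ι] (v : ι → MvPolynomial σ k) :
    ∃ n, ∑ s ∈ Finset.range n, vecComponent ι s v = v := by
  cases nonempty_fintype ι
  refine ⟨(Finset.univ.sup fun j => (v j).totalDegree) + 1, ?_⟩
  ext1 j
  rw [Finset.sum_apply]
  simp only [vecComponent_apply]
  conv_rhs => rw [← sum_homogeneousComponent (v j)]
  symm
  apply Finset.sum_subset
  · intro s
    have := Finset.le_sup (f := fun j => (v j).totalDegree) (Finset.mem_univ j)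
    simp only [Finset.mem_range] at *
    omega
  · intro s _ hs
    apply homogeneousComponent_eq_zero
    simpa using hs

lemma homogeneousComponent_mul (d : ℕ) (a b : MvPolynomial σ k) :
    homogeneousComponent d (a * b) =
      ∑ x ∈ Finset.HasAntidiagonal.antidiagonal d, homogeneousComponent x.1 a * homogeneousComponent x.2 b := by
  classical
  refine MvPolynomial.ext _ _ fun m => ?_
  rw [coeff_homogeneousComponent, coeff_sum]
  simp only [coeff_mul, coeff_homogeneousComponent]
  rw [Finset.sum_comm]
  by_cases hm : m.degree = d
  · rw [if_pos hm]
    refine Finset.sum_congr rfl fun y hy => ?_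
    rw [Finset.HasAntidiagonal.mem_antidiagonal] at hy
    rw [Finset.sum_eq_single (y.1.degree, y.2.degree)]
    · simp
    · rintro ⟨i, j⟩ _ hij
      by_cases h1 : y.1.degree = i
      · by_cases h2 : y.2.degree = j
        · simp [h1, h2] at hij
        · simp [h2]
      · simp [h1]
    · intro h
      rw [Finset.HasAntidiagonal.mem_antidiagonal] at h
      exact absurd (by rw [← hm, ← hy, map_add]) h
  · rw [if_neg hm, Finset.sum_eq_zero]
    intro y hy
    refine Finset.sum_eq_zero fun x hx => ?_
    rw [Finset.HasAntidiagonal.mem_antidiagonal] at hy hx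
    by_cases h1 : y.1.degree = x.1
    · by_cases h2 : y.2.degree = x.2
      · exact absurd (by rw [← hx, ← h1, ← h2, ← hy, map_add]) hm
      · simp [h2]
    · simp [h1]

lemma vecComponent_smul (d : ℕ) (c : MvPolynomial σ k) (v : ι → MvPolynomial σ k) :
    vecComponent ι d (c • v) =
      ∑ x ∈ Finset.HasAntidiagonal.antidiagonal d, homogeneousComponent x.1 c • vecComponent ι x.2 v := by
  ext1 j
  simp [homogeneousComponent_mul]

lemma vecComponent_smul_of_isHomogeneous {e : ℕ} {v : ι → MvPolynomial σ k}
    (hv : ∀ j, (v j).IsHomogeneous e) (d : ℕ) (c : MvPolynomial σ k) :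
    vecComponent ι d (c • v) = (if e ≤ d then homogeneousComponent (d - e) c else 0) • v := by
  rw [vecComponent_smul]
  simp only [vecComponent_of_isHomogeneous hv]
  split_ifs with h
  · rw [Finset.sum_eq_single (d - e, e)]
    · simp
    · rintro ⟨i, j⟩ hx hne
      rw [Finset.HasAntidiagonal.mem_antidiagonal] at hx
      have : j ≠ e := by
        rintro rfl
        apply hne
        simp only [Prod.mk.injEq, and_true] at hx ⊢
        omega
      simp [this]
    · intro hx
      rw [Finset.HasAntidiagonal.mem_antidiagonal] at hx
      exact absurd (by simp only []; omega) hx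
  · rw [zero_smul]
    refine Finset.sum_eq_zero fun x hx => ?_
    rw [Finset.HasAntidiagonal.mem_antidiagonal] at hx
    rw [if_neg (by omega), smul_zero]

/-- A graded free submodule of finite rank in `R^ι` has a basis of homogeneous vectors. -/
theorem exists_isHomogeneous_basis [Finite ι]
    (S : Submodule (MvPolynomial σ k) (ι → MvPolynomial σ k))
    (hS : ∀ v ∈ S, ∀ s, vecComponent ι s v ∈ S) {q : ℕ}
    (b : Module.Basis (Fin q) (MvPolynomial σ k) S) :
    ∃ (e : Fin q → ℕ) (f : Fin q → ι → MvPolynomial σ k),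
      (∀ i j, (f i j).IsHomogeneous (e i)) ∧ LinearIndependent (MvPolynomial σ k) f ∧
        Submodule.span (MvPolynomial σ k) (Set.range f) = S := by
  let ε : S →ₗ[k] (Fin q → k) :=
    LinearMap.pi fun i => lcoeff k 0 ∘ₗ (b.coord i).restrictScalars k
  have hε (x : S) (i : Fin q) : ε x i = coeff 0 (b.repr x i) := rfl
  let H := {x : ℕ × S // ∀ j, (x.2.1 j).IsHomogeneous x.1}
  have hspan : Submodule.span k (Set.range fun x : H => ε x.1.2) = ⊤ := by
    have hmem (x : S) : ε x ∈ Submodule.span k (Set.range fun x : H => ε x.1.2) := by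
      obtain ⟨n, hn⟩ := exists_sum_vecComponent_eq x.1
      have hx : x = ∑ s ∈ Finset.range n, (⟨vecComponent ι s x.1, hS _ x.2 s⟩ : S) := by
        ext1
        simp [hn]
      rw [hx, map_sum]
      exact Submodule.sum_mem _ fun s _ => Submodule.subset_span
        ⟨⟨(s, ⟨vecComponent ι s x.1, hS _ x.2 s⟩), vecComponent_isHomogeneous s x.1⟩, rfl⟩
    rw [eq_top_iff]
    intro w _
    have hw : ε (∑ i, w i • b i) = w := by
      classical
      ext i
      rw [hε]
      have : ∑ i, w i • b i = ∑ i, (C (w i) : MvPolynomial σ k) • b i := by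
        refine Finset.sum_congr rfl fun i _ => ?_
        rw [← algebraMap_eq, algebraMap_smul]
      rw [this, b.repr_sum_self]
      simp
    rw [← hw]
    exact hmem _
  obtain ⟨κ, a, -, hκ, hli⟩ := exists_linearIndependent' k fun x : H => ε x.1.2
  rw [hspan] at hκ
  let B := Module.Basis.mk hli hκ.ge
  let u : Fin q ≃ κ := (Pi.basisFun k (Fin q)).indexEquiv B
  let f : Fin q → S := fun i => (a (u i)).1.2
  let e : Fin q → ℕ := fun i => (a (u i)).1.1
  have hf (i : Fin q) (j : ι) : ((f i).1 j).IsHomogeneous (e i) := (a (u i)).2 j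
  let B' := B.reindex u.symm
  have hB' (i : Fin q) : B' i = ε (f i) := by
    simp [B', B, f]
  let T := Submodule.span (MvPolynomial σ k) (Set.range fun i => (f i).1)
  have hT (d : ℕ) : ∀ x : S, vecComponent ι d x.1 ∈ T := by
    induction d using Nat.strong_induction_on with
    | _ d ih =>
    intro x
    let y : S := x - ∑ i, B'.repr (ε x) i • f i
    have hy : ε y = 0 := by
      have := B'.sum_repr (ε x)
      simp only [hB'] at this
      simp only [y, map_sub, map_sum, map_smul, this, sub_self]
    have hx : x.1 = y.1 + ∑ i, B'.repr (ε x) i • (f i).1 := by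
      simp [y]
    rw [hx, map_add, map_sum]
    refine T.add_mem ?_ (T.sum_mem fun i _ => ?_)
    · have hyb : y.1 = ∑ i, b.repr y i • (b i).1 := by
        have := congrArg S.subtype (b.sum_repr y)
        rw [map_sum] at this
        exact this.symm
      rw [hyb, map_sum]
      refine T.sum_mem fun i _ => ?_
      rw [vecComponent_smul]
      refine T.sum_mem fun z hz => ?_
      rw [Finset.HasAntidiagonal.mem_antidiagonal] at hz
      rcases Nat.eq_zero_or_pos z.1 with h0 | h0
      · have : coeff 0 (b.repr y i) = 0 := by rw [← hε, hy]; rfl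
        rw [h0, homogeneousComponent_zero, this, C_0, zero_smul]
        exact T.zero_mem
      · exact T.smul_mem _ (ih z.2 (by omega) (b i))
    · rw [map_smul, vecComponent_of_isHomogeneous (hf i)]
      apply Submodule.smul_of_tower_mem
      split_ifs
      · exact Submodule.subset_span ⟨i, rfl⟩
      · exact T.zero_mem
  have hTS : T = S := by
    apply le_antisymm
    · rw [Submodule.span_le]
      rintro _ ⟨i, rfl⟩
      exact (f i).2
    · intro v hv
      obtain ⟨n, hn⟩ := exists_sum_vecComponent_eq v
      rw [← hn]
      exact T.sum_mem fun s _ => hT s ⟨v, hv⟩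
  refine ⟨e, fun i => (f i).1, hf, ?_, hTS⟩
  rw [linearIndependent_iff_card_eq_finrank_span]
  exact (Module.finrank_eq_card_basis b).symm.trans
    (congrArg (fun W : Submodule _ _ => Module.finrank (MvPolynomial σ k) W) hTS.symm)

end VecComponent

end MvPolynomial

lemma Finset.sum_comp_sub_eq_sum_range {α : Type*} [Fintype α] (h : ℤ → ℕ)
    (hneg : ∀ z < 0, h z = 0) (t : α → ℕ) (z : ℕ) :
    ∑ i, h ((z : ℤ) - t i) =
      ∑ w ∈ Finset.range (z + 1), Fintype.card {i // t i = w} * h ((z : ℤ) - w) := by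
  have hsub : ∑ i with t i ∈ Finset.range (z + 1), h ((z : ℤ) - t i) =
      ∑ i, h ((z : ℤ) - t i) := by
    apply Finset.sum_subset (Finset.subset_univ _)
    intro i _ hi
    simp only [Finset.mem_range, Finset.mem_filter, Finset.mem_univ, true_and] at hi
    exact hneg _ (by omega)
  rw [← hsub, ← Finset.sum_fiberwise_of_maps_to (t := Finset.range (z + 1)) (g := t)
    fun i hi => (Finset.mem_filter.mp hi).2]
  refine Finset.sum_congr rfl fun w hw => ?_
  rw [Finset.sum_congr rfl (g := fun _ => h ((z : ℤ) - w)), Finset.sum_const, smul_eq_mul,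
    Fintype.card_subtype]
  · congr 2
    ext i
    simp only [Finset.mem_filter, Finset.mem_univ, true_and, and_iff_right_iff_imp]
    rintro rfl
    exact hw
  · intro i hi
    rw [(Finset.mem_filter.mp hi).2]

/-- Two finite families of shifts of a function supported on the nonnegative integers, with value
`1` at `0`, that have the same sum agree up to a permutation. -/
lemma exists_equiv_of_sum_comp_sub_eq {α β : Type*} [Fintype α] [Fintype β] (h : ℤ → ℕ)
    (hneg : ∀ z < 0, h z = 0) (h0 : h 0 = 1) (t : α → ℕ) (e : β → ℕ)
    (hsum : ∀ z : ℕ, ∑ i, h ((z : ℤ) - t i) = ∑ j, h ((z : ℤ) - e j)) :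
    ∃ u : α ≃ β, ∀ i, e (u i) = t i := by
  have hcard (z : ℕ) : Fintype.card {i // t i = z} = Fintype.card {j // e j = z} := by
    induction z using Nat.strong_induction_on with
    | _ z ih =>
    have hz := hsum z
    rw [Finset.sum_comp_sub_eq_sum_range h hneg, Finset.sum_comp_sub_eq_sum_range h hneg,
      Finset.sum_range_succ, Finset.sum_range_succ, sub_self, h0, mul_one, mul_one,
      Finset.sum_congr rfl fun w hw => by rw [ih w (Finset.mem_range.mp hw)]] at hz
    exact Nat.add_left_cancel hz
  exact ⟨Equiv.ofFiberEquiv fun z => Fintype.equivOfCardEq (hcard z), fun i =>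
    Equiv.ofFiberEquiv_map _ i⟩

section HomogZ

variable {σ k : Type*} [Field k]

lemma homogZ_natCast (s : ℕ) : homogZ σ k s = homogeneousSubmodule σ k s := by
  simp [homogZ]

lemma homogZ_of_neg {z : ℤ} (hz : z < 0) : homogZ σ k z = ⊥ := by
  rw [homogZ, if_neg (by omega)]

lemma finrank_homogZ_of_neg {z : ℤ} (hz : z < 0) : Module.finrank k (homogZ σ k z) = 0 := by
  rw [homogZ_of_neg hz, finrank_bot]

lemma finrank_homogZ_zero : Module.finrank k (homogZ σ k 0) = 1 := by
  have := homogZ_natCast (σ := σ) (k := k) 0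
  rw [Nat.cast_zero] at this
  rw [this, homogeneousSubmodule_zero, Submodule.one_eq_span]
  exact finrank_span_singleton one_ne_zero

instance [Finite σ] (s : ℕ) : Module.Finite k (homogeneousSubmodule σ k s) :=
  Module.Finite.iff_fg.mpr (homogeneousSubmodule_fg σ k s)

instance [Finite σ] (z : ℤ) : Module.Finite k (homogZ σ k z) := by
  rcases lt_or_ge z 0 with hz | hz
  · rw [homogZ_of_neg hz]
    infer_instance
  · lift z to ℕ using hz
    rw [homogZ_natCast]
    infer_instance

lemma isHomogeneous_mul_of_mem_homogZ {s e : ℕ} {c a : MvPolynomial σ k}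
    (hc : c ∈ homogZ σ k ((s : ℤ) - e)) (ha : a.IsHomogeneous e) : (c * a).IsHomogeneous s := by
  by_cases h : e ≤ s
  · rw [← Nat.cast_sub h, homogZ_natCast] at hc
    simpa [Nat.sub_add_cancel h] using IsHomogeneous.mul hc ha
  · rw [homogZ_of_neg (by omega), Submodule.mem_bot] at hc
    rw [hc, zero_mul]
    exact isHomogeneous_zero _ _ _

end HomogZ

section GradedModule

variable {σ ι k M : Type*} [Field k] [Fintype ι] [AddCommGroup M] [Module (MvPolynomial σ k) M]
  [Module k M]

lemma sum_smul_mem_of_isHomogeneous {ℳ : ℕ → Submodule k M}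
    (hsmul : ∀ (i j : ℕ) (r : MvPolynomial σ k),
      r ∈ homogeneousSubmodule σ k i → ∀ m ∈ ℳ j, r • m ∈ ℳ (i + j))
    {D : ℕ} {g : ι → M} (hg : ∀ j, g j ∈ ℳ D) {s : ℕ} {v : ι → MvPolynomial σ k}
    (hv : ∀ j, (v j).IsHomogeneous s) : ∑ j, v j • g j ∈ ℳ (s + D) :=
  Submodule.sum_mem _ fun j _ => hsmul s D _ (hv j) _ (hg j)

lemma decompose_sum_smul {ℳ : ℕ → Submodule k M} [DirectSum.Decomposition ℳ]
    (hsmul : ∀ (i j : ℕ) (r : MvPolynomial σ k),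
      r ∈ homogeneousSubmodule σ k i → ∀ m ∈ ℳ j, r • m ∈ ℳ (i + j))
    {D : ℕ} {g : ι → M} (hg : ∀ j, g j ∈ ℳ D) (v : ι → MvPolynomial σ k) (s : ℕ) :
    (DirectSum.decompose ℳ (∑ j, v j • g j) (s + D) : M) = ∑ j, vecComponent ι s v j • g j := by
  let L := Fintype.linearCombination (MvPolynomial σ k) g
  change (DirectSum.decompose ℳ (L v) (s + D) : M) = L (vecComponent ι s v)
  obtain ⟨n, hn⟩ := exists_sum_vecComponent_eq v
  rw [← hn, map_sum L, map_sum (vecComponent ι s), map_sum L, DirectSum.decompose_sum,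
    DFinsupp.finsetSum_apply, Submodule.coe_sum]
  refine Finset.sum_congr rfl fun r _ => ?_
  have hr := vecComponent_isHomogeneous r v
  have hmem : L (vecComponent ι r v) ∈ ℳ (r + D) := sum_smul_mem_of_isHomogeneous hsmul hg hr
  rw [vecComponent_of_isHomogeneous hr]
  split_ifs with h
  · rw [h, DirectSum.decompose_of_mem_same ℳ hmem]
  · rw [DirectSum.decompose_of_mem_ne ℳ hmem (by omega), map_zero]

/-- Additivity of dimensions, degree by degree, along a graded free resolution
`0 → ⊕ R(-eᵢ) → R^ι → M → 0` whose middle term is generated in degree `D`. -/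
lemma card_mul_finrank_eq [Finite σ] [IsScalarTower k (MvPolynomial σ k) M]
    {ℳ : ℕ → Submodule k M} [DirectSum.Decomposition ℳ]
    (hsmul : ∀ (i j : ℕ) (r : MvPolynomial σ k),
      r ∈ homogeneousSubmodule σ k i → ∀ m ∈ ℳ j, r • m ∈ ℳ (i + j))
    {D : ℕ} {g : ι → M} (hg : ∀ j, g j ∈ ℳ D)
    (hgspan : Submodule.span (MvPolynomial σ k) (Set.range g) = ⊤)
    {κ : Type*} [Fintype κ] {e : κ → ℕ} {f : κ → ι → MvPolynomial σ k}
    (hf : ∀ i j, (f i j).IsHomogeneous (e i))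
    (hli : LinearIndependent (MvPolynomial σ k) f)
    (hker : ∀ v : ι → MvPolynomial σ k,
      ∑ j, v j • g j = 0 ↔ v ∈ Submodule.span (MvPolynomial σ k) (Set.range f)) (s : ℕ) :
    Fintype.card ι * Module.finrank k (homogZ σ k s) =
      Module.finrank k (ℳ (s + D)) + ∑ i, Module.finrank k (homogZ σ k ((s : ℤ) - e i)) := by
  let φ : (ι → homogeneousSubmodule σ k s) →ₗ[k] M :=
    ∑ j, (LinearMap.toSpanSingleton (MvPolynomial σ k) M (g j)).restrictScalars k ∘ₗ
      (homogeneousSubmodule σ k s).subtype ∘ₗ LinearMap.proj j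
  have hφ (w) : φ w = ∑ j, (w j : MvPolynomial σ k) • g j := by simp [φ]
  let ψ : (∀ i, homogZ σ k ((s : ℤ) - e i)) →ₗ[k] (ι → homogeneousSubmodule σ k s) :=
    { toFun := fun c j => ⟨∑ i, (c i : MvPolynomial σ k) * f i j,
        Submodule.sum_mem _ fun i _ => isHomogeneous_mul_of_mem_homogZ (c i).2 (hf i j)⟩
      map_add' := fun c d => by
        ext1 j
        ext1
        simp [add_mul, Finset.sum_add_distrib]
      map_smul' := fun a c => by
        ext1 j
        ext1
        simp [Finset.smul_sum] }
  have hψ (c j) : (ψ c j : MvPolynomial σ k) = (∑ i, (c i : MvPolynomial σ k) • f i) j := by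
    simp [ψ]
  have hψinj : Function.Injective ψ := by
    rw [injective_iff_map_eq_zero]
    intro c hc
    have hsum : ∑ i, (c i : MvPolynomial σ k) • f i = 0 := by
      ext1 j
      rw [← hψ, hc]
      rfl
    ext1 i
    ext1
    exact Fintype.linearIndependent_iff.mp hli _ hsum i
  have hφrange : LinearMap.range φ = ℳ (s + D) := by
    apply le_antisymm
    · rintro _ ⟨w, rfl⟩
      rw [hφ]
      exact sum_smul_mem_of_isHomogeneous hsmul hg fun j => (w j).2
    · intro m hm
      have : m ∈ Submodule.span (MvPolynomial σ k) (Set.range g) := by rw [hgspan]; trivial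
      obtain ⟨v, rfl⟩ := Submodule.mem_span_range_iff_exists_fun _ |>.mp this
      refine ⟨fun j => ⟨_, vecComponent_isHomogeneous s v j⟩, ?_⟩
      rw [hφ, ← DirectSum.decompose_of_mem_same ℳ hm, decompose_sum_smul hsmul hg]
  have hψrange : LinearMap.range ψ = LinearMap.ker φ := by
    ext w
    rw [LinearMap.mem_ker, hφ, hker]
    constructor
    · rintro ⟨c, rfl⟩
      exact (Submodule.mem_span_range_iff_exists_fun _).mpr
        ⟨fun i => c i, funext fun j => (hψ c j).symm⟩
    · intro hw
      obtain ⟨c, hc⟩ := Submodule.mem_span_range_iff_exists_fun _ |>.mp hw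
      refine ⟨fun i => ⟨if e i ≤ s then homogeneousComponent (s - e i) (c i) else 0, ?_⟩, ?_⟩
      · split_ifs with h
        · rw [← Nat.cast_sub h, homogZ_natCast]
          exact homogeneousComponent_mem _ _
        · exact Submodule.zero_mem _
      · ext1 j
        ext1
        rw [hψ]
        have hw' := vecComponent_of_isHomogeneous (fun j => (w j).2) s
        rw [if_pos rfl, ← hc, map_sum] at hw'
        have hcj := congrFun hc j
        simp only [vecComponent_smul_of_isHomogeneous (hf _)] at hw'
        rw [hw']
        exact hcj
  have hrank := LinearMap.finrank_range_add_finrank_ker φ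
  rw [hφrange, ← hψrange, LinearMap.finrank_range_of_inj hψinj, Module.finrank_pi_fintype,
    Module.finrank_pi_fintype] at hrank
  rw [hrank, homogZ_natCast]
  simp

end GradedModule

lemma degree_pos_of_minimal_generators {σ ι k M : Type*} [Field k] [Fintype ι] [AddCommGroup M]
    [Module (MvPolynomial σ k) M] {g : ι → M}
    (hgmin : ∀ j, g j ∉ Submodule.span (MvPolynomial σ k) (g '' {j' | j' ≠ j}))
    {e : ℕ} {v : ι → MvPolynomial σ k} (hv : ∀ j, (v j).IsHomogeneous e) (hv0 : v ≠ 0)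
    (hvg : ∑ j, v j • g j = 0) : 0 < e := by
  classical
  rw [Nat.pos_iff_ne_zero]
  rintro rfl
  obtain ⟨j, hj⟩ := Function.ne_iff.mp hv0
  have hvj : v j = C (coeff 0 (v j)) := by
    rw [← homogeneousComponent_zero, homogeneousComponent_eq_self (hv j)]
  have hc : coeff 0 (v j) ≠ 0 := by
    intro h
    rw [h, C_0] at hvj
    exact hj hvj
  apply hgmin j
  rw [← Finset.add_sum_erase _ _ (Finset.mem_univ j), add_eq_zero_iff_eq_neg] at hvg
  have hgj : g j = (C (coeff 0 (v j))⁻¹ : MvPolynomial σ k) • (v j • g j) := by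
    nth_rw 2 [hvj]
    rw [smul_smul, ← C_mul, inv_mul_cancel₀ hc, C_1, one_smul]
  rw [hgj, hvg]
  refine Submodule.smul_mem _ _ (Submodule.neg_mem _ (Submodule.sum_mem _ fun i hi =>
    Submodule.smul_mem _ _ (Submodule.subset_span ⟨i, Finset.ne_of_mem_erase hi, rfl⟩)))

/-!
STATEMENT 18 (Lemma L19.14).  Let `M` be a homogeneous (graded) module of projective
dimension one over the standard graded polynomial ring `R = k[x₁,…,x_N]`, all of whose
generators have degree `D`: `M` carries a grading `ℳ`, has a minimal homogeneous
generating set `g` in degree `D`, and the syzygy module of `g` is free (pd M = 1).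
If `b₀`, `b₁`, `t₁ ≤ ⋯ ≤ t_{b₁}` are integers with `D < tᵢ` and
`λ(M_z) = b₀·λ(R(−D)_z) − Σᵢ λ(R(−tᵢ)_z)` for all `z`, then the minimal homogeneous
free resolution of `M` has the form `0 → ⊕ᵢ R(−tᵢ) → R(−D)^{b₀} → M → 0`; i.e.
`p = b₀` and the syzygies of `g` admit a free homogeneous basis of degrees `tᵢ`.
-/

theorem minimal_resolution_determined_by_hilbert_function
    {k : Type*} [Field k] (N : ℕ)
    {M : Type*} [AddCommGroup M] [Module (MvPolynomial (Fin N) k) M]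
    [Module k M] [IsScalarTower k (MvPolynomial (Fin N) k) M]
    (ℳ : ℕ → Submodule k M) [DirectSum.Decomposition ℳ]
    (hsmul : ∀ (i j : ℕ) (r : MvPolynomial (Fin N) k),
      r ∈ homogeneousSubmodule (Fin N) k i → ∀ m ∈ ℳ j, r • m ∈ ℳ (i + j))
    (D : ℕ) (p : ℕ) (g : Fin p → M)
    (hgdeg : ∀ j, g j ∈ ℳ D)
    (hgspan : Submodule.span (MvPolynomial (Fin N) k) (Set.range g) = ⊤)
    (hgmin : ∀ j, g j ∉ Submodule.span (MvPolynomial (Fin N) k) (g '' {j' | j' ≠ j}))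
    (hpd : ∃ (q : ℕ) (sy : Fin q → (Fin p → MvPolynomial (Fin N) k)),
      LinearIndependent (MvPolynomial (Fin N) k) sy ∧
      ∀ v : Fin p → MvPolynomial (Fin N) k,
        (∑ i, v i • g i = 0) ↔
          v ∈ Submodule.span (MvPolynomial (Fin N) k) (Set.range sy))
    (b₀ b₁ : ℕ) (t : Fin b₁ → ℕ) (hmono : Monotone t) (ht : ∀ i, D < t i)
    (hHF : ∀ z : ℕ, (Module.finrank k ↥(ℳ z) : ℤ) =
      b₀ * (Module.finrank k ↥(homogZ (Fin N) k ((z : ℤ) - D)) : ℤ)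
        - ∑ i, (Module.finrank k ↥(homogZ (Fin N) k ((z : ℤ) - t i)) : ℤ)) :
    p = b₀ ∧
    ∃ sy : Fin b₁ → (Fin p → MvPolynomial (Fin N) k),
      (∀ i j, (sy i j).IsHomogeneous (t i - D)) ∧
      LinearIndependent (MvPolynomial (Fin N) k) sy ∧
      ∀ v : Fin p → MvPolynomial (Fin N) k,
        (∑ i, v i • g i = 0) ↔
          v ∈ Submodule.span (MvPolynomial (Fin N) k) (Set.range sy) := by
  obtain ⟨q, sy, hsy, hker⟩ := hpd
  have hS : ∀ v ∈ Submodule.span (MvPolynomial (Fin N) k) (Set.range sy), ∀ s,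
      vecComponent (Fin p) s v ∈ Submodule.span (MvPolynomial (Fin N) k) (Set.range sy) := by
    intro v hv s
    rw [← hker] at hv ⊢
    rw [← decompose_sum_smul hsmul hgdeg, hv]
    simp
  obtain ⟨e, f, hf, hli, hspan⟩ :=
    exists_isHomogeneous_basis _ hS (Module.Basis.span hsy)
  rw [← hspan] at hker
  have hfg (i) : ∑ j, f i j • g j = 0 := (hker _).mpr (Submodule.subset_span ⟨i, rfl⟩)
  have hpos (i) : 0 < e i :=
    degree_pos_of_minimal_generators hgmin (hf i) (hli.ne_zero i) (hfg i)
  have hdim := card_mul_finrank_eq hsmul hgdeg hgspan hf hli hker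
  simp only [Fintype.card_fin] at hdim
  have hp : p = b₀ := by
    have h1 := hdim 0
    have h2 := hHF D
    rw [Finset.sum_eq_zero fun i _ => finrank_homogZ_of_neg (by have := hpos i; omega),
      Nat.cast_zero, finrank_homogZ_zero, zero_add] at h1
    rw [Finset.sum_eq_zero fun i _ => by
      rw [finrank_homogZ_of_neg (by have := ht i; omega), Nat.cast_zero], sub_self,
      finrank_homogZ_zero] at h2
    omega
  obtain ⟨u, hu⟩ := exists_equiv_of_sum_comp_sub_eq
    (fun z => Module.finrank k (homogZ (Fin N) k z)) (fun _ => finrank_homogZ_of_neg)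
    finrank_homogZ_zero (fun i => t i - D) e fun s => by
      have h1 := hdim s
      have h2 := hHF (s + D)
      have h3 (i) : ((s + D : ℕ) : ℤ) - t i = (s : ℤ) - (t i - D : ℕ) := by
        have := ht i
        omega
      rw [Finset.sum_congr rfl fun i _ => by rw [h3 i], Nat.cast_add, add_sub_cancel_right, ← hp] at h2
      zify at h1 ⊢
      linarith
  refine ⟨hp, f ∘ u, fun i j => hu i ▸ hf (u i) j, hli.comp _ u.injective, fun v => ?_⟩
  rw [hker, u.surjective.range_comp]
end
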